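/- Let p be a prime number and G a finite abelian group of order p. Let n be an integer with 2 ≤ n ≤ p, and assume p does not divide the class number of ℚ(ζ_p + ζ_p^{−1}) (Vandiver's conjecture for p). Let M be an invertible ℤ[G]-module, i.e. a finitely generated projective ℤ[G]-module for which there exists a ℤ[G]-module N with M ⊗_{ℤ[G]} N ≅ ℤ[G]. Suppose M admits an n-cubic structure, i.e. a ℤ[Gⁿ]-module isomorphism c : ℤ[Gⁿ] ≅ Θ_n(M) such that for some generator t of ℚ ⊗_ℤ M as a free rank-one ℚ[G]-module, c(1) = a · Θ_n(t) where a ∈ ℚ[Gⁿ]ˣ is n-cubic (rigid, symmetric, and satisfying the cocycle condition). Then M is a free ℤ[G]-module of rank one. -/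

import Mathlib

set_option linter.unusedSectionVars false
set_option maxHeartbeats 1000000
set_option synthInstance.maxHeartbeats 400000

open scoped TensorProduct BigOperators

noncomputable section

namespace CubicStructure

variable (G : Type) [CommGroup G] [Fintype G] (n : ℕ)

/-- The group ring `ℤ[G]`. -/
abbrev R : Type := MonoidAlgebra ℤ G

/-- The group ring `ℤ[Gⁿ]`. -/
abbrev S : Type := MonoidAlgebra ℤ (Fin n → G)

/-- The group algebra `ℚ[G]`. -/
abbrev RQ : Type := MonoidAlgebra ℚ G

/-- The group algebra `ℚ[Gⁿ]`. -/
abbrev SQ : Type := MonoidAlgebra ℚ (Fin n → G)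

/-- For a subset `I ⊆ {1,…,n}`, the group homomorphism `δ_I : G → Gⁿ` sending `g`
to the element whose `i`-th coordinate is `g` for `i ∈ I` and the identity otherwise. -/
def delta (I : Finset (Fin n)) : G →* (Fin n → G) where
  toFun g i := if i ∈ I then g else 1
  map_one' := by funext i; simp
  map_mul' g h := by funext i; by_cases hi : i ∈ I <;> simp [hi]

/-- The induced ring homomorphism `Δ_I : ℤ[G] → ℤ[Gⁿ]`. -/
def deltaHom (I : Finset (Fin n)) : R G →+* S G n :=
  MonoidAlgebra.mapDomainRingHom ℤ (delta G n I)

/-- The induced ring homomorphism `Δ_I : ℚ[G] → ℚ[Gⁿ]`. -/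
def deltaHomQ (I : Finset (Fin n)) : RQ G →+* SQ G n :=
  MonoidAlgebra.mapDomainRingHom ℚ (delta G n I)

/-- The coefficient-extension homomorphism `ℤ[G] → ℚ[G]`. -/
def iotaR : R G →+* RQ G :=
  (MonoidAlgebra.lift ℤ (RQ G) G (MonoidAlgebra.of ℚ G)).toRingHom

/-- The coefficient-extension homomorphism `ℤ[Gⁿ] → ℚ[Gⁿ]`. -/
def iotaS : S G n →+* SQ G n :=
  (MonoidAlgebra.lift ℤ (SQ G n) (Fin n → G) (MonoidAlgebra.of ℚ (Fin n → G))).toRingHom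

/-- `ℤ[Gⁿ]` regarded as a `ℤ[G]`-module via `Δ_I`. -/
def Sv (_I : Finset (Fin n)) : Type := MonoidAlgebra ℤ (Fin n → G)

instance (I : Finset (Fin n)) : AddCommGroup (Sv G n I) :=
  inferInstanceAs (AddCommGroup (MonoidAlgebra ℤ (Fin n → G)))

instance (I : Finset (Fin n)) : Module (S G n) (Sv G n I) :=
  inferInstanceAs (Module (S G n) (S G n))

instance (I : Finset (Fin n)) : Module (R G) (Sv G n I) :=
  Module.compHom (S G n) (deltaHom G n I)

instance (I : Finset (Fin n)) : SMulCommClass (R G) (S G n) (Sv G n I) :=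
  ⟨fun r s x => mul_left_comm (deltaHom G n I r) s x⟩

/-- The identity map, regarding an element of `ℤ[Gⁿ]` as an element of `Sv`. -/
def mkSv (I : Finset (Fin n)) : MonoidAlgebra ℤ (Fin n → G) → Sv G n I := id

/-- `ℚ[Gⁿ]` regarded as a `ℚ[G]`-module via `Δ_I`. -/
def SQv (_I : Finset (Fin n)) : Type := MonoidAlgebra ℚ (Fin n → G)

instance (I : Finset (Fin n)) : AddCommGroup (SQv G n I) :=
  inferInstanceAs (AddCommGroup (MonoidAlgebra ℚ (Fin n → G)))

instance (I : Finset (Fin n)) : Module (SQ G n) (SQv G n I) :=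
  inferInstanceAs (Module (SQ G n) (SQ G n))

instance (I : Finset (Fin n)) : Module (RQ G) (SQv G n I) :=
  Module.compHom (SQ G n) (deltaHomQ G n I)

instance (I : Finset (Fin n)) : SMulCommClass (RQ G) (SQ G n) (SQv G n I) :=
  ⟨fun r s x => mul_left_comm (deltaHomQ G n I r) s x⟩

/-- The identity map, regarding an element of `ℚ[Gⁿ]` as an element of `SQv`. -/
def mkSQv (I : Finset (Fin n)) : MonoidAlgebra ℚ (Fin n → G) → SQv G n I := id

/-- `ℚ[G]` regarded as a `ℤ[G]`-module via the coefficient extension. -/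
def RQv : Type := MonoidAlgebra ℚ G

instance : AddCommGroup (RQv G) := inferInstanceAs (AddCommGroup (MonoidAlgebra ℚ G))

instance : Module (RQ G) (RQv G) := inferInstanceAs (Module (RQ G) (RQ G))

instance : Module (R G) (RQv G) := Module.compHom (RQ G) (iotaR G)

instance : SMulCommClass (R G) (RQ G) (RQv G) :=
  ⟨fun r s x => mul_left_comm (iotaR G r) s x⟩

/-- The identity map, regarding an element of `ℚ[G]` as an element of `RQv`. -/
def mkRQv : MonoidAlgebra ℚ G → RQv G := id

variable (M : Type) [AddCommGroup M] [Module (R G) M]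

/-- `Δ_I(M) = ℤ[Gⁿ] ⊗_{Δ_I, ℤ[G]} M`, a `ℤ[Gⁿ]`-module. -/
abbrev DM (I : Finset (Fin n)) : Type := TensorProduct (R G) (Sv G n I) M

/-- `M_ℚ = ℚ ⊗_ℤ M`, realized as `ℚ[G] ⊗_{ℤ[G]} M`, a `ℚ[G]`-module. -/
abbrev MQ : Type := TensorProduct (R G) (RQv G) M

/-- `Δ_I(M)_ℚ = ℚ[Gⁿ] ⊗_{Δ_I, ℚ[G]} M_ℚ`, a `ℚ[Gⁿ]`-module. -/
abbrev DMQ (I : Finset (Fin n)) : Type := TensorProduct (RQ G) (SQv G n I) (MQ G M)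

/-- `Δ_I(t) = 1 ⊗ t ∈ Δ_I(M)_ℚ` for `t ∈ M_ℚ`. -/
def deltaT (I : Finset (Fin n)) (t : MQ G M) : DMQ G n M I :=
  TensorProduct.tmul (RQ G) (mkSQv G n I 1) t

/-- The `I`-th factor `Δ_I(M)^{(−1)^{n−#I}}` of `Θ_n(M)`: it is `Δ_I(M)` when
`n − #I` is even, and the `ℤ[Gⁿ]`-dual `Hom_{ℤ[Gⁿ]}(Δ_I(M), ℤ[Gⁿ])` when `n − #I`
is odd. -/
def fam (I : Finset (Fin n)) : ModuleCat (S G n) :=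
  if Even (n - I.card) then ModuleCat.of (S G n) (DM G n M I)
  else ModuleCat.of (S G n) (Module.Dual (S G n) (DM G n M I))

theorem fam_even (I : Finset (Fin n)) (h : Even (n - I.card)) :
    (fam G n M I : Type) = DM G n M I := by
  unfold fam
  rw [if_pos h]

theorem fam_odd (I : Finset (Fin n)) (h : ¬ Even (n - I.card)) :
    (fam G n M I : Type) = Module.Dual (S G n) (DM G n M I) := by
  unfold fam
  rw [if_neg h]

/-- Regard an element of `Δ_I(M)` as an element of the `I`-th factor of `Θ_n(M)`
(case `n − #I` even). -/
def toFamEven (I : Finset (Fin n)) (h : Even (n - I.card)) (x : DM G n M I) :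
    fam G n M I := cast (fam_even G n M I h).symm x

/-- Regard a functional on `Δ_I(M)` as an element of the `I`-th factor of `Θ_n(M)`
(case `n − #I` odd). -/
def toFamOdd (I : Finset (Fin n)) (h : ¬ Even (n - I.card))
    (f : Module.Dual (S G n) (DM G n M I)) : fam G n M I :=
  cast (fam_odd G n M I h).symm f

/-- The `I`-th factor `Δ_I(M)_ℚ^{(−1)^{n−#I}}` of `Θ_n(M)_ℚ`. -/
def famQ (I : Finset (Fin n)) : ModuleCat (SQ G n) :=
  if Even (n - I.card) then ModuleCat.of (SQ G n) (DMQ G n M I)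
  else ModuleCat.of (SQ G n) (Module.Dual (SQ G n) (DMQ G n M I))

instance (I : Finset (Fin n)) : Module (S G n) (famQ G n M I) :=
  Module.compHom (famQ G n M I) (iotaS G n)

theorem famQ_even (I : Finset (Fin n)) (h : Even (n - I.card)) :
    (famQ G n M I : Type) = DMQ G n M I := by
  unfold famQ
  rw [if_pos h]

theorem famQ_odd (I : Finset (Fin n)) (h : ¬ Even (n - I.card)) :
    (famQ G n M I : Type) = Module.Dual (SQ G n) (DMQ G n M I) := by
  unfold famQ
  rw [if_neg h]

/-- Regard an element of `Δ_I(M)_ℚ` as an element of the `I`-th factor of `Θ_n(M)_ℚ`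
(case `n − #I` even). -/
def toFamQEven (I : Finset (Fin n)) (h : Even (n - I.card)) (x : DMQ G n M I) :
    famQ G n M I := cast (famQ_even G n M I h).symm x

/-- Regard an element of the `I`-th factor of `Θ_n(M)_ℚ` as a functional on
`Δ_I(M)_ℚ` (case `n − #I` odd). -/
def famQToDual (I : Finset (Fin n)) (h : ¬ Even (n - I.card)) (x : famQ G n M I) :
    Module.Dual (SQ G n) (DMQ G n M I) := cast (famQ_odd G n M I h) x

/-- `Θ_n(M) = ⊗_{I ⊆ {1,…,n}} Δ_I(M)^{(−1)^{n−#I}}`, the tensor product being taken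
over `ℤ[Gⁿ]`. -/
abbrev Theta : Type := PiTensorProduct (S G n) (fun I => (fam G n M I : Type))

/-- `Θ_n(M)_ℚ`, the corresponding tensor product over `ℚ[Gⁿ]` of the rationalized
factors. -/
abbrev ThetaQ : Type := PiTensorProduct (SQ G n) (fun I => (famQ G n M I : Type))

instance : Module (S G n) (ThetaQ G n M) :=
  Module.compHom (ThetaQ G n M) (iotaS G n)

/-- The automorphism `𝓘_σ : Gⁿ → Gⁿ`, `(g₁,…,gₙ) ↦ (g_{σ(1)},…,g_{σ(n)})`. -/
def permHom (σ : Equiv.Perm (Fin n)) : (Fin n → G) →* (Fin n → G) where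
  toFun g := fun i => g (σ i)
  map_one' := rfl
  map_mul' _ _ := rfl

/-- `𝓘₀ : Gⁿ → G^{n+1}`, `(g₁,…,gₙ) ↦ (g₁,g₁,g₂,…,gₙ)`. -/
def cubI0 (hn : 2 ≤ n) : (Fin n → G) →* (Fin (n + 1) → G) :=
  Pi.monoidHom fun j =>
    Pi.evalMonoidHom (fun _ : Fin n => G) ⟨j.val - 1, by have := j.isLt; omega⟩

/-- `𝓘₁ : Gⁿ → G^{n+1}`, `(g₁,…,gₙ) ↦ (e,g₁,g₂,…,gₙ)`. -/
def cubI1 (hn : 2 ≤ n) : (Fin n → G) →* (Fin (n + 1) → G) :=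
  Pi.monoidHom fun j =>
    if j.val = 0 then 1
    else Pi.evalMonoidHom (fun _ : Fin n => G) ⟨j.val - 1, by have := j.isLt; omega⟩

/-- `𝓘₂ : Gⁿ → G^{n+1}`, `(g₁,…,gₙ) ↦ (g₁,g₂,e,g₃,…,gₙ)`. -/
def cubI2 (hn : 2 ≤ n) : (Fin n → G) →* (Fin (n + 1) → G) :=
  Pi.monoidHom fun j =>
    if j.val = 2 then 1
    else if h : j.val < 2 then Pi.evalMonoidHom (fun _ : Fin n => G) ⟨j.val, by omega⟩
    else Pi.evalMonoidHom (fun _ : Fin n => G) ⟨j.val - 1, by have := j.isLt; omega⟩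

/-- `𝓘₃ : Gⁿ → G^{n+1}`, `(g₁,…,gₙ) ↦ (g₁,g₂,g₂,g₃,…,gₙ)`. -/
def cubI3 (hn : 2 ≤ n) : (Fin n → G) →* (Fin (n + 1) → G) :=
  Pi.monoidHom fun j =>
    if h : j.val < 2 then Pi.evalMonoidHom (fun _ : Fin n => G) ⟨j.val, by omega⟩
    else if j.val = 2 then Pi.evalMonoidHom (fun _ : Fin n => G) ⟨1, by omega⟩
    else Pi.evalMonoidHom (fun _ : Fin n => G) ⟨j.val - 1, by have := j.isLt; omega⟩

/-- `M` admits an `n`-cubic structure: there is a `ℤ[Gⁿ]`-module isomorphism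
`c : ℤ[Gⁿ] ≅ Θ_n(M)` such that for some generator `t` of `ℚ ⊗_ℤ M` as a free
rank-one `ℚ[G]`-module, `c(1) = a·Θ_n(t)` in `Θ_n(M)_ℚ`, where `a ∈ ℚ[Gⁿ]ˣ` is
`n`-cubic (rigid, symmetric, and satisfying the cocycle condition).  Here
`Θ_n(t) = ⊗_I Δ_I(t)^{(−1)^{n−#I}}` is the tensor of the elements `Δ_I(t) = 1 ⊗ t`
for the factors with exponent `+1` and of the corresponding dual generators (the
functionals sending `Δ_I(t)` to `1`) for the factors with exponent `−1`; the
comparison of `Θ_n(M)` with `Θ_n(M)_ℚ` is through the canonical rationalization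
maps `ρ_I` and `κ` (which are uniquely determined by the properties listed below). -/
def HasCubicStructure (hn : 2 ≤ n) : Prop :=
  ∃ (c : S G n ≃ₗ[S G n] Theta G n M) (a : (SQ G n)ˣ) (t : MQ G M)
    (τ : ∀ I : Finset (Fin n), (famQ G n M I : Type))
    (ρ : ∀ I : Finset (Fin n),
      (fam G n M I : Type) →ₗ[S G n] (famQ G n M I : Type))
    (κ : Theta G n M →ₗ[S G n] ThetaQ G n M),
    -- `a` is rigid
    (MonoidAlgebra.lift ℚ ℚ (Fin n → G) (1 : (Fin n → G) →* ℚ)) (↑a : SQ G n) = 1 ∧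
    -- `a` is symmetric
    (∀ σ : Equiv.Perm (Fin n),
      MonoidAlgebra.mapDomainRingHom ℚ (permHom G n σ) (↑a : SQ G n) = (↑a : SQ G n)) ∧
    -- `a` satisfies the cocycle condition
    (MonoidAlgebra.mapDomainRingHom ℚ (cubI0 G n hn) (↑a : SQ G n) *
        MonoidAlgebra.mapDomainRingHom ℚ (cubI2 G n hn) (↑a : SQ G n) =
      MonoidAlgebra.mapDomainRingHom ℚ (cubI1 G n hn) (↑a : SQ G n) *
        MonoidAlgebra.mapDomainRingHom ℚ (cubI3 G n hn) (↑a : SQ G n)) ∧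
    -- `t` generates `ℚ ⊗ M` as a free rank-one `ℚ[G]`-module
    Function.Bijective (LinearMap.toSpanSingleton (RQ G) (MQ G M) t) ∧
    -- `τ` is the family of factors of `Θ_n(t)`: `Δ_I(t)` for even `n − #I` …
    (∀ (I : Finset (Fin n)) (h : Even (n - I.card)),
      τ I = toFamQEven G n M I h (deltaT G n M I t)) ∧
    -- … and the dual generator of `Δ_I(t)` for odd `n − #I`
    (∀ (I : Finset (Fin n)) (h : ¬ Even (n - I.card)),
      famQToDual G n M I h (τ I) (deltaT G n M I t) = 1) ∧
    -- `ρ_I` is the canonical rationalization map on the `I`-th factor (even case) …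
    (∀ (I : Finset (Fin n)) (h : Even (n - I.card)) (s : MonoidAlgebra ℤ (Fin n → G))
        (m : M),
      ρ I (toFamEven G n M I h (TensorProduct.tmul (R G) (mkSv G n I s) m)) =
        toFamQEven G n M I h
          (TensorProduct.tmul (RQ G) (mkSQv G n I (iotaS G n s))
            (TensorProduct.tmul (R G) (mkRQv G 1) m))) ∧
    -- … and in the odd case
    (∀ (I : Finset (Fin n)) (h : ¬ Even (n - I.card))
        (f : Module.Dual (S G n) (DM G n M I)) (s : MonoidAlgebra ℤ (Fin n → G))
        (m : M),
      famQToDual G n M I h (ρ I (toFamOdd G n M I h f))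
          (TensorProduct.tmul (RQ G) (mkSQv G n I (iotaS G n s))
            (TensorProduct.tmul (R G) (mkRQv G 1) m)) =
        iotaS G n (f (TensorProduct.tmul (R G) (mkSv G n I s) m))) ∧
    -- `κ` is the canonical rationalization map `Θ_n(M) → Θ_n(M)_ℚ`
    (∀ v : (∀ I : Finset (Fin n), (fam G n M I : Type)),
      κ (PiTensorProduct.tprod (S G n) v) =
        PiTensorProduct.tprod (SQ G n) (fun I => ρ I (v I))) ∧
    -- the trivialization `c` satisfies `c(1) = a · Θ_n(t)`
    κ (c 1) = (↑a : SQ G n) • PiTensorProduct.tprod (SQ G n) τ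

end CubicStructure

section
/-- nilpotent dimension bound -/
theorem cub_dim_le {F V : Type*} [Field F] [AddCommGroup V] [Module F V] [FiniteDimensional F V]
    (T : V →ₗ[F] V) (k : ℕ) :
    Module.finrank F (LinearMap.ker (T ^ k)) ≤ k * Module.finrank F (LinearMap.ker T) := by
  induction k with
  | zero => 
    have : LinearMap.ker (T ^ 0) = ⊥ := by
      rw [pow_zero]; exact LinearMap.ker_eq_bot.2 (fun x y h => h)
    rw [this]; simp
  | succ k ih =>
    let W := LinearMap.ker (T ^ (k+1))
    have hmap : ∀ x ∈ W, (T^k) x ∈ LinearMap.ker T := by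
      intro x hx
      rw [LinearMap.mem_ker] at hx ⊢
      rwa [pow_succ', Module.End.mul_apply] at hx
    let g : W →ₗ[F] LinearMap.ker T := (T^k).restrict hmap
    have h1 := LinearMap.finrank_range_add_finrank_ker g
    have h2 : Module.finrank F (LinearMap.range g) ≤ Module.finrank F (LinearMap.ker T) :=
      Submodule.finrank_le _
    have h3 : Module.finrank F (LinearMap.ker g) ≤ Module.finrank F (LinearMap.ker (T^k)) := by
      let e : LinearMap.ker g →ₗ[F] LinearMap.ker (T^k) :=
        LinearMap.codRestrict _ (W.subtype ∘ₗ (LinearMap.ker g).subtype) (by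
          rintro ⟨x, hx⟩
          rw [LinearMap.mem_ker] at hx ⊢
          have := congrArg Subtype.val hx
          exact this)
      apply LinearMap.finrank_le_finrank_of_injective (f := e)
      intro x y h
      have := congrArg Subtype.val h
      exact Subtype.ext (Subtype.ext this)
    have : Module.finrank F W ≤ (k+1) * Module.finrank F (LinearMap.ker T) := by
      rw [add_mul, one_mul]; omega
    exact this

/-- If `ker N ⊆ range (1-σ)` then `rank Λ ≤ p * rank Λ^σ`. -/
theorem cub_rank_le {p : ℕ} (hp : p.Prime) {A : Type*} [AddCommGroup A] [Module.Free ℤ A]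
    [Module.Finite ℤ A] (s : A →ₗ[ℤ] A) (hs : s ^ p = 1)
    (H : ∀ y : A, (∑ i ∈ Finset.range p, (s ^ i) y) = 0 → ∃ z, y = z - s z) :
    Module.finrank ℤ A ≤ p * Module.finrank ℤ (LinearMap.ker (1 - s)) := by
  have : Fact p.Prime := ⟨hp⟩
  let V := TensorProduct ℤ (ZMod p) A
  let B := LinearMap.ker (1 - s)
  let b := Module.Free.chooseBasis ℤ A
  let T : V →ₗ[ZMod p] V := LinearMap.baseChange (ZMod p) (1 - s)
  have hV : Module.finrank (ZMod p) V = Module.finrank ℤ A := Module.finrank_baseChange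
  have hsurj : ∀ v : V, ∃ a : A, v = (1 : ZMod p) ⊗ₜ[ℤ] a := by
    intro v
    induction v using TensorProduct.induction_on with
    | zero => exact ⟨0, by simp⟩
    | tmul z a =>
      refine ⟨(z.val : ℤ) • a, ?_⟩
      rw [← TensorProduct.smul_tmul]
      congr 1
      simp
    | add x y hx hy =>
      obtain ⟨a, rfl⟩ := hx
      obtain ⟨c, rfl⟩ := hy
      exact ⟨a + c, by rw [TensorProduct.tmul_add]⟩
  have hker : ∀ a : A, (1 : ZMod p) ⊗ₜ[ℤ] a = 0 → ∃ y : A, a = (p : ℤ) • y := by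
    intro a ha
    have h1 : ∀ i, (p : ℤ) ∣ b.repr a i := by
      intro i
      have h2 := congrArg (fun v => (b.baseChange (ZMod p)).repr v i) ha
      simp only [Module.Basis.baseChange_repr_tmul, map_zero, Finsupp.zero_apply] at h2
      rw [← ZMod.intCast_zmod_eq_zero_iff_dvd (b.repr a i) p]
      simpa using h2
    choose f hf using h1
    refine ⟨∑ i, f i • b i, ?_⟩
    rw [Finset.smul_sum, ← b.sum_repr a]
    refine Finset.sum_congr rfl fun i _ => ?_
    rw [hf i, mul_smul]
  have hTp : T ^ p = 0 := by
    by_cases hn : Subsingleton V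
    · exact LinearMap.ext fun x => Subsingleton.elim _ _
    have hnt : Nontrivial V := not_subsingleton_iff_nontrivial.1 hn
    have : CharP (Module.End (ZMod p) V) p :=
      charP_of_injective_algebraMap (algebraMap (ZMod p) (Module.End (ZMod p) V)).injective p
    have hT : T = 1 - LinearMap.baseChange (ZMod p) s := by
      simp only [T]
      rw [LinearMap.baseChange_sub]
      congr 1
      exact LinearMap.baseChange_id
    rw [hT, sub_pow_char_of_commute _ (Commute.one_left _), one_pow, ← LinearMap.baseChange_pow, hs]
    rw [sub_eq_zero]
    exact LinearMap.baseChange_id.symm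
  have h1 := cub_dim_le T p
  rw [hTp, LinearMap.ker_zero, finrank_top, hV] at h1
  refine h1.trans (Nat.mul_le_mul_left p ?_)
  let β := LinearMap.baseChange (ZMod p) B.subtype
  have hle : LinearMap.ker T ≤ LinearMap.range β := by
    intro v hv
    obtain ⟨x, rfl⟩ := hsurj v
    rw [LinearMap.mem_ker, LinearMap.baseChange_tmul] at hv
    obtain ⟨y, hy⟩ := hker _ hv
    have hN : ∑ i ∈ Finset.range p, (s ^ i) y = 0 := by
      have h3 : (p : ℤ) • ∑ i ∈ Finset.range p, (s ^ i) y = 0 := by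
        rw [Finset.smul_sum]
        simp_rw [← map_smul, ← hy]
        have h4 : (∑ i ∈ Finset.range p, s ^ i) * (1 - s) = 0 := by
          have := geom_sum_mul_neg s p
          rw [this, hs, sub_self]
        have := LinearMap.congr_fun h4 x
        simpa [LinearMap.sum_apply] using this
      exact (smul_eq_zero.1 h3).resolve_left (by exact_mod_cast hp.ne_zero)
    obtain ⟨z, hz⟩ := H y hN
    have hB : x - (p : ℤ) • z ∈ B := by
      rw [LinearMap.mem_ker, map_sub, map_smul, hy, hz]
      simp
    refine ⟨1 ⊗ₜ ⟨_, hB⟩, ?_⟩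
    simp only [β, LinearMap.baseChange_tmul, Submodule.subtype_apply, TensorProduct.tmul_sub]
    rw [TensorProduct.tmul_smul, TensorProduct.smul_tmul']
    simp
  calc _ ≤ Module.finrank (ZMod p) (LinearMap.range β) := Submodule.finrank_mono hle
    _ ≤ Module.finrank (ZMod p) (TensorProduct ℤ (ZMod p) B) := LinearMap.finrank_range_le _
    _ = _ := Module.finrank_baseChange
end

section
/-- Unramified descent of invariant ideals. -/
theorem cub_descent {A B : Type*} [CommRing A] [CommRing B] [Algebra A B] (p : ℕ) (hp : 0 < p)
    (σ : B →+* B)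
    (hTr : ∀ x : B, ∃ a : A, algebraMap A B a = ∑ i ∈ Finset.range p, (σ ^ i) x)
    (hD : ∀ i, 0 < i → i < p → Ideal.span (Set.range fun b : B => b - (σ ^ i) b) = ⊤)
    (I : Ideal B) (hI : ∀ x ∈ I, σ x ∈ I) :
    Ideal.map (algebraMap A B) (Ideal.comap (algebraMap A B) I) = I := by
  apply le_antisymm Ideal.map_comap_le
  let f : B → B → ℕ → B := fun x y j => x * (σ ^ j) y
  let W : AddSubgroup (ℕ → B) := AddSubgroup.closure {w | ∃ x y, w = f x y}
  have hf : ∀ x y, f x y ∈ W := fun x y => AddSubgroup.subset_closure ⟨x, y, rfl⟩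
  have hmul : ∀ u ∈ W, ∀ v ∈ W, u * v ∈ W := by
    intro u hu v hv
    induction hu using AddSubgroup.closure_induction with
    | mem u hu =>
      obtain ⟨x, y, rfl⟩ := hu
      induction hv using AddSubgroup.closure_induction with
      | mem v hv =>
        obtain ⟨x', y', rfl⟩ := hv
        have : f x y * f x' y' = f (x * x') (y * y') := by
          funext j; simp only [f, Pi.mul_apply, map_mul]; ring
        rw [this]; exact hf _ _
      | zero => rw [mul_zero]; exact W.zero_mem
      | add a b _ _ ha hb => rw [mul_add]; exact W.add_mem ha hb
      | neg a _ ha => rw [mul_neg]; exact W.neg_mem ha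
    | zero => rw [zero_mul]; exact W.zero_mem
    | add a b _ _ ha hb => rw [add_mul]; exact W.add_mem ha hb
    | neg a _ ha => rw [neg_mul]; exact W.neg_mem ha
  have h1 : ∀ i, 0 < i → i < p → ∃ w ∈ W, w 0 = 1 ∧ w i = 0 := by
    intro i hi hip
    have h : (1 : B) ∈ Ideal.span (Set.range fun b : B => b - (σ ^ i) b) := by
      rw [hD i hi hip]; trivial
    have key : ∀ z ∈ Ideal.span (Set.range fun b : B => b - (σ ^ i) b),
        ∃ w ∈ W, w 0 = z ∧ w i = 0 := by
      intro z hz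
      induction hz using Submodule.span_induction with
      | mem z hz =>
        obtain ⟨b, rfl⟩ := hz
        refine ⟨f 1 b - f ((σ ^ i) b) 1, W.sub_mem (hf _ _) (hf _ _), ?_, ?_⟩ <;> simp [f]
      | zero => exact ⟨0, W.zero_mem, rfl, rfl⟩
      | add x y _ _ hx hy =>
        obtain ⟨u, hu, h1, h2⟩ := hx
        obtain ⟨v, hv, h3, h4⟩ := hy
        exact ⟨u + v, W.add_mem hu hv, by simp [h1, h3], by simp [h2, h4]⟩
      | smul a x _ hx =>
        obtain ⟨u, hu, h1, h2⟩ := hx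
        exact ⟨f a 1 * u, hmul _ (hf _ _) _ hu, by simp [h1, f], by simp [h2]⟩
    exact key 1 h
  have h2 : ∃ w ∈ W, w 0 = 1 ∧ ∀ i, 0 < i → i < p → w i = 0 := by
    have : ∀ k, k ≤ p → ∃ w ∈ W, w 0 = 1 ∧ ∀ i, 0 < i → i < k → w i = 0 := by
      intro k
      induction k with
      | zero => exact fun _ => ⟨f 1 1, hf _ _, by simp [f], fun i _ h => by omega⟩
      | succ k ih =>
        intro hk
        obtain ⟨w, hw, h0, hwi⟩ := ih (by omega)
        rcases Nat.eq_zero_or_pos k with rfl | hk0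
        · exact ⟨w, hw, h0, fun i _ h => by omega⟩
        obtain ⟨u, hu, hu0, hui⟩ := h1 k hk0 (by omega)
        refine ⟨w * u, hmul _ hw _ hu, by simp [h0, hu0], fun i hi hik => ?_⟩
        rcases Nat.lt_or_ge i k with h | h
        · simp [hwi i hi h]
        · obtain rfl : i = k := by omega
          simp [hui]
    exact this p le_rfl
  have hI' : ∀ j, ∀ x ∈ I, (σ ^ j) x ∈ I := by
    intro j
    induction j with
    | zero => intro x hx; simpa using hx
    | succ j ih => intro x hx; rw [pow_succ]; exact ih _ (hI x hx)
  obtain ⟨w, hw, h0, hwi⟩ := h2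
  intro m hm
  have h3 : ∀ u ∈ W, ∑ j ∈ Finset.range p, u j * (σ ^ j) m ∈
      Ideal.map (algebraMap A B) (Ideal.comap (algebraMap A B) I) := by
    intro u hu
    induction hu using AddSubgroup.closure_induction with
    | mem u hu =>
      obtain ⟨x, y, rfl⟩ := hu
      obtain ⟨a, ha⟩ := hTr (y * m)
      have : ∑ j ∈ Finset.range p, f x y j * (σ ^ j) m = x * algebraMap A B a := by
        rw [ha, Finset.mul_sum]
        refine Finset.sum_congr rfl fun j _ => ?_
        simp only [f, map_mul]; ring
      rw [this]
      refine Ideal.mul_mem_left _ _ (Ideal.mem_map_of_mem _ ?_)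
      rw [Ideal.mem_comap, ha]
      exact Ideal.sum_mem _ fun j _ => hI' j _ (I.mul_mem_left _ hm)
    | zero => simp
    | add a b _ _ ha hb =>
      simp only [Pi.add_apply, add_mul, Finset.sum_add_distrib]
      exact Ideal.add_mem _ ha hb
    | neg a _ ha =>
      simp only [Pi.neg_apply, neg_mul, Finset.sum_neg_distrib]
      exact Submodule.neg_mem _ ha
  have h4 := h3 w hw
  obtain ⟨q, rfl⟩ : ∃ q, p = q + 1 := ⟨p - 1, by omega⟩
  rw [Finset.sum_range_succ', Finset.sum_eq_zero] at h4
  · simpa [h0] using h4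
  · intro j hj
    rw [hwi (j+1) (by omega) (by simpa using hj), zero_mul]
end

section
open NumberField in
theorem cub_absNorm_map {K : Type*} [Field K] [NumberField K] (e : 𝓞 K ≃+* 𝓞 K) (I : Ideal (𝓞 K)) :
    Ideal.absNorm (Ideal.map (e : 𝓞 K →+* 𝓞 K) I) = Ideal.absNorm I := by
  rw [Ideal.absNorm_apply, Ideal.absNorm_apply, Submodule.cardQuot_apply, Submodule.cardQuot_apply]
  exact Nat.card_congr (Ideal.quotientEquiv I _ e rfl).symm.toEquiv

open NumberField in
theorem cub_lemV_aux {k K : Type*} [Field k] [NumberField k] [Field K] [NumberField K] [Algebra k K]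
    [IsGalois k K] (h2 : Module.finrank k K = 2) (c : K ≃ₐ[k] K) (hc : c ≠ 1)
    (p : ℕ) (hp : p.Prime) (hcl : ¬ p ∣ Nat.card (ClassGroup (𝓞 k))) (I : Ideal (𝓞 K))
    (hI0 : I ≠ ⊥)
    (hI : (I ^ p).IsPrincipal) :
    (I * Ideal.map (RingOfIntegers.mapRingHom (c : K →+* K)) I).IsPrincipal := by
  classical
  have hGal : (Finset.univ : Finset (K ≃ₐ[k] K)) = {1, c} := by
    symm
    apply Finset.eq_univ_of_card
    rw [Finset.card_pair (Ne.symm hc), ← Nat.card_eq_fintype_card, IsGalois.card_aut_eq_finrank, h2]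
  have hn : ∀ x : 𝓞 K, algebraMap (𝓞 k) (𝓞 K) (Algebra.intNorm (𝓞 k) (𝓞 K) x) =
      x * RingOfIntegers.mapRingHom (c : K →+* K) x := by
    intro x
    apply FaithfulSMul.algebraMap_injective (𝓞 K) K
    rw [← IsScalarTower.algebraMap_apply, IsScalarTower.algebraMap_apply (𝓞 k) k K,
      Algebra.algebraMap_intNorm (K := k) (L := K), Algebra.norm_eq_prod_automorphisms, hGal,
      Finset.prod_pair (Ne.symm hc)]
    simp
  set N := Ideal.relNorm (𝓞 k) I with hN
  have hN0 : N ≠ ⊥ := fun h => hI0 (Ideal.relNorm_eq_bot_iff.1 h)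
  have hNp : (N ^ p).IsPrincipal := by
    obtain ⟨x, hx⟩ := hI
    rw [hN, ← map_pow, hx]
    exact ⟨_, Ideal.relNorm_singleton _ _⟩
  have hNprin : N.IsPrincipal := by
    refine Ideal.IsPrincipal.of_isPrincipal_pow_of_coprime (n := p) ?_ hNp
    rw [← Nat.card_eq_fintype_card]
    exact (Nat.Prime.coprime_iff_not_dvd hp).2 hcl
  have hle : Ideal.map (algebraMap (𝓞 k) (𝓞 K)) N ≤
      I * Ideal.map (RingOfIntegers.mapRingHom (c : K →+* K)) I := by
    rw [Ideal.map_relNorm, Ideal.span_le]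
    rintro _ ⟨x, hx, rfl⟩
    simp only [Function.comp, hn, SetLike.mem_coe]
    exact Ideal.mul_mem_mul hx (Ideal.mem_map_of_mem _ hx)
  have hnorm : Ideal.absNorm (Ideal.map (algebraMap (𝓞 k) (𝓞 K)) N) = 
      Ideal.absNorm (I * Ideal.map (RingOfIntegers.mapRingHom (c : K →+* K)) I) := by
    rw [Ideal.absNorm_algebraMap, Ideal.absNorm_relNorm, map_mul]
    have h3 := cub_absNorm_map (RingOfIntegers.mapRingEquiv c.toRingEquiv) I
    have h4 : ((RingOfIntegers.mapRingEquiv c.toRingEquiv : 𝓞 K ≃+* 𝓞 K) : 𝓞 K →+* 𝓞 K) =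
      RingOfIntegers.mapRingHom (c : K →+* K) := rfl
    rw [h4] at h3
    rw [h3, ← pow_two]
    congr 1
    rw [← h2]
    exact (IsFractionRing.finrank_eq (𝓞 k) k (𝓞 K) K).symm
  have heq : Ideal.map (algebraMap (𝓞 k) (𝓞 K)) N =
      I * Ideal.map (RingOfIntegers.mapRingHom (c : K →+* K)) I := by
    obtain ⟨C, hC⟩ := Ideal.dvd_iff_le.2 hle
    have h5 : Ideal.absNorm C = 1 := by
      rw [hC, map_mul] at hnorm
      refine Nat.eq_of_mul_eq_mul_left ?_ (hnorm.trans (mul_one _).symm)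
      apply Nat.pos_of_ne_zero
      intro h0
      rw [Ideal.absNorm_eq_zero_iff] at h0
      rw [h0, Ideal.bot_mul] at hC
      rw [Ideal.map_eq_bot_iff_of_injective (FaithfulSMul.algebraMap_injective _ _)] at hC
      exact hN0 hC
    rw [hC, Ideal.absNorm_eq_one_iff.1 h5, Ideal.mul_top]
  rw [← heq]
  exact hNprin.map_ringHom _

/-- data of complex conjugation on the cyclotomic field -/
structure CubConj (K : Type*) [Field K] [NumberField K] (ζ : K) (p : ℕ) where
  c : K ≃ₐ[ℚ] K
  hζ : c ζ = ζ⁻¹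
  hconj : ∀ (φ : K →+* ℂ) (x : K), φ (c x) = (starRingEnd ℂ) (φ x)
  hcc : ∀ x, c (c x) = x
  hV : ∀ I : Ideal (NumberField.RingOfIntegers K), I ≠ ⊥ → (I ^ p).IsPrincipal →
    (I * Ideal.map (NumberField.RingOfIntegers.mapRingHom (c : K →+* K)) I).IsPrincipal

open NumberField IntermediateField in
theorem cub_conj (p : ℕ) (hp : p.Prime) (hp2 : 2 < p) (K : Type*) [Field K] [NumberField K]
    [IsCyclotomicExtension {p} ℚ K] (ζ : K) (hζ : IsPrimitiveRoot ζ p)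
    (hV : ¬ p ∣ Nat.card (ClassGroup (𝓞 (adjoin ℚ {ζ + ζ⁻¹})))) :
    Nonempty (CubConj K ζ p) := by
  have : NeZero p := ⟨hp.ne_zero⟩
  have hCM : IsCMField K := IsCyclotomicExtension.Rat.isCMField K (S := {p}) ⟨p, rfl, hp2⟩
  have hG : IsGalois ℚ K := IsCyclotomicExtension.isGalois {p} ℚ K
  let c : K ≃ₐ[ℚ] K := (IsCMField.complexConj K).restrictScalars ℚ
  have hconj : ∀ (φ : K →+* ℂ) (x : K), φ (c x) = (starRingEnd ℂ) (φ x) :=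
    fun φ x => IsCMField.complexEmbedding_complexConj K φ x
  let φ : K →+* ℂ := Classical.choice (inferInstance : Nonempty _)
  have hζ0 : ζ ≠ 0 := hζ.ne_zero hp.ne_zero
  have hcζ : c ζ = ζ⁻¹ := by
    apply φ.injective
    rw [hconj, map_inv₀]
    have : ‖φ ζ‖ = 1 := (hζ.map_of_injective φ.injective).norm'_eq_one hp.ne_zero
    exact (Complex.inv_eq_conj this).symm
  have hcc : ∀ x, c (c x) = x := fun x => IsCMField.complexConj_apply_apply K x
  let k := adjoin ℚ {ζ + ζ⁻¹}
  have hk : ∀ x : k, c x = x := by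
    have : k ≤ IntermediateField.fixedField (Subgroup.zpowers c) := by
      rw [adjoin_le_iff]
      rintro _ rfl
      rw [SetLike.mem_coe, IntermediateField.mem_fixedField_iff]
      intro f hf
      have hcf : c (ζ + ζ⁻¹) = ζ + ζ⁻¹ := by
        rw [map_add, map_inv₀, hcζ, inv_inv, add_comm]
      have hc1 : c ∈ MulAction.stabilizer (K ≃ₐ[ℚ] K) (ζ + ζ⁻¹) := hcf
      exact (Subgroup.zpowers_le.2 hc1) hf
    intro x
    exact (IntermediateField.mem_fixedField_iff _ _).1 (this x.2) c (Subgroup.mem_zpowers c)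
  let c' : K ≃ₐ[k] K := AlgEquiv.ofRingEquiv (f := c.toRingEquiv) hk
  have hc' : c' ≠ 1 := by
    intro h
    have h1 : c ζ = ζ := congrArg (fun f : K ≃ₐ[k] K => f ζ) h
    rw [hcζ] at h1
    have h2 : ζ ^ 2 = 1 := by
      rw [pow_two]; nth_rw 1 [← h1]; exact inv_mul_cancel₀ hζ0
    exact absurd (Nat.le_of_dvd (by norm_num) (hζ.dvd_of_pow_eq_one 2 h2)) (by omega)
  have hle : Module.finrank k K ≤ 2 := by
    have htop : k⟮ζ⟯ = ⊤ := by
      have h1 : ℚ⟮ζ⟯ = ⊤ := by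
        have := IsCyclotomicExtension.adjoin_primitive_root_eq_top (A := ℚ) hζ
        rw [eq_top_iff]
        intro x _
        have hx : x ∈ Algebra.adjoin ℚ {ζ} := by rw [this]; trivial
        exact IntermediateField.algebra_adjoin_le_adjoin ℚ _ hx
      rw [eq_top_iff]
      intro x _
      have hx : x ∈ ℚ⟮ζ⟯ := by rw [h1]; trivial
      have h2 : ℚ⟮ζ⟯ ≤ (k⟮ζ⟯).restrictScalars ℚ := by
        rw [adjoin_le_iff]
        rintro _ rfl
        exact mem_adjoin_simple_self k _
      exact h2 hx
    have hint : IsIntegral k ζ := (Algebra.IsIntegral.isIntegral (R := ℚ) ζ).tower_top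
    rw [← IntermediateField.finrank_top', ← htop, IntermediateField.adjoin.finrank hint]
    let g : k := ⟨ζ + ζ⁻¹, mem_adjoin_simple_self ℚ _⟩
    let P : Polynomial k := Polynomial.C 1 * Polynomial.X ^ 2 + Polynomial.C (-g) * Polynomial.X + Polynomial.C 1
    have hP : P.natDegree = 2 := Polynomial.natDegree_quadratic one_ne_zero
    have hP0 : P ≠ 0 := by intro h; rw [h] at hP; simp at hP
    have hPz : Polynomial.aeval ζ P = 0 := by
      have hg : algebraMap k K g = ζ + ζ⁻¹ := rfl
      simp only [P, map_add, map_mul, Polynomial.aeval_C, map_one, map_pow, Polynomial.aeval_X,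
        map_neg, hg]
      field_simp
      ring
    rw [← hP]
    exact Polynomial.natDegree_le_of_dvd (minpoly.dvd k ζ hPz) hP0
  have : IsGalois k K := inferInstance
  have h2 : Module.finrank k K = 2 := by
    apply le_antisymm hle
    by_contra hlt
    have h1 : Nat.card (K ≃ₐ[k] K) ≤ 1 := by
      rw [IsGalois.card_aut_eq_finrank]; omega
    have := Finite.card_le_one_iff_subsingleton.1 h1
    exact hc' (Subsingleton.elim _ _)
  refine ⟨⟨c, hcζ, hconj, hcc, fun I hI0 hI => ?_⟩⟩
  exact cub_lemV_aux h2 c' hc' p hp hV I hI0 hI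
end

section
section
variable {K L : Type*} [Field K] [Field L] [Algebra K L] [FiniteDimensional K L] [IsGalois K L]

theorem cub_gal_gen {p : ℕ} (hp : p.Prime) (hL : Module.finrank K L = p) (σ : L ≃ₐ[K] L)
    (hσ : σ ≠ 1) : orderOf σ = p ∧ ∀ x, x ∈ Subgroup.zpowers σ := by
  have hc : Nat.card (L ≃ₐ[K] L) = p := by rw [IsGalois.card_aut_eq_finrank, hL]
  have : Fact p.Prime := ⟨hp⟩
  refine ⟨?_, fun x => ?_⟩
  · apply orderOf_eq_prime _ hσ
    rw [← hc]; exact pow_card_eq_one'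
  · rw [zpowers_eq_top_of_prime_card hc hσ]; trivial

theorem cub_gal_fix {p : ℕ} (hp : p.Prime) (hL : Module.finrank K L = p) (σ : L ≃ₐ[K] L)
    (hσ : σ ≠ 1) (x : L) (hx : σ x = x) : ∃ y : K, algebraMap K L y = x := by
  have h1 := (cub_gal_gen hp hL σ hσ).2
  have : x ∈ (⊥ : IntermediateField K L) := by
    rw [IsGalois.mem_bot_iff_fixed]
    intro f
    have h2 : Subgroup.zpowers σ ≤ MulAction.stabilizer (L ≃ₐ[K] L) x := by
      rw [Subgroup.zpowers_le]; exact hx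
    exact h2 (h1 f)
  exact IntermediateField.mem_bot.1 this

theorem cub_gal_range {p : ℕ} (hp : p.Prime) (hL : Module.finrank K L = p) (σ : L ≃ₐ[K] L)
    (hσ : σ ≠ 1) {A : Type*} [CommMonoid A] (f : (L ≃ₐ[K] L) → A) :
    ∏ g, f g = ∏ i ∈ Finset.range p, f (σ ^ i) := by
  classical
  obtain ⟨h1, h2⟩ := cub_gal_gen hp hL σ hσ
  have hc : Nat.card (L ≃ₐ[K] L) = p := by rw [IsGalois.card_aut_eq_finrank, hL]
  rw [← IsCyclic.image_range_orderOf h2, h1, Finset.prod_image]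
  intro i hi j hj hij
  rw [← h1] at hi hj
  exact pow_injOn_Iio_orderOf (by simpa using hi) (by simpa using hj) hij

theorem cub_gal_norm {p : ℕ} (hp : p.Prime) (hL : Module.finrank K L = p) (σ : L ≃ₐ[K] L)
    (hσ : σ ≠ 1) (x : L) :
    algebraMap K L (Algebra.norm K x) = ∏ i ∈ Finset.range p, (σ ^ i) x := by
  rw [Algebra.norm_eq_prod_automorphisms, cub_gal_range hp hL σ hσ (fun g => g x)]

theorem cub_gal_trace {p : ℕ} (hp : p.Prime) (hL : Module.finrank K L = p) (σ : L ≃ₐ[K] L)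
    (hσ : σ ≠ 1) (x : L) :
    algebraMap K L (Algebra.trace K L x) = ∑ i ∈ Finset.range p, (σ ^ i) x := by
  rw [trace_eq_sum_automorphisms]
  exact cub_gal_range (A := Multiplicative L) hp hL σ hσ (fun g => Multiplicative.ofAdd (g x))
end
end

section
section
open NumberField NumberField.Units

/-- action on units -/
def cubU {L : Type*} [Field L] [NumberField L] (σ : L →+* L) : Monoid.End (𝓞 L)ˣ :=
  Units.map (RingOfIntegers.mapRingHom σ : 𝓞 L →* 𝓞 L)

theorem cubU_coe {L : Type*} [Field L] [NumberField L] (σ : L →+* L) (u : (𝓞 L)ˣ) :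
    ((cubU σ u : (𝓞 L)ˣ) : L) = σ (u : L) := rfl

theorem cubU_pow_coe {L : Type*} [Field L] [NumberField L] (σ : L →+* L) (i : ℕ) (u : (𝓞 L)ˣ) :
    (((cubU σ ^ i) u : (𝓞 L)ˣ) : L) = (σ ^ i) (u : L) := by
  induction i generalizing u with
  | zero => rfl
  | succ i ih =>
    rw [pow_succ, pow_succ]
    exact ih (cubU σ u)

theorem cub_torsion_map {L L' : Type*} [Field L] [Field L'] [NumberField L] [NumberField L'] (f : (𝓞 L)ˣ →* (𝓞 L')ˣ) :
    torsion L ≤ (torsion L').comap f := by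
  intro x hx
  exact f.isOfFinOrder hx

/-- units modulo torsion -/
def CubLam (L : Type*) [Field L] : Type _ := Additive ((𝓞 L)ˣ ⧸ torsion L)

instance (L : Type*) [Field L] : AddCommGroup (CubLam L) :=
  (Additive.addCommGroup : AddCommGroup (Additive ((𝓞 L)ˣ ⧸ torsion L)))

theorem cubLam_free (L : Type*) [Field L] [NumberField L] : Module.Free ℤ (CubLam L) :=
  Module.Free.of_basis (basisModTorsion L)

theorem cubLam_finite (L : Type*) [Field L] [NumberField L] : Module.Finite ℤ (CubLam L) :=
  Module.Finite.of_basis (basisModTorsion L)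

theorem cubLam_finrank (L : Type*) [Field L] [NumberField L] : Module.finrank ℤ (CubLam L) = rank L :=
  finrank_modTorsion L

/-- induced map on units modulo torsion -/
def cubUQ {L L' : Type*} [Field L] [Field L'] [NumberField L] [NumberField L'] (f : (𝓞 L)ˣ →* (𝓞 L')ˣ) :
    CubLam L →ₗ[ℤ] CubLam L' :=
  (MonoidHom.toAdditive (QuotientGroup.map _ _ f (cub_torsion_map f))).toIntLinearMap

/-- class of a unit -/
def cubCl {L : Type*} [Field L] [NumberField L] (u : (𝓞 L)ˣ) : CubLam L :=
  Additive.ofMul (QuotientGroup.mk u)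

theorem cubUQ_cl {L L' : Type*} [Field L] [Field L'] [NumberField L] [NumberField L'] (f : (𝓞 L)ˣ →* (𝓞 L')ˣ) (u : (𝓞 L)ˣ) :
    cubUQ f (cubCl u) = cubCl (f u) := rfl

theorem cubCl_mul {L : Type*} [Field L] [NumberField L] (u v : (𝓞 L)ˣ) : cubCl (u * v) = cubCl u + cubCl v := rfl

theorem cubCl_div {L : Type*} [Field L] [NumberField L] (u v : (𝓞 L)ˣ) : cubCl (u / v) = cubCl u - cubCl v := rfl

theorem cubCl_pow {L : Type*} [Field L] [NumberField L] (u : (𝓞 L)ˣ) (k : ℕ) : cubCl (u ^ k) = k • cubCl u := rfl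

theorem cubCl_prod {L : Type*} [Field L] [NumberField L] {ι : Type*} (t : Finset ι) (u : ι → (𝓞 L)ˣ) :
    cubCl (∏ i ∈ t, u i) = ∑ i ∈ t, cubCl (u i) := by
  classical
  induction t using Finset.induction_on with
  | empty => rfl
  | insert a t ha ih => rw [Finset.prod_insert ha, Finset.sum_insert ha, cubCl_mul, ih]

theorem cubCl_eq_zero {L : Type*} [Field L] [NumberField L] (u : (𝓞 L)ˣ) : cubCl u = 0 ↔ u ∈ torsion L :=
  (QuotientGroup.eq_one_iff u)

theorem cubCl_surj {L : Type*} [Field L] [NumberField L] (x : CubLam L) : ∃ u, cubCl u = x :=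
  QuotientGroup.mk_surjective x

theorem cubUQ_pow_cl {L : Type*} [Field L] [NumberField L] (f : Monoid.End (𝓞 L)ˣ) (i : ℕ) (u : (𝓞 L)ˣ) :
    ((cubUQ f) ^ i) (cubCl u) = cubCl ((f ^ i) u) := by
  induction i generalizing u with
  | zero => rfl
  | succ i ih =>
    rw [pow_succ, pow_succ]
    exact ih (f u)

theorem cub_units_contra {K L : Type*} [Field K] [Field L] [NumberField K] [NumberField L]
    [Algebra K L] [IsGalois K L] {p : ℕ} (hp : p.Prime) (hL : Module.finrank K L = p)
    (σ : L ≃ₐ[K] L) (hσ : σ ≠ 1)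
    (hK : 2 * Fintype.card (InfinitePlace K) = Module.finrank ℚ K)
    (H : ∀ η : (𝓞 L)ˣ, (∏ i ∈ Finset.range p, (cubU (σ : L →+* L) ^ i) η) ∈ torsion L →
      ∃ z, cubCl η = z - cubUQ (cubU (σ : L →+* L)) z) : False := by
  set s := cubUQ (cubU (σ : L →+* L)) with hs
  have hpos : 0 < p := hp.pos
  have := cubLam_free L
  have := cubLam_finite L
  have := cubLam_free K
  have := cubLam_finite K
  have hσp : σ ^ p = 1 := by
    rw [← (cub_gal_gen hp hL σ hσ).1]; exact pow_orderOf_eq_one σ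
  have hcoe : ∀ i (x : L), ((σ : L →+* L) ^ i) x = (σ ^ i) x := by
    intro i
    induction i with
    | zero => intro x; rfl
    | succ i ih => intro x; rw [pow_succ, pow_succ]; exact ih _
  have hsp : s ^ p = 1 := by
    refine LinearMap.ext fun x => ?_
    obtain ⟨u, rfl⟩ := cubCl_surj x
    rw [hs, cubUQ_pow_cl]
    congr 1
    apply Units.ext
    apply RingOfIntegers.ext
    refine (cubU_pow_coe _ _ _).trans ?_
    rw [hcoe, hσp]
    rfl
  have h1 := cub_rank_le hp s hsp (by
    intro y hy
    obtain ⟨η, rfl⟩ := cubCl_surj y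
    apply H
    rw [← cubCl_eq_zero, cubCl_prod, ← hy]
    refine Finset.sum_congr rfl fun i _ => ?_
    rw [hs, cubUQ_pow_cl])
  rw [cubLam_finrank] at h1
  let f := cubUQ (Units.map (algebraMap (𝓞 K) (𝓞 L) : 𝓞 K →* 𝓞 L))
  have h2 : Module.finrank ℤ (LinearMap.ker (1 - s)) ≤ rank K := by
    rw [← cubLam_finrank]
    refine le_trans ?_ (LinearMap.finrank_range_le f)
    have hmem : ∀ x : LinearMap.ker (1 - s), (p : ℤ) • (x : CubLam L) ∈
        LinearMap.range f := by
      rintro ⟨x, hx⟩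
      obtain ⟨u, rfl⟩ := cubCl_surj x
      have hx1 : s (cubCl u) = cubCl u := by
        rw [LinearMap.mem_ker, LinearMap.sub_apply, sub_eq_zero] at hx
        exact hx.symm
      have hxi : ∀ i, (s ^ i) (cubCl u) = cubCl u := by
        intro i
        induction i with
        | zero => rfl
        | succ i ih => rw [pow_succ, Module.End.mul_apply, hx1, ih]
      have hpx : (p : ℤ) • cubCl u = cubCl (∏ i ∈ Finset.range p, (cubU (σ : L →+* L) ^ i) u) := by
        rw [cubCl_prod]
        simp_rw [← cubUQ_pow_cl, ← hs, hxi]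
        simp
      refine ⟨cubCl (Units.map (Algebra.intNorm (𝓞 K) (𝓞 L) : 𝓞 L →* 𝓞 K) u), ?_⟩
      simp only [hpx, f, cubUQ_cl]
      congr 1
      apply Units.ext
      apply RingOfIntegers.ext
      have e1 : ((algebraMap (𝓞 K) (𝓞 L) (Algebra.intNorm (𝓞 K) (𝓞 L) (u : 𝓞 L)) : 𝓞 L) : L) =
          ∏ i ∈ Finset.range p, (σ ^ i) ((u : 𝓞 L) : L) := by
        rw [← cub_gal_norm hp hL σ hσ, ← Algebra.algebraMap_intNorm (A := 𝓞 K) (B := 𝓞 L)]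
        rfl
      refine e1.trans ?_
      rw [Units.coe_prod, RingOfIntegers.coe_eq_algebraMap (∏ i ∈ Finset.range p, _), map_prod]
      refine Finset.prod_congr rfl fun i _ => ?_
      exact ((cubU_pow_coe _ _ _).trans (hcoe _ _)).symm
    let g : LinearMap.ker (1 - s) →ₗ[ℤ] LinearMap.range f :=
      LinearMap.codRestrict _ ((p : ℤ) • (LinearMap.ker (1 - s)).subtype) hmem
    apply LinearMap.finrank_le_finrank_of_injective (f := g)
    intro x y hxy
    have := congrArg Subtype.val hxy
    have h3 : (p : ℤ) • (x : CubLam L) = (p : ℤ) • (y : CubLam L) := this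
    exact Subtype.ext (smul_right_injective _ (by exact_mod_cast hp.ne_zero) h3)
  have h3 : Module.finrank ℚ L = Module.finrank ℚ K * p := by
    rw [← hL, Module.finrank_mul_finrank]
  have h4 := InfinitePlace.card_add_two_mul_card_eq_rank L
  have h5 := InfinitePlace.card_eq_nrRealPlaces_add_nrComplexPlaces L
  have h6 : 0 < Fintype.card (InfinitePlace K) := Fintype.card_pos
  have h7 : Fintype.card (InfinitePlace L) - 1 ≤ p * (Fintype.card (InfinitePlace K) - 1) :=
    h1.trans (Nat.mul_le_mul_left p h2)
  obtain ⟨k, hk⟩ : ∃ k, Fintype.card (InfinitePlace K) = k + 1 := ⟨_, (Nat.succ_pred_eq_of_pos h6).symm⟩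
  rw [hk] at h7 hK
  rw [Nat.add_sub_cancel] at h7
  rw [← hK] at h3
  have h8 : 2 * (k+1) * p = 2 * (p * k) + 2 * p := by ring
  have := hp.two_le
  omega
end
end

section
section
open NumberField NumberField.Units

theorem cub_mem_torsion {L : Type*} [Field L] [NumberField L] (u : (𝓞 L)ˣ) :
    u ∈ torsion L ↔ ∀ φ : L →+* ℂ, ‖φ (u : L)‖ = 1 := by
  rw [mem_torsion, InfinitePlace.eq_iff_eq]

/-- pure module lemma: coprimality -/
theorem cub_mod_coprime {A : Type*} [AddCommGroup A] (s : A →ₗ[ℤ] A) (p : ℕ) (hp : Nat.Coprime 8 p)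
    (y w : A) (hN : ∑ i ∈ Finset.range p, (s ^ i) y = 0) (h8 : 8 • y = w - s w) :
    ∃ z, y = z - s z := by
  have hr : ∀ x : A, (∃ z, x = z - s z) ↔ x ∈ LinearMap.range (1 - s) := by
    intro x
    constructor
    · rintro ⟨z, rfl⟩; exact ⟨z, rfl⟩
    · rintro ⟨z, rfl⟩; exact ⟨z, rfl⟩
  rw [hr]
  have h1 : (8 : ℤ) • y ∈ LinearMap.range (1 - s) := by
    rw [← hr]; exact ⟨w, by rw [← h8]; norm_cast⟩
  have h2 : (p : ℤ) • y ∈ LinearMap.range (1 - s) := by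
    have : (p : ℤ) • y = ∑ i ∈ Finset.range p, (y - (s ^ i) y) := by
      rw [Finset.sum_sub_distrib, hN]; simp
    rw [this]
    refine Submodule.sum_mem _ fun i _ => ?_
    refine ⟨(∑ j ∈ Finset.range i, s ^ j) y, ?_⟩
    rw [← Module.End.mul_apply, mul_neg_geom_sum]
    rfl
  obtain ⟨a, b, hab⟩ := (Int.isCoprime_iff_gcd_eq_one (m := (8:ℤ)) (n := p)).2 (by exact_mod_cast hp)
  have : y = a • ((8 : ℤ) • y) + b • ((p : ℤ) • y) := by
    rw [smul_smul, smul_smul, ← add_smul, hab, one_smul]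
  rw [this]
  exact Submodule.add_mem _ (Submodule.smul_mem _ _ h1) (Submodule.smul_mem _ _ h2)

theorem cub_no_ext {K L : Type} [Field K] [Field L] [NumberField K] [NumberField L]
    [Algebra K L] [IsGalois K L] {p : ℕ} (hp : p.Prime) (hp2 : 2 < p)
    (hL : Module.finrank K L = p)
    (σ : L ≃ₐ[K] L) (hσ : σ ≠ 1)
    (hK : 2 * Fintype.card (InfinitePlace K) = Module.finrank ℚ K)
    {ζ : K} (cc : CubConj K ζ p) (ct : L →+* L)
    (hct : ∀ (φ : L →+* ℂ) (x : L), φ (ct x) = (starRingEnd ℂ) (φ x))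
    (hD : ∀ i, 0 < i → i < p → Ideal.span (Set.range fun b : 𝓞 L =>
      b - (RingOfIntegers.mapRingHom (σ : L →+* L) ^ i) b) = ⊤) : False := by
  refine cub_units_contra hp hL σ hσ hK fun η hη => ?_
  obtain ⟨φ₀⟩ : Nonempty (L →+* ℂ) := inferInstance
  have hcoe : ∀ i (x : L), ((σ : L →+* L) ^ i) x = (σ ^ i) x := by
    intro i
    induction i with
    | zero => intro x; rfl
    | succ i ih => intro x; rw [pow_succ, pow_succ]; exact ih _
  have hcoe' : ∀ i (x : 𝓞 L), (((RingOfIntegers.mapRingHom (σ : L →+* L) ^ i) x : 𝓞 L) : L) =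
      (σ ^ i) (x : L) := by
    intro i
    induction i with
    | zero => intro x; rfl
    | succ i ih => intro x; rw [pow_succ, pow_succ]; exact ih _
  have hcomm : ∀ x, ct (σ x) = σ (ct x) := by
    intro x
    apply φ₀.injective
    have := hct (φ₀.comp (σ : L →+* L)) x
    rw [hct]
    exact this.symm
  have hcommi : ∀ i x, ct ((σ ^ i) x) = (σ ^ i) (ct x) := by
    intro i
    induction i with
    | zero => intro x; rfl
    | succ i ih =>
      intro x
      rw [pow_succ, AlgEquiv.mul_apply, ih, hcomm]; rfl
  have hctct : ∀ x, ct (ct x) = x := by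
    intro x
    apply φ₀.injective
    rw [hct, hct, Complex.conj_conj]
  have hctK : ∀ x : K, ct (algebraMap K L x) = algebraMap K L (cc.c x) := by
    intro x
    apply φ₀.injective
    rw [hct]
    exact (cc.hconj (φ₀.comp (algebraMap K L)) x).symm
  set s := cubUQ (cubU (σ : L →+* L)) with hs
  -- the real unit
  have hNη : (∏ i ∈ Finset.range p, (σ ^ i) (η : L)) * ct (∏ i ∈ Finset.range p, (σ ^ i) (η : L)) = 1 := by
    have h1 := (cub_mem_torsion _).1 hη
    have h2 : ((∏ i ∈ Finset.range p, (cubU (σ : L →+* L) ^ i) η : (𝓞 L)ˣ) : L) =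
        ∏ i ∈ Finset.range p, (σ ^ i) (η : L) := by
      rw [Units.coe_prod, map_prod]
      refine Finset.prod_congr rfl fun i _ => ?_
      exact (cubU_pow_coe _ _ _).trans (hcoe _ _)
    rw [h2] at h1
    apply φ₀.injective
    rw [map_mul, hct, Complex.mul_conj, Complex.normSq_eq_norm_sq, h1]
    simp
  let η1 : (𝓞 L)ˣ := η * cubU ct η
  have hη1c : (η1 : L) = η * ct η := by
    simp only [η1, Units.val_mul, map_mul, cubU_coe]
  have hη1 : Algebra.norm K (η1 : L) = 1 := by
    apply (algebraMap K L).injective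
    rw [cub_gal_norm hp hL σ hσ, map_one, ← hNη, map_prod, ← Finset.prod_mul_distrib]
    refine Finset.prod_congr rfl fun i _ => ?_
    rw [hη1c, map_mul, hcommi]
  have hctη1 : ct (η1 : L) = η1 := by
    rw [hη1c, map_mul, hctct, mul_comm]
  have hgen := (cub_gal_gen hp hL σ hσ).2
  have : IsCyclic (L ≃ₐ[K] L) := ⟨σ, hgen⟩
  obtain ⟨x, hx0, hx⟩ := groupCohomology.exists_mul_galRestrict_of_norm_eq_one (A := 𝓞 K) (B := 𝓞 L)
    hgen hη1
  have hxL : (η1 : L) * σ (x : L) = x := by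
    have := congrArg (algebraMap (𝓞 L) L) hx
    rwa [map_mul, algebraMap_galRestrict_apply] at this
  let y : 𝓞 L := x * RingOfIntegers.mapRingHom ct x
  have hyL : (y : L) = x * ct x := rfl
  have hct0 : ∀ z, ct z = 0 → z = 0 := fun z hz => (map_eq_zero ct).1 hz
  have hy0 : y ≠ 0 := by
    intro h
    have h1 : (y : L) = 0 := by rw [h]; rfl
    rw [hyL] at h1
    have hx0' : (x : L) ≠ 0 := fun h => hx0 (RingOfIntegers.ext h)
    rcases mul_eq_zero.1 h1 with h | h
    · exact hx0' h
    · exact hx0' (hct0 _ h)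
  have hyc : RingOfIntegers.mapRingHom ct y = y := by
    apply RingOfIntegers.ext
    change ct (y : L) = y
    rw [hyL, map_mul, hctct, mul_comm]
  have hyσ : (η1 : 𝓞 L) ^ 2 * RingOfIntegers.mapRingHom (σ : L →+* L) y = y := by
    apply RingOfIntegers.ext
    change (η1 : L) ^ 2 * σ (y : L) = y
    have h2 := congrArg ct hxL
    rw [map_mul, hctη1, hcomm] at h2
    rw [hyL, map_mul]
    calc _ = ((η1 : L) * σ x) * ((η1 : L) * σ (ct x)) := by ring
      _ = _ := by rw [hxL, h2]
  -- descent
  let I : Ideal (𝓞 L) := Ideal.span {y}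
  have hI : ∀ z ∈ I, RingOfIntegers.mapRingHom (σ : L →+* L) z ∈ I := by
    intro z hz
    obtain ⟨w, rfl⟩ := Ideal.mem_span_singleton'.1 hz
    rw [map_mul]
    apply Ideal.mul_mem_left
    rw [Ideal.mem_span_singleton']
    refine ⟨((η1⁻¹ ^ 2 : (𝓞 L)ˣ) : 𝓞 L), ?_⟩
    nth_rw 1 [← hyσ]
    rw [← mul_assoc, ← Units.val_pow_eq_pow_val, ← Units.val_mul, inv_pow, inv_mul_cancel]
    simp
  let J : Ideal (𝓞 K) := Ideal.comap (algebraMap (𝓞 K) (𝓞 L)) I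
  have hJ : Ideal.map (algebraMap (𝓞 K) (𝓞 L)) J = I := by
    refine cub_descent p hp.pos (RingOfIntegers.mapRingHom (σ : L →+* L)) (fun x => ?_) hD I hI
    refine ⟨Algebra.intTrace (𝓞 K) (𝓞 L) x, ?_⟩
    apply RingOfIntegers.ext
    have e1 : ((algebraMap (𝓞 K) (𝓞 L) (Algebra.intTrace (𝓞 K) (𝓞 L) x) : 𝓞 L) : L) =
          ∑ i ∈ Finset.range p, (σ ^ i) (x : L) := by
      rw [← cub_gal_trace hp hL σ hσ, ← Algebra.algebraMap_intTrace (A := 𝓞 K) (B := 𝓞 L)]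
      rfl
    refine e1.trans ?_
    rw [RingOfIntegers.coe_eq_algebraMap (∑ i ∈ Finset.range p, _), map_sum]
    exact Finset.sum_congr rfl fun i _ => (hcoe' _ _).symm
  have hJ0 : J ≠ ⊥ := by
    intro h
    rw [h, Ideal.map_bot] at hJ
    exact hy0 (Ideal.span_singleton_eq_bot.1 hJ.symm)
  have hJp : (J ^ p).IsPrincipal := by
    have h1 := Ideal.relNorm_algebraMap (𝓞 L) J
    rw [hJ, Ideal.relNorm_singleton] at h1
    have h2 : Module.finrank (𝓞 K) (𝓞 L) = p := by
      rw [← hL]; exact (IsFractionRing.finrank_eq (𝓞 K) K (𝓞 L) L).symm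
    rw [h2] at h1
    exact ⟨_, h1.symm⟩
  have hJle : Ideal.map (RingOfIntegers.mapRingHom (cc.c : K →+* K)) J ≤ J := by
    rw [Ideal.map_le_iff_le_comap]
    intro z hz
    obtain ⟨w, hw⟩ := Ideal.mem_span_singleton'.1 (Ideal.mem_comap.1 hz)
    rw [Ideal.mem_comap, Ideal.mem_comap]
    rw [Ideal.mem_span_singleton']
    refine ⟨RingOfIntegers.mapRingHom ct w, ?_⟩
    rw [← hyc, ← map_mul, hw]
    apply RingOfIntegers.ext
    exact hctK z
  have hJeq : Ideal.map (RingOfIntegers.mapRingHom (cc.c : K →+* K)) J = J := by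
    apply le_antisymm hJle
    have h1 := Ideal.map_mono (f := RingOfIntegers.mapRingHom (cc.c : K →+* K)) hJle
    rw [Ideal.map_map] at h1
    have h2 : (RingOfIntegers.mapRingHom (cc.c : K →+* K)).comp
        (RingOfIntegers.mapRingHom (cc.c : K →+* K)) = RingHom.id _ := by
      ext z
      exact cc.hcc z
    rwa [h2, Ideal.map_id] at h1
  obtain ⟨z, hz⟩ := cc.hV J hJ0 hJp
  rw [hJeq] at hz
  have hzy : Ideal.span {y * y} = Ideal.span {algebraMap (𝓞 K) (𝓞 L) z} := by
    rw [← Ideal.span_singleton_mul_span_singleton]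
    change I * I = _
    rw [← hJ, ← Ideal.map_mul, hz, Ideal.submodule_span_eq, Ideal.map_span, Set.image_singleton]
  obtain ⟨w, hw⟩ := Ideal.span_singleton_eq_span_singleton.1 hzy
  -- y * y * w = z
  have h4 : η1 ^ 4 * w = cubU (σ : L →+* L) w := by
    apply Units.ext
    apply RingOfIntegers.ext
    change (η1 : L) ^ 4 * (w : L) = σ (w : L)
    have hwL : (y : L) * y * (w : L) = algebraMap K L z := congrArg (algebraMap (𝓞 L) L) hw
    have h5 := congrArg σ hwL
    rw [map_mul, map_mul, AlgEquiv.commutes, ← hwL] at h5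
    have h6 : (η1 : L) ^ 2 * σ (y : L) = y := congrArg (algebraMap (𝓞 L) L) hyσ
    have hσy : σ (y : L) ≠ 0 := by
      rw [Ne, EmbeddingLike.map_eq_zero_iff]
      exact fun h => hy0 (RingOfIntegers.ext h)
    apply mul_left_cancel₀ (mul_ne_zero hσy hσy)
    linear_combination (-1) * h5 + (w : L) * ((η1 : L) ^ 2 * σ (y : L) + y) * h6
  have hη0 : algebraMap (𝓞 L) L (η : 𝓞 L) ≠ 0 := by
    intro h
    exact η.ne_zero (RingOfIntegers.ext (h.trans (map_zero _).symm))
  have h5 : cubCl η1 = 2 • cubCl η := by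
    have h6 : cubU ct η / η ∈ torsion L := by
      rw [cub_mem_torsion]
      intro φ
      have h7 : ((cubU ct η / η : (𝓞 L)ˣ) : L) = ct η / η := by
        rw [eq_div_iff hη0]
        rw [← cubU_coe, ← map_mul, ← Units.val_mul, div_mul_cancel]
      rw [h7, map_div₀, hct, norm_div, RCLike.norm_conj, div_self]
      rw [norm_ne_zero_iff, Ne, map_eq_zero]
      exact hη0
    rw [← cubCl_eq_zero, cubCl_div, sub_eq_zero] at h6
    rw [cubCl_mul, h6, two_smul]
  refine cub_mod_coprime s p ?_ (cubCl η) (- cubCl w) ?_ ?_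
  · exact Nat.Coprime.pow_left 3 ((Nat.coprime_primes Nat.prime_two hp).2 (by omega))
  · rw [← cubCl_eq_zero, cubCl_prod] at hη
    rw [← hη]
    refine Finset.sum_congr rfl fun i _ => ?_
    rw [hs, cubUQ_pow_cl]
  · have h6 := congrArg cubCl h4
    have h7 : cubCl (cubU (σ : L →+* L) w) = s (cubCl w) := by rw [hs]; rfl
    rw [cubCl_mul, cubCl_pow, h5, h7, smul_smul] at h6
    rw [map_neg, sub_neg_eq_add, ← h6]
    abel
end
end

section
open NumberField

theorem cub_p_assoc {K : Type*} [Field K] [NumberField K]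
    {p : ℕ} (hp : p.Prime) [IsCyclotomicExtension {p} ℚ K]
    {ζ : K} [NeZero p] (hζ : IsPrimitiveRoot ζ p) :
    Associated ((hζ.toInteger - 1) ^ (p - 1)) (p : 𝓞 K) := by
  have : Fact p.Prime := ⟨hp⟩
  exact IsCyclotomicExtension.Rat.associated_zeta_sub_one_pow_prime p hζ

theorem cub_unram {K L : Type} [Field K] [Field L] [NumberField K] [NumberField L]
    [Algebra K L] {p : ℕ} (hp : p.Prime) [IsCyclotomicExtension {p} ℚ K]
    {ζ : K} [NeZero p] (hζ : IsPrimitiveRoot ζ p)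
    (σ : L ≃ₐ[K] L) (γ : L) (α q : K) (hα0 : α ≠ 0) (hγ : γ ^ p = algebraMap K L α)
    (hσ : σ γ = algebraMap K L ζ * γ) (I : Ideal (𝓞 K)) (a : 𝓞 K) (ha : a ≠ 0)
    (hI : I ^ p = Ideal.span {a}) (haq : (a : K) = α * q ^ p) (d b : 𝓞 K)
    (hd : ¬ (hζ.toInteger - 1) ∣ d) (hprim : (d : K) * (α - 1) = (ζ - 1) ^ p * b) :
    ∀ i, 0 < i → i < p → Ideal.span (Set.range fun b : 𝓞 L =>
      b - (RingOfIntegers.mapRingHom (σ : L →+* L) ^ i) b) = ⊤ := by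
  intro i hi hip
  have hγ0 : γ ≠ 0 := by
    rintro rfl
    rw [zero_pow hp.ne_zero] at hγ
    exact hα0 ((map_eq_zero (algebraMap K L)).1 hγ.symm)
  have haK : (a : K) ≠ 0 := by
    intro h; exact ha (RingOfIntegers.ext h)
  have hq0 : q ≠ 0 := by
    rintro rfl
    rw [zero_pow hp.ne_zero, mul_zero] at haq
    exact haK haq
  set Z := hζ.toInteger with hZ
  have hZc : (Z : K) = ζ := rfl
  have hlam : Prime (Z - 1) := by
    have : Fact p.Prime := ⟨hp⟩
    exact hζ.zeta_sub_one_prime'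
  have hζ1 : ζ - 1 ≠ 0 := by
    intro h
    exact hζ.ne_one hp.one_lt (sub_eq_zero.1 h)
  have hσi : ∀ j, (σ ^ j) γ = algebraMap K L (ζ ^ j) * γ := by
    intro j
    induction j with
    | zero => simp
    | succ j ih =>
      rw [pow_succ', AlgEquiv.mul_apply, ih, map_mul, AlgEquiv.commutes, hσ, pow_succ, map_mul]
      ring
  have hcoe' : ∀ (x : 𝓞 L), (((RingOfIntegers.mapRingHom (σ : L →+* L) ^ i) x : 𝓞 L) : L)
      = (σ ^ i) (x : L) := by
    intro x
    clear hip hi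
    induction i generalizing x with
    | zero => rfl
    | succ j ih =>
      rw [pow_succ', pow_succ', AlgEquiv.mul_apply, ← ih]
      rfl
  set D := Ideal.span (Set.range fun b : 𝓞 L =>
      b - (RingOfIntegers.mapRingHom (σ : L →+* L) ^ i) b) with hDdef
  have hmem : ∀ (x y : L) (r : 𝓞 K), IsIntegral ℤ x → IsIntegral ℤ y →
      (x - (σ ^ i) x) * y = algebraMap K L r → algebraMap (𝓞 K) (𝓞 L) r ∈ D := by
    intro x y r hx hy hr
    let X : 𝓞 L := ⟨x, hx⟩
    let Y : 𝓞 L := ⟨y, hy⟩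
    have h1 : algebraMap (𝓞 K) (𝓞 L) r = Y * (X -
        (RingOfIntegers.mapRingHom (σ : L →+* L) ^ i) X) := by
      apply RingOfIntegers.ext
      rw [RingOfIntegers.coe_eq_algebraMap (_ * _), map_mul, map_sub]
      have h2 := hcoe' X
      refine Eq.trans ?_ (congrArg (fun w => y * (x - w)) h2.symm)
      change algebraMap K L r = _
      rw [← hr, mul_comm]
      rfl
    rw [h1]
    exact Ideal.mul_mem_left _ _ (Ideal.subset_span ⟨_, rfl⟩)
  have hintK : ∀ r : 𝓞 K, IsIntegral ℤ (algebraMap K L r) := fun r =>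
    (RingOfIntegers.isIntegral_coe r).map (algebraMap K L).toIntAlgHom
  have hintp : ∀ (x : L) (r : 𝓞 K), x ^ p = algebraMap K L r → IsIntegral ℤ x := by
    intro x r h
    exact IsIntegral.of_pow hp.pos (h ▸ hintK r)
  -- unit
  obtain ⟨u, hu⟩ : ∃ u : (𝓞 K)ˣ, 1 - Z ^ i = - ((u : 𝓞 K) * (Z - 1)) := by
    have hcop : i.Coprime p := (Nat.coprime_of_lt_prime (by omega) hip hp).symm
    obtain ⟨u, hu⟩ := (hζ.toInteger_isPrimitiveRoot).geom_sum_isUnit hp.two_le hcop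
    refine ⟨u, ?_⟩
    rw [hu]
    have := geom_sum_mul Z i
    rw [this]; ring
  have huK : (1 : K) - ζ ^ i = - ((u : 𝓞 K) * (ζ - 1)) := by
    have := congrArg (algebraMap (𝓞 K) K) hu
    rw [map_sub, map_neg, map_mul, map_sub, map_pow, map_one] at this
    exact this
  -- first: λ ∈ D
  have hA1 : ∀ y ∈ I, ∀ z ∈ I ^ (p - 1), ∀ r, y * z = a * r →
      algebraMap (𝓞 K) (𝓞 L) (r * (1 - Z ^ i)) ∈ D := by
    intro y hy z hz r hr
    have hyp : y ^ p ∈ I ^ p := Ideal.pow_mem_pow hy p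
    rw [hI, Ideal.mem_span_singleton'] at hyp
    obtain ⟨s, hs⟩ := hyp
    have hzp : z ^ p ∈ (I ^ p) ^ (p - 1) := by
      rw [← pow_mul, mul_comm, pow_mul]
      exact Ideal.pow_mem_pow hz p
    rw [hI, Ideal.span_singleton_pow, Ideal.mem_span_singleton'] at hzp
    obtain ⟨s', hs'⟩ := hzp
    have hap : (a : K) ^ p = a ^ (p - 1) * a := by
      rw [← pow_succ, Nat.sub_add_cancel hp.one_le]
    have hsK : (s : K) * a = y ^ p := by
      have := congrArg (algebraMap (𝓞 K) K) hs
      simpa using this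
    have hsK' : (s' : K) * a ^ (p - 1) = z ^ p := by
      have := congrArg (algebraMap (𝓞 K) K) hs'
      simpa using this
    have hrK : (y : K) * z = a * r := by
      have := congrArg (algebraMap (𝓞 K) K) hr
      simpa using this
    refine hmem (algebraMap K L (z * q / a) * γ) (algebraMap K L (y / q) * γ⁻¹) _
      (hintp _ s' ?_) (hintp _ s ?_) ?_
    · rw [mul_pow, hγ, ← map_pow, ← map_mul]
      congr 1
      rw [div_pow, mul_pow, ← hsK', hap, div_mul_eq_mul_div, div_eq_iff (by positivity)]
      rw [haq]; ring
    · rw [mul_pow, inv_pow, hγ, ← map_pow, ← map_inv₀, ← map_mul]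
      congr 1
      rw [div_pow, ← hsK, haq]
      field_simp
    · rw [map_mul, AlgEquiv.commutes, hσi]
      have : (algebraMap K L (z * q / a) * γ - algebraMap K L (z * q / a) *
        (algebraMap K L (ζ ^ i) * γ)) * (algebraMap K L (y / q) * γ⁻¹) =
        algebraMap K L (z * q / a * (1 - ζ ^ i) * (y / q)) := by
        simp only [map_mul, map_sub, map_one]
        field_simp
      rw [this]
      congr 1
      have e2 : ((r * (1 - Z ^ i) : 𝓞 K) : K) = r * (1 - ζ ^ i) := by
        simp [map_mul, map_sub, hZc]
      rw [e2]
      field_simp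
      linear_combination (1 - ζ ^ i) * hrK
  have hA2 : algebraMap (𝓞 K) (𝓞 L) (1 - Z ^ i) ∈ D := by
    have h1 : a ∈ I * I ^ (p - 1) := by
      rw [← pow_succ', Nat.sub_add_cancel hp.one_le, hI]
      exact Ideal.mem_span_singleton_self a
    have h2 : ∀ w ∈ I * I ^ (p - 1), ∃ r, w = a * r ∧ algebraMap (𝓞 K) (𝓞 L) (r * (1 - Z ^ i)) ∈ D := by
      intro w hw
      refine Submodule.mul_induction_on hw ?_ ?_
      · intro y hy z hz
        have h3 : y * z ∈ I * I ^ (p - 1) := Ideal.mul_mem_mul hy hz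
        rw [← pow_succ', Nat.sub_add_cancel hp.one_le, hI, Ideal.mem_span_singleton] at h3
        obtain ⟨r, hr⟩ := h3
        exact ⟨r, hr, hA1 y hy z hz r hr⟩
      · rintro x y ⟨r, hr, hr'⟩ ⟨s, hs, hs'⟩
        refine ⟨r + s, by rw [hr, hs]; ring, ?_⟩
        rw [add_mul, map_add]
        exact D.add_mem hr' hs'
    obtain ⟨r, hr, hr'⟩ := h2 a h1
    have : r = 1 := by
      have h3 : a * 1 = a * r := by rw [← hr, mul_one]
      exact (mul_left_cancel₀ ha h3).symm
    rwa [this, one_mul] at hr'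
  have hlamD : algebraMap (𝓞 K) (𝓞 L) (Z - 1) ∈ D := by
    have : Z - 1 = - ((u⁻¹ : (𝓞 K)ˣ) : 𝓞 K) * (1 - Z ^ i) := by
      rw [hu]; simp
    rw [this, map_mul]
    exact D.mul_mem_left _ hA2
  -- second
  have hdK : (d : K) ≠ 0 := by
    intro h
    apply hd
    have : d = 0 := RingOfIntegers.ext h
    rw [this]; exact dvd_zero _
  set d' : 𝓞 K := d + (Z - 1) ^ p * b with hd'
  have hd'K : (d' : K) = d * α := by
    have : (d' : K) = d + (ζ - 1) ^ p * b := by simp [hd', hZc]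
    rw [this, ← hprim]; ring
  have hd'n : ¬ (Z - 1) ∣ d' := by
    intro h
    apply hd
    have h2 : (Z - 1) ∣ (Z - 1) ^ p * b := dvd_mul_of_dvd_left (dvd_pow_self _ hp.ne_zero) _
    exact (dvd_add_left h2).1 h
  have hint2 : IsIntegral ℤ (algebraMap K L d' * γ⁻¹) := by
    apply hintp _ (d' ^ (p - 1) * d)
    rw [mul_pow, inv_pow, hγ, ← map_pow, ← map_inv₀, ← map_mul]
    congr 1
    have hpp : (d' : K) ^ p = d' ^ (p - 1) * d' := by
      rw [← pow_succ, Nat.sub_add_cancel hp.one_le]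
    rw [hpp]
    have e2 : ((d' ^ (p - 1) * d : 𝓞 K) : K) = d' ^ (p - 1) * d := by simp
    rw [e2, mul_assoc]
    congr 1
    rw [hd'K]; field_simp
  have hint3 : IsIntegral ℤ (algebraMap K L (d / (ζ - 1)) * (γ - 1)) := by
    have hass := cub_p_assoc hp hζ
    obtain ⟨e, he⟩ := hass.dvd
    set x := algebraMap K L (d / (ζ - 1)) * (γ - 1) with hx
    have heK : (p : K) = (ζ - 1) ^ (p - 1) * e := by
      have := congrArg (algebraMap (𝓞 K) K) he
      rw [map_mul, map_pow, map_sub, map_one, map_natCast] at this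
      exact this
    have hxγ : algebraMap K L (ζ - 1) * x + algebraMap K L d = algebraMap K L d * γ := by
      rw [hx, ← mul_assoc, ← map_mul, mul_div_cancel₀ _ hζ1]; ring
    clear_value x
    have hpw : (algebraMap K L (ζ - 1) * x + algebraMap K L d) ^ p =
        algebraMap K L (d ^ p + (ζ - 1) ^ p * (d ^ (p - 1) * b)) := by
      rw [hxγ, mul_pow, hγ, ← map_pow, ← map_mul]
      congr 1
      have hpp : (d : K) ^ p = d ^ (p - 1) * d := by
        rw [← pow_succ, Nat.sub_add_cancel hp.one_le]
      rw [hpp]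
      linear_combination (d : K) ^ (p - 1) * hprim
    -- coefficients
    have hck : ∀ k, 0 < k → k < p → ∃ c : 𝓞 K,
        (ζ - 1) ^ k * (d : K) ^ (p - k) * (p.choose k) = (ζ - 1) ^ p * c := by
      intro k hk hkp
      obtain ⟨m, hm⟩ := hp.dvd_choose_self hk.ne' hkp
      refine ⟨(Z - 1) ^ (k - 1) * d ^ (p - k) * (e * m), ?_⟩
      have e2 : (((Z - 1) ^ (k - 1) * d ^ (p - k) * (e * m) : 𝓞 K) : K) =
          (ζ - 1) ^ (k - 1) * d ^ (p - k) * (e * m) := by simp [hZc]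
      rw [e2, hm, Nat.cast_mul, heK]
      have h1 : (ζ - 1) ^ k = (ζ - 1) ^ (k - 1) * (ζ - 1) := by
        rw [← pow_succ, Nat.sub_add_cancel hk]
      have h2 : (ζ - 1) ^ p = (ζ - 1) ^ (p - 1) * (ζ - 1) := by
        rw [← pow_succ, Nat.sub_add_cancel hp.one_le]
      rw [h1, h2]; ring
    choose! cf hcf using hck
    let C0 : ℕ → 𝓞 K := fun k => if k = 0 then - (d ^ (p - 1) * b) else cf k
    have hrel : x ^ p + ∑ k ∈ Finset.range p, algebraMap K L (C0 k) * x ^ k = 0 := by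
      have hl : algebraMap K L ((ζ - 1) ^ p) ≠ 0 := by
        rw [Ne, map_eq_zero]; exact pow_ne_zero _ hζ1
      apply mul_left_cancel₀ hl
      rw [mul_zero, mul_add, Finset.mul_sum]
      rw [add_pow, Finset.sum_range_succ] at hpw
      obtain ⟨r, hr⟩ : ∃ r, p = r + 1 := ⟨p - 1, by have := hp.one_le; omega⟩
      have h3 : ∀ F : ℕ → L, ∑ k ∈ Finset.range p, F k =
          ∑ k ∈ Finset.range r, F (k + 1) + F 0 := by
        intro F; rw [hr, Finset.sum_range_succ']
      rw [h3] at hpw ⊢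
      have h4 : ∑ k ∈ Finset.range r, algebraMap K L ((ζ - 1) ^ p) *
          (algebraMap K L (C0 (k + 1)) * x ^ (k + 1)) =
          ∑ k ∈ Finset.range r, (algebraMap K L (ζ - 1) * x) ^ (k + 1) *
            algebraMap K L d ^ (p - (k + 1)) * (p.choose (k + 1)) := by
        refine Finset.sum_congr rfl fun k hk => ?_
        have hk' : k + 1 < p := by rw [Finset.mem_range] at hk; omega
        have h5 := congrArg (algebraMap K L) (hcf (k + 1) (Nat.succ_pos k) hk')
        simp only [map_mul, map_natCast, map_pow] at h5
        have h6 : C0 (k + 1) = cf (k + 1) := if_neg (Nat.succ_ne_zero k)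
        rw [h6, map_pow, mul_pow]
        linear_combination (- x ^ (k + 1)) * h5
      rw [h4]
      have h7 : C0 0 = - (d ^ (p - 1) * b) := if_pos rfl
      have h8 : ((- (d ^ (p - 1) * b) : 𝓞 K) : K) = - (d ^ (p - 1) * b) := by simp
      rw [h7, h8]
      simp only [map_add, map_mul, map_pow, map_neg, pow_zero, Nat.sub_zero, Nat.choose_zero_right,
        Nat.cast_one, mul_one, one_mul, Nat.sub_self, Nat.choose_self] at hpw ⊢
      linear_combination hpw
    have h9 : IsIntegral (𝓞 K) x := by
      refine ⟨Polynomial.X ^ p + ∑ k ∈ Finset.range p, Polynomial.C (C0 k) * Polynomial.X ^ k, ?_, ?_⟩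
      · apply Polynomial.monic_X_pow_add
        refine (Polynomial.degree_sum_le _ _).trans_lt
          ((Finset.sup_lt_iff (WithBot.bot_lt_coe p)).2 fun k hk => ?_)
        exact (Polynomial.degree_C_mul_X_pow_le k _).trans_lt
          (WithBot.coe_lt_coe.2 (Finset.mem_range.1 hk))
      · rw [Polynomial.eval₂_add, Polynomial.eval₂_X_pow, Polynomial.eval₂_finset_sum, ← hrel]
        congr 1
        refine Finset.sum_congr rfl fun k _ => ?_
        rw [Polynomial.eval₂_mul, Polynomial.eval₂_C, Polynomial.eval₂_X_pow]
        rfl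
    have : Algebra.IsIntegral ℤ (𝓞 K) := inferInstance
    exact isIntegral_trans x h9
  have hdd : algebraMap (𝓞 K) (𝓞 L) (d * d' * u) ∈ D := by
    rw [← neg_mem_iff, ← map_neg]
    refine hmem _ _ _ hint3 hint2 ?_
    rw [map_mul, AlgEquiv.commutes, map_sub, hσi, map_one]
    have : (algebraMap K L (d / (ζ - 1)) * (γ - 1) - algebraMap K L (d / (ζ - 1)) *
      (algebraMap K L (ζ ^ i) * γ - 1)) * (algebraMap K L d' * γ⁻¹) =
      algebraMap K L (d / (ζ - 1) * (1 - ζ ^ i) * d') := by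
      simp only [map_mul, map_sub, map_one]
      field_simp
      ring
    rw [this, huK]
    congr 1
    have e2 : ((- (d * d' * u) : 𝓞 K) : K) = - (d * d' * (u : 𝓞 K)) := by simp
    rw [e2]
    field_simp
  have hmax : (Ideal.span {Z - 1}).IsMaximal := by
    have := (Ideal.span_singleton_prime hlam.ne_zero).2 hlam
    exact this.isMaximal (by rw [Ne, Ideal.span_singleton_eq_bot]; exact hlam.ne_zero)
  have hnot : d * d' * u ∉ Ideal.span {Z - 1} := by
    rw [Ideal.mem_span_singleton]
    intro h
    rcases hlam.dvd_or_dvd h with h | h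
    · rcases hlam.dvd_or_dvd h with h | h
      · exact hd h
      · exact hd'n h
    · exact hlam.not_unit (isUnit_of_dvd_unit h u.isUnit)
  obtain ⟨y, w, hw, h1⟩ := hmax.exists_inv hnot
  rw [Ideal.eq_top_iff_one, ← map_one (algebraMap (𝓞 K) (𝓞 L)), ← h1, map_add, map_mul]
  refine D.add_mem (D.mul_mem_left _ hdd) ?_
  obtain ⟨w', rfl⟩ := Ideal.mem_span_singleton'.1 hw
  rw [map_mul]
  exact D.mul_mem_left _ hlamD
end

section
open NumberField

theorem cub_hK {K : Type} [Field K] [NumberField K] {p : ℕ} (hp2 : 2 < p)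
    [IsCyclotomicExtension {p} ℚ K] [NeZero p] :
    2 * Fintype.card (InfinitePlace K) = Module.finrank ℚ K := by
  have h1 := IsCyclotomicExtension.Rat.nrRealPlaces_eq_zero (n := p) K hp2
  rw [InfinitePlace.card_eq_nrRealPlaces_add_nrComplexPlaces,
    ← InfinitePlace.card_add_two_mul_card_eq_rank, h1]
  ring

open Polynomial in
theorem cub_kummer_pow {K : Type} [Field K] [NumberField K]
    {p : ℕ} (hp : p.Prime) (hp2 : 2 < p) [IsCyclotomicExtension {p} ℚ K]
    {ζ : K} [NeZero p] (hζ : IsPrimitiveRoot ζ p) (cc : CubConj K ζ p)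
    (α q : K) (hαc : α * cc.c α = 1) (I : Ideal (𝓞 K)) (a : 𝓞 K) (ha : a ≠ 0)
    (hI : I ^ p = Ideal.span {a}) (haq : (a : K) = α * q ^ p) (d b : 𝓞 K)
    (hd : ¬ (hζ.toInteger - 1) ∣ d) (hprim : (d : K) * (α - 1) = (ζ - 1) ^ p * b) :
    ∃ γ : K, γ ^ p = α := by
  by_contra! hne
  have H : Irreducible (X ^ p - C α) := X_pow_sub_C_irreducible_of_prime hp hne
  have hα0 : α ≠ 0 := by rintro rfl; simp at hαc
  have hprimr : (primitiveRoots p K).Nonempty := ⟨ζ, (mem_primitiveRoots hp.pos).2 hζ⟩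
  have hF := Fact.mk H
  let L := AdjoinRoot (X ^ p - C α)
  have hmon : (X ^ p - C α).Monic := monic_X_pow_sub_C α hp.ne_zero
  have hfin : Module.Finite K L := hmon.finite_adjoinRoot
  have hNF : NumberField L := NumberField.of_module_finite K L
  have hsplit := isSplittingField_AdjoinRoot_X_pow_sub_C hprimr H
  have hGal : IsGalois K L :=
    IsGalois.of_separable_splitting_field (separable_X_pow_sub_C_of_irreducible hprimr α H)
  have hrank : Module.finrank K L = p := by
    rw [(AdjoinRoot.powerBasis' hmon).finrank, AdjoinRoot.powerBasis'_dim, natDegree_X_pow_sub_C]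
  let γ : L := AdjoinRoot.root _
  have hγ : γ ^ p = algebraMap K L α := root_X_pow_sub_C_pow p α
  have hγ0 : γ ≠ 0 := by
    intro h
    rw [h, zero_pow hp.ne_zero] at hγ
    exact hα0 ((map_eq_zero (algebraMap K L)).1 hγ.symm)
  let η : rootsOfUnity p K := rootsOfUnity.mkOfPowEq ζ hζ.pow_eq_one
  let σ : L ≃ₐ[K] L := autAdjoinRootXPowSubC p α η
  have hσ : σ γ = algebraMap K L ζ * γ := by
    have := autAdjoinRootXPowSubC_root (n := p) α η
    refine this.trans ?_
    rw [Algebra.smul_def]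
    rfl
  have hσ1 : σ ≠ 1 := by
    intro h
    rw [h] at hσ
    have h1 : (algebraMap K L ζ - 1) * γ = 0 := by
      rw [sub_mul, ← hσ]; simp
    rcases mul_eq_zero.1 h1 with h2 | h2
    · rw [← map_one (algebraMap K L), ← map_sub, map_eq_zero] at h2
      exact hζ.ne_one hp.one_lt (sub_eq_zero.1 h2)
    · exact hγ0 h2
  have hev : (X ^ p - C α).eval₂ ((algebraMap K L).comp (cc.c : K →+* K)) γ⁻¹ = 0 := by
    rw [eval₂_sub, eval₂_X_pow, eval₂_C, inv_pow, hγ, sub_eq_zero, RingHom.comp_apply, ← map_inv₀]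
    congr 1
    rw [eq_comm]
    exact eq_inv_of_mul_eq_one_right hαc
  let ct : L →+* L := AdjoinRoot.lift ((algebraMap K L).comp (cc.c : K →+* K)) γ⁻¹ hev
  have hct : ∀ (φ : L →+* ℂ) (x : L), φ (ct x) = (starRingEnd ℂ) (φ x) := by
    intro φ x
    have h1 : φ.comp ct = (starRingEnd ℂ).comp φ := by
      apply AdjoinRoot.ringHom_ext
      · ext y
        have h2 : ct (algebraMap K L y) = algebraMap K L (cc.c y) := AdjoinRoot.lift_of hev
        exact (congrArg φ h2).trans (cc.hconj (φ.comp (algebraMap K L)) y)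
      · have h2 : ct γ = γ⁻¹ := AdjoinRoot.lift_root hev
        change φ (ct γ) = (starRingEnd ℂ) (φ γ)
        have h3 := cc.hconj (φ.comp (algebraMap K L)) α
        have h4 := congrArg (φ.comp (algebraMap K L)) hαc
        rw [map_mul, h3, map_one, Complex.mul_conj] at h4
        have h5 : Complex.normSq (φ γ) ^ p = 1 := by
          rw [← map_pow, ← map_pow, hγ]
          exact_mod_cast h4
        have h6 : Complex.normSq (φ γ) = 1 :=
          (pow_eq_one_iff_of_nonneg (Complex.normSq_nonneg _) hp.ne_zero).1 h5
        rw [h2, map_inv₀]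
        symm
        apply eq_inv_of_mul_eq_one_right
        rw [Complex.mul_conj, h6]; simp
    exact RingHom.congr_fun h1 x
  exact cub_no_ext hp hp2 hrank σ hσ1 (cub_hK hp2) cc ct hct
    (cub_unram hp hζ σ γ α q hα0 hγ hσ I a ha hI haq d b hd hprim)

theorem cub_ideal_pow_inj {R : Type*} [CommRing R] [IsDedekindDomain R] {I J : Ideal R} {p : ℕ}
    (hp : p ≠ 0) (h : I ^ p = J ^ p) : I = J := by
  apply dvd_antisymm
  · exact (UniqueFactorizationMonoid.pow_dvd_pow_iff_dvd hp).1 (dvd_of_eq h)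
  · exact (UniqueFactorizationMonoid.pow_dvd_pow_iff_dvd hp).1 (dvd_of_eq h.symm)

theorem cub_nt {K : Type} [Field K] [NumberField K]
    {p : ℕ} (hp : p.Prime) (hp2 : 2 < p) [IsCyclotomicExtension {p} ℚ K]
    {ζ : K} [NeZero p] (hζ : IsPrimitiveRoot ζ p) (cc : CubConj K ζ p)
    (α e : K) (I : Ideal (𝓞 K)) (a : 𝓞 K) (ha : a ≠ 0)
    (hI : I ^ p = Ideal.span {a}) (hae : (a : K) = α * e ^ p) (d b : 𝓞 K)
    (hd : ¬ (hζ.toInteger - 1) ∣ d) (hprim : (d : K) * (α - 1) = (ζ - 1) ^ p * b) :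
    I.IsPrincipal := by
  set Z := hζ.toInteger with hZ
  have hlam : Prime (Z - 1) := by
    have : Fact p.Prime := ⟨hp⟩
    exact hζ.zeta_sub_one_prime'
  have hζ0 : ζ ≠ 0 := hζ.ne_zero hp.ne_zero
  have haK : (a : K) ≠ 0 := by
    intro h; exact ha (RingOfIntegers.ext h)
  have hα0 : α ≠ 0 := by rintro rfl; rw [zero_mul] at hae; exact haK hae
  have he0 : e ≠ 0 := by
    rintro rfl; rw [zero_pow hp.ne_zero, mul_zero] at hae; exact haK hae
  let C : 𝓞 K →+* 𝓞 K := RingOfIntegers.mapRingHom (cc.c : K →+* K)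
  have hC : ∀ x : 𝓞 K, ((C x : 𝓞 K) : K) = cc.c x := fun x => rfl
  have hCC : ∀ x : 𝓞 K, C (C x) = x := fun x => RingOfIntegers.ext (cc.hcc x)
  have hc0 : ∀ x : K, x ≠ 0 → cc.c x ≠ 0 := fun x hx => by
    rwa [Ne, EmbeddingLike.map_eq_zero_iff]
  have hCa : C a ≠ 0 := by
    intro h
    apply ha
    rw [← hCC a, h, map_zero]
  have hI0 : I ≠ ⊥ := by
    rintro rfl
    rw [← Ideal.zero_eq_bot, zero_pow hp.ne_zero, eq_comm, Ideal.zero_eq_bot, Ideal.span_singleton_eq_bot] at hI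
    exact ha hI
  have hIC : (Ideal.map C I) ^ p = Ideal.span {C a} := by
    rw [← Ideal.map_pow, hI, Ideal.map_span, Set.image_singleton]
  have hdvdC : ∀ x, (Z - 1) ∣ C x → (Z - 1) ∣ x := by
    rintro x ⟨y, hy⟩
    have h1 : x = C (Z - 1) * C y := by rw [← map_mul, ← hy, hCC]
    have h2 : C Z * Z = 1 := by
      apply RingOfIntegers.ext
      change cc.c ζ * ζ = 1
      rw [cc.hζ, inv_mul_cancel₀ hζ0]
    have h3 : C (Z - 1) = (Z - 1) * (- C Z) := by
      rw [map_sub, map_one]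
      linear_combination h2
    rw [h1, h3, mul_assoc]
    exact dvd_mul_right _ _
  have hclam : (cc.c ζ - 1) ^ p = - (ζ - 1) ^ p := by
    have h1 : cc.c ζ - 1 = - (ζ⁻¹ * (ζ - 1)) := by
      rw [cc.hζ]; field_simp; ring
    rw [h1, (hp.odd_of_ne_two (by omega)).neg_pow, mul_pow, inv_pow, hζ.pow_eq_one]; simp
  set α' := α / cc.c α with hα'
  have hα'c : α' * cc.c α' = 1 := by
    rw [hα', map_div₀, cc.hcc]
    have := hc0 α hα0
    field_simp
  set d' : 𝓞 K := d + (Z - 1) ^ p * b with hd'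
  have hd'K : (d' : K) = d * α := by
    have : (d' : K) = d + (ζ - 1) ^ p * b := by
      rw [hd']; simp only [map_add, map_mul, map_pow, map_sub, map_one]; rfl
    rw [this, ← hprim]; ring
  have hd'n : ¬ (Z - 1) ∣ d' := by
    intro h
    apply hd
    have h2 : (Z - 1) ∣ (Z - 1) ^ p * b := dvd_mul_of_dvd_left (dvd_pow_self _ hp.ne_zero) _
    exact (dvd_add_left h2).1 h
  have hae' := congrArg cc.c hae
  rw [map_mul, map_pow] at hae'
  obtain ⟨γ, hγ⟩ : ∃ γ : K, γ ^ p = α' := by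
    refine cub_kummer_pow hp hp2 hζ cc α' (e / cc.c e * cc.c a) hα'c (I * (Ideal.map C I) ^ (p - 1))
      (a * C a ^ (p - 1)) (mul_ne_zero ha (pow_ne_zero _ hCa)) ?_ ?_ (d * C d')
      (b * C d + C b * d) ?_ ?_
    · rw [mul_pow, hI, ← pow_mul, mul_comm (p - 1), pow_mul, hIC, Ideal.span_singleton_pow,
        Ideal.span_singleton_mul_span_singleton]
    · have e2 : ((a * C a ^ (p - 1) : 𝓞 K) : K) = a * cc.c a ^ (p - 1) := by
        simp only [map_mul, map_pow]; rw [← hC]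
      have hpp : cc.c (a : K) ^ p = cc.c (a : K) ^ (p - 1) * cc.c (a : K) := by
        rw [← pow_succ, Nat.sub_add_cancel hp.one_le]
      have h1 := hc0 e he0
      have h2 := hc0 α hα0
      rw [e2, mul_pow, div_pow, hpp]
      generalize cc.c (a : K) ^ (p - 1) = Q
      rw [hae', hae, hα']
      field_simp
    · intro h
      rcases hlam.dvd_or_dvd h with h | h
      · exact hd h
      · exact hd'n (hdvdC _ h)
    · have e2 : ((d * C d' : 𝓞 K) : K) = d * (cc.c d * cc.c α) := by
        rw [← map_mul, ← hd'K, ← hC]; simp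
      have e3 : ((b * C d + C b * d : 𝓞 K) : K) = b * cc.c d + cc.c b * d := by
        rw [← hC, ← hC]; simp
      have h2 := hc0 α hα0
      have h3 := congrArg cc.c hprim
      rw [map_mul, map_sub, map_one, map_mul, map_pow, map_sub, map_one, hclam] at h3
      rw [e2, e3, hα']
      field_simp
      linear_combination cc.c (d : K) * hprim - (d : K) * h3
  -- conclude
  obtain ⟨s, t, ht, hst⟩ := IsFractionRing.div_surjective (A := 𝓞 K) (γ * e / cc.c e)
  have ht0 : t ≠ 0 := nonZeroDivisors.ne_zero ht
  have htK : (t : K) ≠ 0 := by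
    intro h; exact ht0 (RingOfIntegers.ext h)
  have hrel : t ^ p * a = s ^ p * C a := by
    apply RingOfIntegers.ext
    have h1 : (t : K) * (γ * e / cc.c e) = s := by
      rw [← hst]; exact mul_div_cancel₀ _ htK
    have e2 : ((t ^ p * a : 𝓞 K) : K) = t ^ p * a := by simp
    have e3 : ((s ^ p * C a : 𝓞 K) : K) = s ^ p * cc.c a := by rw [← hC]; simp
    rw [e2, e3, ← h1, mul_pow, div_pow, mul_pow, hγ, hae', hae, hα']
    have h1 := hc0 e he0
    have h2 := hc0 α hα0
    field_simp
  have hid : Ideal.span {t} * I = Ideal.span {s} * Ideal.map C I := by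
    apply cub_ideal_pow_inj hp.ne_zero
    rw [mul_pow, mul_pow, hI, hIC, Ideal.span_singleton_pow, Ideal.span_singleton_pow,
      Ideal.span_singleton_mul_span_singleton, Ideal.span_singleton_mul_span_singleton, hrel]
  obtain ⟨b0, hb0⟩ := cc.hV I hI0 ⟨_, hI⟩
  have hid2 : Ideal.span {t} * I ^ 2 = Ideal.span {s * b0} := by
    rw [pow_two, ← mul_assoc, hid, mul_assoc, mul_comm _ I]
    change _ * (I * Ideal.map C I) = _
    rw [hb0, Ideal.submodule_span_eq, Ideal.span_singleton_mul_span_singleton]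
  have hsq : (I ^ 2).IsPrincipal := by
    have h1 : s * b0 ∈ Ideal.span {t} * I ^ 2 := by
      rw [hid2]; exact Ideal.mem_span_singleton_self _
    obtain ⟨w, hw, hw2⟩ := Ideal.mem_span_singleton_mul.1 h1
    refine ⟨w, ?_⟩
    have h2 : Ideal.span {t} ≠ (0 : Ideal (𝓞 K)) := by
      rw [Ideal.zero_eq_bot, Ne, Ideal.span_singleton_eq_bot]; exact ht0
    apply mul_left_cancel₀ h2
    rw [hid2, ← hw2, Ideal.submodule_span_eq, Ideal.span_singleton_mul_span_singleton]
  have hI0' : I ∈ nonZeroDivisors (Ideal (𝓞 K)) := mem_nonZeroDivisors_of_ne_zero hI0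
  rw [← ClassGroup.mk0_eq_one_iff hI0']
  have h2 : (ClassGroup.mk0 ⟨I, hI0'⟩) ^ 2 = 1 := by
    rw [← map_pow]
    exact (ClassGroup.mk0_eq_one_iff (pow_mem hI0' 2)).2 hsq
  have h3 : (ClassGroup.mk0 ⟨I, hI0'⟩) ^ p = 1 := by
    rw [← map_pow]
    exact (ClassGroup.mk0_eq_one_iff (pow_mem hI0' p)).2 ⟨_, hI⟩
  have h4 : Nat.gcd 2 p = 1 := (Nat.coprime_primes Nat.prime_two hp).2 (by omega)
  rw [← pow_one (ClassGroup.mk0 _), ← h4]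
  exact pow_gcd_eq_one.2 ⟨h2, h3⟩
end

section
section
variable {A B : Type} [CommRing A] [CommRing B] [Algebra A B]

theorem cub_newton (T : Subalgebra A B) {p : ℕ} {σ : Type} [Fintype σ] (hσ : Fintype.card σ = p)
    (hu : ∀ j, 0 < j → j < p → IsUnit (j : A)) (u : σ → B) (hT : ∀ i, u i ∈ T)
    (hps : ∀ j, 0 < j → ∃ w ∈ T, ∑ i, u i ^ j = p * w) (μ ν : A) (hμ : μ ^ p = p * μ * ν) :
    ∃ w ∈ T, ∏ i, (1 + algebraMap A B μ * u i) = 1 + p * algebraMap A B μ * w := by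
  classical
  let e : ℕ → B := fun k => ∑ t ∈ Finset.powersetCard k (Finset.univ : Finset σ), ∏ i ∈ t, u i
  have heT : ∀ k, e k ∈ T := fun k => T.sum_mem (fun t _ => T.prod_mem (fun i _ => hT i))
  have he : ∀ k, MvPolynomial.aeval u (MvPolynomial.esymm σ A k) = e k := by
    intro k
    rw [MvPolynomial.aeval_esymm_eq_multiset_esymm, Finset.esymm_map_val]
  have hps' : ∀ k, MvPolynomial.aeval u (MvPolynomial.psum σ A k) = ∑ i, u i ^ k := by
    intro k
    simp [MvPolynomial.psum]
  have hep : ∀ k, 0 < k → k < p → ∃ w ∈ T, e k = p * w := by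
    intro k hk hkp
    have h1 := congrArg (MvPolynomial.aeval u) (MvPolynomial.mul_esymm_eq_sum σ A k)
    simp only [map_mul, map_natCast, map_pow, map_neg, map_one, map_sum, he, hps'] at h1
    have h2 : ∃ w ∈ T, ∑ a ∈ Finset.HasAntidiagonal.antidiagonal k with a.1 < k,
        (-1) ^ a.1 * e a.1 * ∑ i, u i ^ a.2 = p * w := by
      choose! W hW hW2 using hps
      refine ⟨∑ a ∈ Finset.HasAntidiagonal.antidiagonal k with a.1 < k,
        (-1) ^ a.1 * e a.1 * W a.2, ?_, ?_⟩
      · apply T.sum_mem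
        intro a ha
        have h3 := (Finset.mem_filter.1 ha)
        have h4 := Finset.HasAntidiagonal.mem_antidiagonal.1 h3.1
        exact T.mul_mem (T.mul_mem (T.pow_mem (T.neg_mem T.one_mem) _) (heT _))
          (hW _ (by omega))
      · rw [Finset.mul_sum]
        apply Finset.sum_congr rfl
        intro a ha
        have h3 := (Finset.mem_filter.1 ha)
        have h4 := Finset.HasAntidiagonal.mem_antidiagonal.1 h3.1
        rw [hW2 _ (by omega)]
        ring
    obtain ⟨w, hw, hw2⟩ := h2
    rw [hw2] at h1
    obtain ⟨v, hv⟩ := (hu k hk hkp).exists_left_inv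
    refine ⟨algebraMap A B v * ((-1) ^ (k + 1) * w), ?_, ?_⟩
    · exact T.mul_mem (T.algebraMap_mem _) (T.mul_mem (T.pow_mem (T.neg_mem T.one_mem) _) hw)
    · have h5 : algebraMap A B v * (k : B) = 1 := by
        rw [← map_natCast (algebraMap A B), ← map_mul, hv, map_one]
      calc e k = (algebraMap A B v * (k : B)) * e k := by rw [h5, one_mul]
        _ = algebraMap A B v * (k * e k) := by ring
        _ = _ := by rw [h1]; ring
  have hexp : ∏ i, (1 + algebraMap A B μ * u i) =
      ∑ k ∈ Finset.range (p + 1), algebraMap A B μ ^ k * e k := by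
    rw [Finset.prod_one_add, Finset.sum_powerset, Finset.card_univ, hσ]
    apply Finset.sum_congr rfl
    intro k _
    rw [Finset.mul_sum]
    apply Finset.sum_congr rfl
    intro t ht
    rw [Finset.prod_mul_distrib, Finset.prod_const, (Finset.mem_powersetCard.1 ht).2]
  rw [hexp, Finset.sum_range_succ']
  have h0 : e 0 = 1 := by simp [e]
  rw [h0]
  have hterm : ∀ k, k < p → ∃ w ∈ T, algebraMap A B μ ^ (k+1) * e (k+1) =
      p * algebraMap A B μ * w := by
    intro k hk
    rcases Nat.lt_or_ge (k+1) p with h | h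
    · obtain ⟨w, hw, hw2⟩ := hep (k+1) (by omega) h
      refine ⟨algebraMap A B μ ^ k * w, T.mul_mem (T.pow_mem (T.algebraMap_mem _) _) hw, ?_⟩
      rw [hw2]; ring
    · have h1 : k + 1 = p := by omega
      refine ⟨algebraMap A B ν * e (k+1), T.mul_mem (T.algebraMap_mem _) (heT _), ?_⟩
      rw [h1, ← map_pow, hμ, map_mul, map_mul, map_natCast]; ring
  choose! W hW hW2 using hterm
  refine ⟨∑ k ∈ Finset.range p, W k, T.sum_mem (fun k hk => hW k (Finset.mem_range.1 hk)), ?_⟩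
  rw [Finset.sum_congr rfl (fun k hk => hW2 k (Finset.mem_range.1 hk)), ← Finset.mul_sum]
  ring
end

section
variable {A : Type} [CommRing A] {p : ℕ} (E : AddChar (ZMod p) A)

/-- The characters of `(ℤ/p)^m`. -/
def cubChi (m : ℕ) : Multiplicative (Fin m → ZMod p) →* ((Fin m → ZMod p) → A) where
  toFun k := fun x => ∏ i, E (x i * k.toAdd i)
  map_one' := by funext x; simp
  map_mul' k l := by
    funext x
    simp [mul_add, AddChar.map_add_eq_mul, Finset.prod_mul_distrib]

/-- Functions with integral Fourier coefficients. -/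
def cubF (m : ℕ) : Subalgebra A ((Fin m → ZMod p) → A) :=
  (MonoidAlgebra.lift A ((Fin m → ZMod p) → A) (Multiplicative (Fin m → ZMod p))
    (cubChi E m)).range

theorem cubF_gen {m : ℕ} (c : A) (k : Fin m → ZMod p) :
    (fun x => c * ∏ i, E (x i * k i)) ∈ cubF E m :=
  ⟨MonoidAlgebra.single (Multiplicative.ofAdd k) c, by
    change (MonoidAlgebra.lift A ((Fin m → ZMod p) → A) (Multiplicative (Fin m → ZMod p))
      (cubChi E m)) _ = _
    rw [MonoidAlgebra.lift_single]; rfl⟩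

theorem cubF_ind {m : ℕ} {P : ((Fin m → ZMod p) → A) → Prop} (h0 : P 0)
    (hadd : ∀ u v, P u → P v → P (u + v)) (hs : ∀ (c : A) (k : Fin m → ZMod p), P (fun x => c * ∏ i, E (x i * k i)))
    (u : (Fin m → ZMod p) → A) (hu : u ∈ cubF E m) : P u := by
  obtain ⟨f, rfl⟩ := hu
  change P ((MonoidAlgebra.lift A ((Fin m → ZMod p) → A) (Multiplicative (Fin m → ZMod p))
      (cubChi E m)) f)
  induction f using MonoidAlgebra.induction_linear with
  | zero => rw [map_zero]; exact h0
  | add x y hx hy => rw [map_add]; exact hadd _ _ hx hy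
  | single k c => rw [MonoidAlgebra.lift_single]; exact hs c k.toAdd

theorem cubF_slice {m : ℕ} (i : ZMod p) (u : (Fin (m+1) → ZMod p) → A) (hu : u ∈ cubF E (m+1)) :
    (fun x => u (Fin.cons i x)) ∈ cubF E m := by
  refine cubF_ind E (P := fun u => (fun x => u (Fin.cons i x)) ∈ cubF E m) ?_ ?_ ?_ u hu
  · exact (cubF E m).zero_mem
  · intro u v hu hv
    exact (cubF E m).add_mem hu hv
  · intro c k
    convert cubF_gen E (c * E (i * k 0)) (Fin.tail k) using 1
    funext x
    simp only [Fin.prod_univ_succ]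
    simp [Fin.tail, mul_assoc]

theorem cubF_diff {m : ℕ} {lam : A} (hlam : ∀ z, ∃ w, E z - 1 = lam * w)
    (u : (Fin (m+1) → ZMod p) → A) (hu : u ∈ cubF E (m+1)) :
    ∃ w ∈ cubF E m, ∀ x, u (Fin.cons 1 x) - u (Fin.cons 0 x) = lam * w x := by
  refine cubF_ind E (P := fun u => ∃ w ∈ cubF E m,
    ∀ x, u (Fin.cons 1 x) - u (Fin.cons 0 x) = lam * w x) ?_ ?_ ?_ u hu
  · exact ⟨0, (cubF E m).zero_mem, by simp⟩
  · rintro u v ⟨w, hw, hw2⟩ ⟨w', hw', hw2'⟩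
    refine ⟨w + w', (cubF E m).add_mem hw hw', fun x => ?_⟩
    have h1 := hw2 x
    have h2 := hw2' x
    simp only [Pi.add_apply]
    linear_combination h1 + h2
  · intro c k
    obtain ⟨w, hw⟩ := hlam (k 0)
    refine ⟨_, cubF_gen E (c * w) (Fin.tail k), ?_⟩
    intro x
    simp only [Fin.prod_univ_succ, Fin.tail, Fin.cons_zero, Fin.cons_succ, one_mul, zero_mul,
      AddChar.map_zero_eq_one]
    linear_combination (c * ∏ i, E (x i * k i.succ)) * hw

variable [IsDomain A] [Fact p.Prime]

theorem cubF_sum (hE : E.IsPrimitive) {m : ℕ} (u : (Fin (m+1) → ZMod p) → A) (hu : u ∈ cubF E (m+1)) :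
    ∃ w ∈ cubF E m, ∀ x, ∑ i, u (Fin.cons i x) = p * w x := by
  classical
  refine cubF_ind E (P := fun u => ∃ w ∈ cubF E m,
    ∀ x, ∑ i, u (Fin.cons i x) = p * w x) ?_ ?_ ?_ u hu
  · exact ⟨0, (cubF E m).zero_mem, by simp⟩
  · rintro u v ⟨w, hw, hw2⟩ ⟨w', hw', hw2'⟩
    refine ⟨w + w', (cubF E m).add_mem hw hw', fun x => ?_⟩
    simp only [Pi.add_apply, Finset.sum_add_distrib, hw2, hw2', mul_add]
  · intro c k
    refine ⟨_, cubF_gen E (c * (if k 0 = 0 then 1 else 0)) (Fin.tail k), ?_⟩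
    intro x
    have h1 := AddChar.sum_mulShift (ψ := E) (k 0) hE
    simp only [Fin.prod_univ_succ, Fin.tail, Fin.cons_zero, Fin.cons_succ]
    rw [← Finset.mul_sum, ← Finset.sum_mul, h1, ZMod.card]
    split_ifs <;> simp <;> ring

theorem cubF_prod (hE : E.IsPrimitive) (hu : ∀ j, 0 < j → j < p → IsUnit (j : A)) (lam ν : A)
    (hlam : lam ^ (p - 1) = p * ν) : ∀ (m : ℕ) (μ : A), lam ∣ μ → 
    ∀ u ∈ cubF E m, ∃ w, ∏ x, (1 + μ * u x) = 1 + p ^ m * μ * w := by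
  intro m
  induction m with
  | zero =>
    intro μ _ u _
    refine ⟨u default, ?_⟩
    rw [Fintype.prod_unique, pow_zero, one_mul]
    congr 3
    exact Subsingleton.elim _ _
  | succ m ih =>
    rintro μ ⟨μ', rfl⟩ u hu'
    have hpos : 0 < p := (Fact.out : p.Prime).pos
    obtain ⟨w, hw, hw2⟩ := cub_newton (cubF E m) (p := p) (σ := ZMod p) (ZMod.card p) hu
      (fun i => fun x => u (Fin.cons i x)) (fun i => cubF_slice E i u hu') (by
        intro j _
        obtain ⟨w, hw, hw2⟩ := cubF_sum E hE (u ^ j) ((cubF E (m+1)).pow_mem hu' j)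
        refine ⟨w, hw, ?_⟩
        funext x
        have := hw2 x
        simp only [Pi.pow_apply] at this
        simp [this]) (lam * μ') (ν * μ' ^ (p-1)) (by
        obtain ⟨q, rfl⟩ : ∃ q, p = q + 1 := ⟨p - 1, by omega⟩
        simp only [Nat.add_sub_cancel] at hlam ⊢
        calc (lam * μ') ^ (q+1) = lam ^ q * lam * μ' ^ (q+1) := by ring
          _ = _ := by rw [hlam]; ring)
    obtain ⟨w', hw'⟩ := ih (p * (lam * μ')) (Dvd.intro_left _ (by ring : (p * μ') * lam = _)) w hw
    refine ⟨w', ?_⟩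
    have h1 : ∏ x, (1 + (lam * μ') * u x) = ∏ x : Fin m → ZMod p, ∏ i : ZMod p,
        (1 + (lam * μ') * u (Fin.cons i x)) := by
      rw [← Equiv.prod_comp (Fin.consEquiv (fun _ => ZMod p)), Fintype.prod_prod_type_right]
      rfl
    rw [h1]
    have h2 : ∀ x : Fin m → ZMod p, ∏ i : ZMod p, (1 + (lam * μ') * u (Fin.cons i x)) =
        1 + p * (lam * μ') * w x := by
      intro x
      have := congrFun hw2 x
      simpa [Finset.prod_apply] using this
    rw [Finset.prod_congr rfl (fun x _ => h2 x), hw']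
    ring
end
end

section
section
open Polynomial in
theorem cub_binom {A : Type} [CommRing A] {p : ℕ} (hp : p.Prime) (t : A) :
    ∃ q : A, (1 + t) ^ p = 1 + t ^ p + p * (t * (1 + t * q)) := by
  obtain ⟨r, hr⟩ := exists_add_pow_prime_eq hp (1 : ℤ[X]) (X : ℤ[X])
  have hcoe : (p : ℤ[X]) = C (p : ℤ) := by simp
  replace hr : (1 + X) ^ p = 1 + X ^ p + C (p : ℤ) * (X * r) := by
    rw [hr, hcoe]; ring
  have h1 := congrArg (fun f => coeff f 1) hr
  have hp1 : (1 : ℕ) ≠ p := hp.one_lt.ne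
  simp only [coeff_one_add_X_pow, coeff_add, coeff_one, coeff_X_pow, hp1, if_false,
    coeff_C_mul, coeff_X_mul, Nat.choose_one_right, one_ne_zero] at h1
  have h2 : r.coeff 0 = 1 := by
    have : (p : ℤ) ≠ 0 := by exact_mod_cast hp.ne_zero
    apply mul_left_cancel₀ this
    simpa using h1.symm
  have h3 : r = 1 + X * r.divX := by
    conv_lhs => rw [← Polynomial.X_mul_divX_add r, h2]
    simp [add_comm]
  rw [h3] at hr
  refine ⟨aeval t r.divX, ?_⟩
  have h4 := congrArg (aeval t) hr
  simpa using h4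

variable {A : Type} [CommRing A] [IsDomain A] {p : ℕ} (hp : p.Prime) (hp2 : 2 < p) {ζ : A}
    (hζ : ζ ^ p = 1) (hass : Associated ((ζ - 1) ^ (p - 1)) (p : A)) 
    (hres : ∀ x : A, ∃ c : ℤ, (ζ - 1) ∣ x - c)
    (hunit : ∀ x : A, ¬ (ζ - 1) ∣ x → IsUnit x) (hnu : ¬ IsUnit (ζ - 1)) (hp0 : (p : A) ≠ 0)

theorem cub_stepB (hp : p.Prime) (hp2 : 2 < p) (hass : Associated ((ζ - 1) ^ (p - 1)) (p : A))
    (hunit : ∀ x : A, ¬ (ζ - 1) ∣ x → IsUnit x) (hnu : ¬ IsUnit (ζ - 1)) (hp0 : (p : A) ≠ 0)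
    (x ρ : A) (hx : (ζ - 1) ^ 2 ∣ x - 1) (h : p * ρ ∣ x ^ p - 1) : ρ ∣ x - 1 := by
  obtain ⟨t, rfl⟩ : ∃ t, x = 1 + t := ⟨x - 1, by ring⟩
  rw [add_sub_cancel_left] at hx ⊢
  obtain ⟨q, hq⟩ := cub_binom hp t
  obtain ⟨s, hs⟩ := hx
  obtain ⟨u, hu⟩ := hass
  obtain ⟨w, hw⟩ := h
  have h1 : t ^ p = p * (t * (ζ - 1) * ((ζ - 1) ^ (p - 2) * ↑u⁻¹ * s ^ (p-1))) := by
    obtain ⟨k, rfl⟩ : ∃ k, p = k + 2 := ⟨p - 2, by omega⟩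
    have e1 : k + 2 - 1 = k + 1 := by omega
    have e2 : k + 2 - 2 = k := by omega
    rw [e1] at hu ⊢
    rw [e2, ← hu]
    have e3 : (u : A) * ↑u⁻¹ = 1 := by simp
    calc t ^ (k+2) = t * t ^ (k+1) := by ring
      _ = t * ((ζ - 1) ^ 2 * s) ^ (k+1) * ((u : A) * ↑u⁻¹) := by rw [e3, mul_one, ← hs]
      _ = _ := by generalize ζ - 1 = l; ring
  have h2 : IsUnit (1 + t * q + (ζ - 1) * ((ζ - 1) ^ (p - 2) * ↑u⁻¹ * s ^ (p-1))) := by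
    apply hunit
    intro hd
    apply hnu
    apply isUnit_of_dvd_one
    have h3 : (ζ - 1) ∣ t * q + (ζ - 1) * ((ζ - 1) ^ (p - 2) * ↑u⁻¹ * s ^ (p-1)) := by
      apply dvd_add _ (dvd_mul_right _ _)
      rw [hs]
      exact ⟨(ζ - 1) * s * q, by ring⟩
    have := dvd_sub hd h3
    convert this using 1
    ring
  have h4 : (p : A) * (t * (1 + t * q + (ζ - 1) * ((ζ - 1) ^ (p - 2) * ↑u⁻¹ * s ^ (p-1)))) =
      p * (ρ * w) := by
    rw [hq, h1] at hw
    linear_combination hw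
  have h5 := mul_left_cancel₀ hp0 h4
  have h6 : ρ ∣ t * (1 + t * q + (ζ - 1) * ((ζ - 1) ^ (p - 2) * ↑u⁻¹ * s ^ (p-1))) := ⟨w, h5⟩
  exact (h2.dvd_mul_right).1 h6

theorem cub_endgame (hp : p.Prime) (hp2 : 2 < p) (hζ : ζ ^ p = 1)
    (hass : Associated ((ζ - 1) ^ (p - 1)) (p : A)) 
    (hres : ∀ x : A, ∃ c : ℤ, (ζ - 1) ∣ x - c)
    (hunit : ∀ x : A, ¬ (ζ - 1) ∣ x → IsUnit x) (hnu : ¬ IsUnit (ζ - 1)) (hp0 : (p : A) ≠ 0)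
    (m : ℕ) (z : A) (hz : (p ^ (m+1) * (ζ - 1) : A) ∣ z ^ (p ^ m) - 1) :
    ∃ k : ℕ, (ζ - 1) ^ p ∣ ζ ^ k * z - 1 := by
  have hlp : (ζ - 1) ∣ (p : A) := (dvd_pow_self _ (by omega)).trans hass.dvd
  have hlast : ∀ y : A, (p * (ζ - 1) : A) ∣ y → (ζ - 1) ^ p ∣ y := by
    intro y hy
    refine dvd_trans ?_ hy
    obtain ⟨k, rfl⟩ : ∃ k, p = k + 1 := ⟨p - 1, by omega⟩
    rw [pow_succ]
    exact mul_dvd_mul_right hass.dvd _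
  rcases Nat.eq_zero_or_pos m with rfl | hm
  · refine ⟨0, hlast _ ?_⟩
    simpa using hz
  have hz1 : (ζ - 1) ∣ z ^ (p ^ m) - 1 := (dvd_mul_left _ _).trans hz
  obtain ⟨c, hc⟩ := hres z
  have hcc : (ζ - 1) ∣ ((c : A) ^ (p ^ m) - c) := by
    have : (p : ℤ) ∣ c ^ (p ^ m) - c := by
      have := Fact.mk hp
      rw [← ZMod.intCast_zmod_eq_zero_iff_dvd]
      push_cast
      rw [ZMod.pow_card_pow, sub_self]
    have h2 := Int.cast_dvd_cast (α := A) _ _ this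
    push_cast at h2
    exact hlp.trans h2
  have hz2 : (ζ - 1) ∣ z - 1 := by
    have h3 := (hc.trans (sub_dvd_pow_sub_pow z (c : A) (p ^ m)))
    have := dvd_sub hz1 (dvd_add h3 hcc)
    have h4 := dvd_add hc this
    convert h4 using 1
    ring
  obtain ⟨y, hy⟩ := hz2
  obtain ⟨e, he⟩ := hres y
  obtain ⟨k, hk⟩ : ∃ k : ℕ, (p : ℤ) ∣ k + e := by
    refine ⟨((-e) % p).toNat, ?_⟩
    have h0 : (p : ℤ) ≠ 0 := by exact_mod_cast hp.ne_zero
    rw [Int.toNat_of_nonneg (Int.emod_nonneg _ h0)]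
    have := Int.mul_ediv_add_emod (-e) p
    exact ⟨-((-e) / p), by linear_combination this⟩
  have hpw : ∀ k : ℕ, ∃ w, ζ ^ k = 1 + k * (ζ - 1) + (ζ - 1) ^ 2 * w := by
    intro k
    induction k with
    | zero => exact ⟨0, by simp⟩
    | succ k ih =>
      obtain ⟨w, hw⟩ := ih
      refine ⟨k + ζ * w, ?_⟩
      rw [pow_succ, hw]
      push_cast
      ring
  obtain ⟨w, hw⟩ := hpw k
  have hz' : (ζ - 1) ^ 2 ∣ ζ ^ k * z - 1 := by
    have h5 : (ζ - 1) ∣ (k : A) + e := by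
      have h2 := Int.cast_dvd_cast (α := A) _ _ hk
      push_cast at h2
      exact hlp.trans h2
    have h6 : (ζ - 1) ∣ (k : A) + y := by
      convert dvd_add h5 he using 1; ring
    obtain ⟨v, hv⟩ := h6
    have hzz : z = 1 + (ζ - 1) * y := by linear_combination hy
    refine ⟨v + k * y + w * z, ?_⟩
    rw [hw, hzz]
    linear_combination (ζ - 1) * hv
  refine ⟨k, hlast _ ?_⟩
  have hpw2 : (p ^ m * (p * (ζ - 1)) : A) ∣ (ζ ^ k * z) ^ (p ^ m) - 1 := by
    have h7 : (ζ ^ k) ^ (p ^ m) = 1 := by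
      obtain ⟨m', rfl⟩ : ∃ m', m = m' + 1 := ⟨m - 1, by omega⟩
      rw [← pow_mul, pow_succ, ← mul_assoc, mul_comm, pow_mul, hζ, one_pow]
    rw [mul_pow, h7, one_mul]
    convert hz using 1
    ring
  generalize ζ ^ k * z = x at hz' hpw2 ⊢
  clear hz hm hz1 hcc
  induction m with
  | zero => simpa using hpw2
  | succ m ih =>
    apply ih
    apply cub_stepB hp hp2 hass hunit hnu hp0 _ _ ?_ ?_
    · refine hz'.trans ?_
      simpa using sub_dvd_pow_sub_pow x 1 (p ^ m)
    · rw [← pow_mul, ← pow_succ, ← mul_assoc, ← pow_succ']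
      exact hpw2
end
end

section
open NumberField

section
variable {K : Type} [Field K] [NumberField K]

/-- The localization of the ring of integers at a principal prime, as a subring. -/
def cubLoc {lam : 𝓞 K} (h : Prime lam) : Subring K where
  carrier := {x | ∃ d b : 𝓞 K, ¬ lam ∣ d ∧ x * (d : K) = (b : K)}
  mul_mem' := by
    rintro x y ⟨d, b, hd, hx⟩ ⟨d', b', hd', hy⟩
    refine ⟨d * d', b * b', fun hh => (h.dvd_or_dvd hh).elim hd hd', ?_⟩
    change x * y * ((d : K) * (d' : K)) = (b : K) * (b' : K)
    rw [← hx, ← hy]; ring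
  one_mem' := ⟨1, 1, fun hh => h.not_unit (isUnit_of_dvd_one hh), by simp⟩
  add_mem' := by
    rintro x y ⟨d, b, hd, hx⟩ ⟨d', b', hd', hy⟩
    refine ⟨d * d', b * d' + b' * d, fun hh => (h.dvd_or_dvd hh).elim hd hd', ?_⟩
    change (x + y) * ((d : K) * (d' : K)) = (b : K) * (d' : K) + (b' : K) * (d : K)
    rw [← hx, ← hy]; ring
  zero_mem' := ⟨1, 0, fun hh => h.not_unit (isUnit_of_dvd_one hh), by simp⟩
  neg_mem' := by
    rintro x ⟨d, b, hd, hx⟩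
    refine ⟨d, -b, hd, ?_⟩
    change -x * (d : K) = -(b : K)
    rw [← hx]; ring

variable {lam : 𝓞 K} (h : Prime lam)

theorem cubLoc_int (x : 𝓞 K) : (x : K) ∈ cubLoc h :=
  ⟨1, x, fun hh => h.not_unit (isUnit_of_dvd_one hh), by simp⟩

/-- Integers in the localization. -/
def cubIn (x : 𝓞 K) : cubLoc h := ⟨(x : K), cubLoc_int h x⟩

theorem cubIn_val (x : 𝓞 K) : ((cubIn h x : cubLoc h) : K) = x := rfl

theorem cubIn_mul (x y : 𝓞 K) : cubIn h (x * y) = cubIn h x * cubIn h y := rfl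

theorem cubLoc_frac (x : cubLoc h) : ∃ d b : 𝓞 K, ¬ lam ∣ d ∧ x * cubIn h d = cubIn h b := by
  obtain ⟨d, b, hd, hx⟩ := x.2
  exact ⟨d, b, hd, Subtype.ext hx⟩

theorem cubLoc_isUnit (x : 𝓞 K) (hx : ¬ lam ∣ x) : IsUnit (cubIn h x) := by
  have hx0 : (x : K) ≠ 0 := by
    intro h0
    apply hx
    have : x = 0 := RingOfIntegers.ext h0
    rw [this]; exact dvd_zero _
  have hm : (x : K)⁻¹ ∈ cubLoc h := ⟨x, 1, hx, by simp [hx0]⟩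
  exact IsUnit.of_mul_eq_one ⟨_, hm⟩ (Subtype.ext (mul_inv_cancel₀ hx0))

theorem cubLoc_unit (x : cubLoc h) (hx : ¬ cubIn h lam ∣ x) : IsUnit x := by
  obtain ⟨d, b, hd, hb⟩ := cubLoc_frac h x
  have hb2 : ¬ lam ∣ b := by
    rintro ⟨c, rfl⟩
    apply hx
    rw [cubIn_mul] at hb
    exact (cubLoc_isUnit h d hd).dvd_mul_right.1 ⟨_, hb⟩
  have := cubLoc_isUnit h b hb2
  rw [← hb] at this
  exact isUnit_of_mul_isUnit_left this

theorem cubLoc_dvd (x : 𝓞 K) (hx : cubIn h lam ∣ cubIn h x) : lam ∣ x := by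
  obtain ⟨y, hy⟩ := hx
  obtain ⟨d, b, hd, hb⟩ := cubLoc_frac h y
  have h1 : cubIn h (x * d) = cubIn h (lam * b) := by
    rw [cubIn_mul, cubIn_mul, hy, ← hb]; ring
  have h2 : x * d = lam * b := RingOfIntegers.ext (congrArg (fun y : cubLoc h => (y : K)) h1)
  exact (h.dvd_or_dvd (Dvd.intro _ h2.symm)).resolve_right hd

theorem cubLoc_not_unit : ¬ IsUnit (cubIn h lam) := by
  intro hu
  apply h.not_unit
  have : cubIn h lam ∣ cubIn h 1 := by
    obtain ⟨v, hv⟩ := hu.exists_right_inv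
    exact ⟨v, hv.symm⟩
  exact isUnit_of_dvd_one (cubLoc_dvd h _ this)

theorem cubLoc_root (x : K) (N : ℕ) (hN : N ≠ 0) (hx : x ^ N ∈ cubLoc h) : x ∈ cubLoc h := by
  by_contra hx1
  have hx0 : x ≠ 0 := by rintro rfl; exact hx1 (zero_mem _)
  obtain ⟨b, d, hd0, hbd⟩ := IsFractionRing.div_surjective (A := 𝓞 K) x
  have hd : d ≠ 0 := nonZeroDivisors.ne_zero hd0
  have hdK : (d : K) ≠ 0 := fun h0 => hd (RingOfIntegers.ext h0)
  have hb : b ≠ 0 := by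
    rintro rfl
    apply hx0; rw [← hbd]; simp
  have hbK : (b : K) ≠ 0 := fun h0 => hb (RingOfIntegers.ext h0)
  obtain ⟨k, b', hb', hbe⟩ := WfDvdMonoid.max_power_factor hb h.irreducible
  obtain ⟨l, d', hd', hde⟩ := WfDvdMonoid.max_power_factor hd h.irreducible
  have hlK : (lam : K) ≠ 0 := fun h0 => h.ne_zero (RingOfIntegers.ext h0)
  have hd'K : (d' : K) ≠ 0 := by
    intro h0
    apply hd'
    rw [show d' = 0 from RingOfIntegers.ext h0]; exact dvd_zero _
  have hbeK : (b : K) = (lam : K) ^ k * b' := by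
    rw [hbe]; simp
  have hdeK : (d : K) = (lam : K) ^ l * d' := by
    rw [hde]; simp
  have hxe : x * (d : K) = b := by
    rw [← hbd]; exact div_mul_cancel₀ _ hdK
  rcases Nat.lt_or_ge k l with hkl | hkl
  · -- the inverse is divisible by `lam`
    obtain ⟨r, rfl⟩ : ∃ r, l = k + r + 1 := ⟨l - k - 1, by omega⟩
    have h1 : x * ((lam : K) * ((lam : K) ^ r * d')) = b' := by
      have : (lam : K) ^ k * (x * ((lam : K) * ((lam : K) ^ r * d'))) = (lam : K) ^ k * b' := by
        rw [← hbeK, ← hxe, hdeK]; ring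
      exact mul_left_cancel₀ (pow_ne_zero _ hlK) this
    have h2 : (⟨x ^ N, hx⟩ : cubLoc h) * (cubIn h lam * cubIn h (lam ^ r * d')) ^ N = 
        cubIn h b' ^ N := by
      apply Subtype.ext
      change x ^ N * ((lam : K) * ((lam ^ r * d' : 𝓞 K) : K)) ^ N = (b' : K) ^ N
      rw [← mul_pow, ← h1]; simp
    have h3 : IsUnit (cubIn h b' ^ N) := (cubLoc_isUnit h b' hb').pow N
    rw [← h2] at h3
    have h4 := (isUnit_pow_iff hN).1 (isUnit_of_mul_isUnit_right h3)
    exact cubLoc_not_unit h (isUnit_of_mul_isUnit_left h4)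
  · apply hx1
    obtain ⟨r, rfl⟩ : ∃ r, k = l + r := ⟨k - l, by omega⟩
    refine ⟨d', lam ^ r * b', hd', ?_⟩
    have : (lam : K) ^ l * (x * d') = (lam : K) ^ l * ((lam ^ r * b' : 𝓞 K) : K) := by
      have h5 : ((lam ^ r * b' : 𝓞 K) : K) = (lam : K) ^ r * b' := by simp
      rw [h5, ← mul_assoc (_ ^ l) (_ ^ r), ← pow_add, ← hbeK, ← hxe, hdeK]; ring
    exact mul_left_cancel₀ (pow_ne_zero _ hlK) this
end

section
variable {K : Type} [Field K] [NumberField K] {p : ℕ} [IsCyclotomicExtension {p} ℚ K]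
    {ζ : K} [NeZero p] (hζ : IsPrimitiveRoot ζ p)

theorem cub_adjoin_top : Algebra.adjoin ℤ {hζ.toInteger} = ⊤ := by
  rw [← hζ.integralPowerBasis_gen]
  exact hζ.integralPowerBasis.adjoin_gen_eq_top

theorem cub_resO (x : 𝓞 K) : ∃ c : ℤ, (hζ.toInteger - 1) ∣ x - c := by
  have hx : x ∈ Algebra.adjoin ℤ {hζ.toInteger} := by rw [cub_adjoin_top hζ]; trivial
  induction hx using Algebra.adjoin_induction with
  | mem y hy => 
    rw [Set.mem_singleton_iff.1 hy]
    exact ⟨1, by simp⟩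
  | algebraMap r => exact ⟨r, by simp⟩
  | add x y _ _ hx hy =>
    obtain ⟨c, hc⟩ := hx
    obtain ⟨d, hd⟩ := hy
    refine ⟨c + d, ?_⟩
    convert dvd_add hc hd using 1; push_cast; ring
  | mul x y _ _ hx hy =>
    obtain ⟨c, hc⟩ := hx
    obtain ⟨d, hd⟩ := hy
    refine ⟨c * d, ?_⟩
    convert dvd_add (hc.mul_right y) (hd.mul_left (c : 𝓞 K)) using 1; push_cast; ring

theorem cub_lam_prime (hp : p.Prime) : Prime (hζ.toInteger - 1) := by
  have : Fact p.Prime := ⟨hp⟩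
  exact hζ.zeta_sub_one_prime'

theorem cub_lam_int (hp : p.Prime) (c : ℤ) (h : (hζ.toInteger - 1) ∣ (c : 𝓞 K)) : (p : ℤ) ∣ c := by
  by_contra hc
  have hcop : IsCoprime (p : ℤ) c := (Prime.coprime_iff_not_dvd (Nat.prime_iff_prime_int.1 hp)).2 hc
  obtain ⟨u, v, huv⟩ := hcop
  have hl := cub_lam_prime hζ hp
  have hlp : (hζ.toInteger - 1) ∣ (p : 𝓞 K) :=
    (dvd_pow_self _ (by have := hp.two_le; omega)).trans (cub_p_assoc hp hζ).dvd
  apply hl.not_unit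
  apply isUnit_of_dvd_one
  have : (1 : 𝓞 K) = u * p + v * c := by exact_mod_cast huv.symm
  have h2 := dvd_add (hlp.mul_left (u : 𝓞 K)) (h.mul_left (v : 𝓞 K))
  rwa [← this] at h2

theorem cub_resLoc (hp : p.Prime) (x : cubLoc (cub_lam_prime hζ hp)) :
    ∃ c : ℤ, cubIn (cub_lam_prime hζ hp) (hζ.toInteger - 1) ∣ x - c := by
  obtain ⟨d, b, hd, hb⟩ := cubLoc_frac _ x
  obtain ⟨c, hc⟩ := cub_resO hζ b
  obtain ⟨e, he⟩ := cub_resO hζ d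
  have he2 : ¬ (p : ℤ) ∣ e := by
    rintro ⟨f, rfl⟩
    apply hd
    have hlp : (hζ.toInteger - 1) ∣ (p : 𝓞 K) :=
      (dvd_pow_self _ (by have := hp.two_le; omega)).trans (cub_p_assoc hp hζ).dvd
    have h2 : (hζ.toInteger - 1) ∣ ((p * f : ℤ) : 𝓞 K) := by
      push_cast; exact hlp.mul_right _
    simpa using dvd_add he h2
  obtain ⟨u, v, huv⟩ := (Prime.coprime_iff_not_dvd (Nat.prime_iff_prime_int.1 hp)).2 he2
  have hlp : (hζ.toInteger - 1) ∣ (p : 𝓞 K) :=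
      (dvd_pow_self _ (by have := hp.two_le; omega)).trans (cub_p_assoc hp hζ).dvd
  have h3 : (hζ.toInteger - 1) ∣ b - d * (v * c : ℤ) := by
    have : b - d * (v * c : ℤ) = (b - c) - (d - e) * (v * c : ℤ) + p * (u * c : ℤ) := by
      have h4 : (u * p + v * e : 𝓞 K) = 1 := by exact_mod_cast huv
      push_cast
      linear_combination (-c : 𝓞 K) * h4
    rw [this]
    exact dvd_add (dvd_sub hc (he.mul_right _)) (hlp.mul_right _)
  refine ⟨v * c, ?_⟩
  obtain ⟨q, hq⟩ := h3
  rw [← (cubLoc_isUnit _ d hd).dvd_mul_right]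
  refine ⟨cubIn _ q, ?_⟩
  rw [← cubIn_mul, ← hq, sub_mul, hb]
  apply Subtype.ext
  change (b : K) - ((v * c : ℤ) : K) * (d : K) = ((b - d * (v * c : ℤ) : 𝓞 K) : K)
  simp
  ring
end
end

section
open NumberField

section
variable {K : Type} [Field K] [NumberField K] {p : ℕ} [IsCyclotomicExtension {p} ℚ K]
    {ζ : K} [NeZero p] (hζ : IsPrimitiveRoot ζ p) (hp : p.Prime)

theorem cub_zetaA_pow : cubIn (cub_lam_prime hζ hp) hζ.toInteger ^ p = 1 := by
  apply Subtype.ext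
  change ζ ^ p = 1
  exact hζ.pow_eq_one

/-- The standard additive character with values in the localization. -/
def cubE : AddChar (ZMod p) (cubLoc (cub_lam_prime hζ hp)) :=
  AddChar.zmodChar p (cub_zetaA_pow hζ hp)

theorem cubE_val (z : ZMod p) : ((cubE hζ hp z : cubLoc (cub_lam_prime hζ hp)) : K) = ζ ^ z.val := by
  rw [cubE, AddChar.zmodChar_apply]
  rfl

theorem cub_zetaA_prim : IsPrimitiveRoot (cubIn (cub_lam_prime hζ hp) hζ.toInteger) p := by
  apply IsPrimitiveRoot.of_map_of_injective (f := (cubLoc (cub_lam_prime hζ hp)).subtype)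
  · exact hζ
  · exact Subtype.val_injective

theorem cub_prim (hp2 : 2 < p) (m : ℕ) (u : (Fin (m + 2) → ZMod p) → cubLoc (cub_lam_prime hζ hp))
    (hu : u ∈ cubF (cubE hζ hp) (m + 2)) (h0 : ∀ x, u (Fin.cons 0 x) = 1) (α : K)
    (hα : α ^ (p ^ m) * ((∏ x : Fin (m+1) → ZMod p, u (Fin.cons 1 x) :
        cubLoc (cub_lam_prime hζ hp)) : K) = 1 ∨
      α ^ (p ^ m) = ((∏ x : Fin (m+1) → ZMod p, u (Fin.cons 1 x) :
        cubLoc (cub_lam_prime hζ hp)) : K)) :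
    ∃ (k : ℕ) (d b : 𝓞 K), ¬ (hζ.toInteger - 1) ∣ d ∧
      (d : K) * (ζ ^ k * α - 1) = (ζ - 1) ^ p * b := by
  have hl := cub_lam_prime hζ hp
  have hF : Fact p.Prime := ⟨hp⟩
  let Z := cubIn (cub_lam_prime hζ hp) hζ.toInteger
  have hZl : cubIn (cub_lam_prime hζ hp) (hζ.toInteger - 1) = Z - 1 := rfl
  have hE : (cubE hζ hp).IsPrimitive :=
    AddChar.zmodChar_primitive_of_primitive_root p (cub_zetaA_prim hζ hp)
  have hdvd : ∀ z, ∃ w, cubE hζ hp z - 1 = (Z - 1) * w := by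
    intro z
    rw [cubE, AddChar.zmodChar_apply]
    have := sub_dvd_pow_sub_pow Z 1 z.val
    rw [one_pow] at this
    exact this
  obtain ⟨w, hw, hw2⟩ := cubF_diff (cubE hζ hp) hdvd u hu
  have hpc : ∀ x, ((x : 𝓞 K) : K) = x := fun _ => rfl
  have hass : Associated ((Z - 1) ^ (p - 1)) (p : cubLoc (cub_lam_prime hζ hp)) := by
    obtain ⟨v, hv⟩ := cub_p_assoc hp hζ
    have hvu : IsUnit (cubIn (cub_lam_prime hζ hp) (v : 𝓞 K)) := by
      apply cubLoc_isUnit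
      intro hd
      exact hl.not_unit (isUnit_of_dvd_unit hd v.isUnit)
    refine ⟨hvu.unit, ?_⟩
    apply Subtype.ext
    have := congrArg (algebraMap (𝓞 K) K) hv
    rw [map_mul, map_pow, map_natCast] at this
    exact this
  obtain ⟨ν', hν⟩ := hass.symm.dvd
  have hunits : ∀ j : ℕ, 0 < j → j < p → IsUnit (j : cubLoc (cub_lam_prime hζ hp)) := by
    intro j hj hjp
    have h1 := cubLoc_isUnit (cub_lam_prime hζ hp) (j : 𝓞 K) (by
      intro hd
      have h2 := cub_lam_int hζ hp (j : ℤ) (by exact_mod_cast hd)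
      have h3 : p ∣ j := by exact_mod_cast h2
      exact absurd (Nat.le_of_dvd hj h3) (by omega))
    have h4 : cubIn (cub_lam_prime hζ hp) (j : 𝓞 K) = (j : cubLoc (cub_lam_prime hζ hp)) := by
      apply Subtype.ext
      change algebraMap (𝓞 K) K (j : 𝓞 K) = _
      rw [map_natCast]; rfl
    rwa [h4] at h1
  obtain ⟨w', hw'⟩ := cubF_prod (cubE hζ hp) hE hunits (Z - 1) ν' hν (m+1) (Z - 1) dvd_rfl w hw
  have hP : ∏ x : Fin (m+1) → ZMod p, u (Fin.cons 1 x) = 1 + p ^ (m+1) * (Z - 1) * w' := by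
    rw [← hw']
    apply Finset.prod_congr rfl
    intro x _
    rw [← hw2, h0]; ring
  set P := ∏ x : Fin (m+1) → ZMod p, u (Fin.cons 1 x) with hPdef
  have hnu := cubLoc_not_unit (cub_lam_prime hζ hp)
  rw [hZl] at hnu
  have hPu : IsUnit P := by
    apply cubLoc_unit
    rw [hZl]
    intro hd
    apply hnu
    apply isUnit_of_dvd_one
    have : (1 : cubLoc (cub_lam_prime hζ hp)) = P - (Z - 1) * (p ^ (m+1) * w') := by rw [hP]; ring
    have h2 := dvd_sub hd (dvd_mul_right (Z - 1) (p ^ (m+1) * w'))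
    rwa [← this] at h2
  obtain ⟨Q, hQ⟩ := hPu.exists_right_inv
  have hQK : (P : K) * (Q : K) = 1 := congrArg (fun y : cubLoc (cub_lam_prime hζ hp) => (y : K)) hQ
  have hmain : ∃ Y : cubLoc (cub_lam_prime hζ hp), α ^ (p ^ m) = Y ∧
      (p ^ (m+1) * (Z - 1)) ∣ Y - 1 := by
    rcases hα with h | h
    · refine ⟨Q, ?_, -(w' * Q), ?_⟩
      · calc α ^ (p^m) = α ^ (p^m) * ((P : K) * (Q : K)) := by rw [hQK, mul_one]
          _ = (α ^ (p^m) * P) * Q := by ring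
          _ = Q := by rw [h, one_mul]
      · rw [hP] at hQ
        linear_combination hQ
    · exact ⟨P, h, w', by rw [hP]; ring⟩
  obtain ⟨Y, hY1, hY2⟩ := hmain
  have hαA : α ∈ cubLoc (cub_lam_prime hζ hp) := by
    apply cubLoc_root _ α (p ^ m) (pow_ne_zero _ hp.ne_zero)
    rw [hY1]; exact Y.2
  have hY3 : Y = (⟨α, hαA⟩ : cubLoc (cub_lam_prime hζ hp)) ^ (p ^ m) := Subtype.ext hY1.symm
  rw [hY3] at hY2
  obtain ⟨k, c, hk⟩ := cub_endgame hp hp2 (cub_zetaA_pow hζ hp) hass (cub_resLoc hζ hp)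
    (cubLoc_unit _) hnu (by
      intro h0
      have h1 := congrArg (fun y : cubLoc (cub_lam_prime hζ hp) => (y : K)) h0
      have h2 : (p : K) = 0 := by simpa using h1
      exact hp.ne_zero (by exact_mod_cast h2)) m _ hY2
  obtain ⟨d, b, hd, hb⟩ := c.2
  refine ⟨k, d, b, hd, ?_⟩
  have h5 : ζ ^ k * α - 1 = (ζ - 1) ^ p * (c : K) := 
    congrArg (fun y : cubLoc (cub_lam_prime hζ hp) => (y : K)) hk
  rw [h5, ← hb]; ring
end
end

section
open NumberField
section
variable {K : Type} [Field K] [NumberField K] {p : ℕ} [hpF : Fact p.Prime]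
  [IsCyclotomicExtension {p} ℚ K] {ζ : K} (hζ : IsPrimitiveRoot ζ p)

def cubS (k : ZMod p) : 𝓞 K := ∑ i ∈ Finset.range k.val, hζ.toInteger ^ i

lemma cubS_mul (k : ZMod p) : cubS hζ k * (hζ.toInteger - 1) = hζ.toInteger ^ k.val - 1 :=
  geom_sum_mul _ _

lemma cub_Z_mod (i : ℕ) : hζ.toInteger ^ (i % p) = hζ.toInteger ^ i := by
  have h := hζ.toInteger_isPrimitiveRoot.pow_eq_one
  conv_rhs => rw [← Nat.div_add_mod i p, pow_add, pow_mul, h, one_pow, one_mul]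

lemma cub_Z_ne : hζ.toInteger - 1 ≠ 0 := by
  intro h
  have h1 : hζ.toInteger = 1 := sub_eq_zero.1 h
  have h2 := hζ.toInteger_isPrimitiveRoot.ne_one hpF.out.one_lt
  exact h2 h1

lemma cubS_nat (i : ℕ) : cubS hζ (i : ZMod p) = ∑ j ∈ Finset.range i, hζ.toInteger ^ j := by
  apply mul_right_cancel₀ (cub_Z_ne hζ)
  rw [cubS_mul, geom_sum_mul, ZMod.val_natCast, cub_Z_mod]

lemma cubS_add (k : ZMod p) (l : ℕ) :
    cubS hζ (k + l) = cubS hζ (l : ZMod p) + cubS hζ k * hζ.toInteger ^ l := by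
  apply mul_right_cancel₀ (cub_Z_ne hζ)
  rw [add_mul, cubS_mul, cubS_mul, mul_right_comm, cubS_mul, ZMod.val_add, cub_Z_mod, pow_add,
    ZMod.val_natCast, cub_Z_mod]
  ring

lemma cubS_one : cubS hζ (1 : ZMod p) = 1 := by
  have := cubS_nat hζ 1
  simpa using this

lemma cub_O_ind {V : Type*} [AddCommGroup V] (Φ Φ' : 𝓞 K →+ V)
    (h : ∀ k, Φ (cubS hζ k) = Φ' (cubS hζ k)) : Φ = Φ' := by
  have h2 : ∀ i : ℕ, Φ (hζ.toInteger ^ i) = Φ' (hζ.toInteger ^ i) := by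
    intro i
    have : hζ.toInteger ^ i = cubS hζ ((i+1 : ℕ) : ZMod p) - cubS hζ (i : ZMod p) := by
      rw [cubS_nat, cubS_nat, Finset.sum_range_succ]; ring
    rw [this, map_sub, map_sub, h, h]
  have h3 : Φ.toIntLinearMap = Φ'.toIntLinearMap := by
    apply hζ.integralPowerBasis.basis.ext
    intro i
    rw [PowerBasis.basis_eq_pow, IsPrimitiveRoot.integralPowerBasis_gen]
    exact h2 _
  ext x
  exact congrArg (fun f => f x) h3

lemma cub_two {V : Type*} [AddCommGroup V] (f : ZMod p → ZMod p → V)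
    (hc : ∀ y0 y1 y2, f (y0 + y1) y2 + f y0 y1 = f y1 y2 + f y0 (y1 + y2))
    (h1 : ∀ l, f 0 l = 0) (h2 : ∀ k, f k 0 = 0) :
    ∃ Φ : 𝓞 K →+ V, ∀ k l, f k l = Φ (cubS hζ k * cubS hζ l) := by
  have hp : p.Prime := hpF.out
  let D : ℕ → V := fun i => f (i + 1) 1 - f i 1
  have hDp : ∀ i, D (i % p) = D i := by intro i; simp [D]
  let Φl : 𝓞 K →ₗ[ℤ] V := hζ.integralPowerBasis.basis.constr ℤ (fun i => D i)
  have hdim : hζ.integralPowerBasis.dim = p - 1 := by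
    rw [IsPrimitiveRoot.integralPowerBasis_dim, Nat.totient_prime hp]
  have hsmall : ∀ i, i < p - 1 → Φl (hζ.toInteger ^ i) = D i := by
    intro i hi
    have := hζ.integralPowerBasis.basis.constr_basis ℤ (fun i => D i) ⟨i, by rw [hdim]; exact hi⟩
    rw [PowerBasis.basis_eq_pow, IsPrimitiveRoot.integralPowerBasis_gen] at this
    exact this
  have htel : ∀ i, ∑ j ∈ Finset.range i, D j = f (i : ZMod p) 1 := by
    intro i
    induction i with
    | zero => simp [h1]
    | succ i ih => rw [Finset.sum_range_succ, ih]; simp [D]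
  have hlt : ∀ i, i < p → Φl (hζ.toInteger ^ i) = D i := by
    intro i hi
    by_cases h : i < p - 1
    · exact hsmall i h
    · have hi' : i = p - 1 := by omega
      subst hi'
      have hg := hζ.toInteger_isPrimitiveRoot.geom_sum_eq_zero hp.one_lt
      have hT := htel p
      have hg' : ∑ j ∈ Finset.range (p-1), hζ.toInteger ^ j + hζ.toInteger ^ (p - 1) = 0 := by
        rw [← Finset.sum_range_succ, Nat.sub_add_cancel hp.one_le, hg]
      have hT' : ∑ j ∈ Finset.range (p-1), D j + D (p - 1) = 0 := by
        rw [← Finset.sum_range_succ, Nat.sub_add_cancel hp.one_le, hT]; simp [h1]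
      rw [eq_neg_of_add_eq_zero_right hg', map_neg, map_sum, eq_neg_of_add_eq_zero_right hT']
      congr 1
      exact Finset.sum_congr rfl fun j hj => hsmall j (Finset.mem_range.1 hj)
  have hall : ∀ i, Φl (hζ.toInteger ^ i) = D i := by
    intro i
    rw [← cub_Z_mod, hlt _ (Nat.mod_lt _ hp.pos), hDp]
  have hf1 : ∀ k, f k 1 = Φl (cubS hζ k) := by
    intro k
    have := htel k.val
    rw [ZMod.natCast_zmod_val] at this
    rw [← this, cubS, map_sum]
    exact Finset.sum_congr rfl fun j _ => (hall j).symm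
  have hfn : ∀ k (l : ℕ), f k (l : ZMod p) = Φl (cubS hζ k * cubS hζ (l : ZMod p)) := by
    intro k l
    induction l with
    | zero => simp [h2, cubS]
    | succ l ih =>
      have h3 := hc k l 1
      have h4 : f k ((l : ZMod p) + 1) = f (k + l) 1 - f (l : ZMod p) 1 + f k l := by
        rw [sub_add_eq_add_sub, h3]; abel
      rw [Nat.cast_succ, h4, hf1, hf1, ih, ← map_sub, ← map_add]
      congr 1
      have h5 := cubS_add hζ (1 : ZMod p) l
      rw [cubS_one] at h5
      rw [cubS_add, add_comm (l : ZMod p) 1, h5]; ring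
  refine ⟨Φl.toAddMonoidHom, fun k l => ?_⟩
  have := hfn k l.val
  rw [ZMod.natCast_zmod_val] at this
  exact this

lemma cub_swap {m : ℕ} {X : Type*} (k l : X) (z : Fin m → X) (j : Fin m) :
    (fun i => (Fin.cons k (Fin.cons l z : Fin (m+1) → X) : Fin (m+2) → X)
      (Equiv.swap 1 j.succ.succ i)) =
    Fin.cons k (Fin.cons (z j) (Function.update z j l) : Fin (m+1) → X) := by
  funext i
  have e1 : (1 : Fin (m+2)) = (0 : Fin (m+1)).succ := rfl
  by_cases h1 : i = 1
  · subst h1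
    rw [Equiv.swap_apply_left, e1]
    rw [Fin.cons_succ, Fin.cons_succ, Fin.cons_succ, Fin.cons_zero]
  by_cases h2 : i = j.succ.succ
  · subst h2
    rw [Equiv.swap_apply_right, e1]; simp
  rw [Equiv.swap_apply_of_ne_of_ne h1 h2]
  induction i using Fin.cases with
  | zero => simp
  | succ i =>
    induction i using Fin.cases with
    | zero => exact absurd rfl h1
    | succ i =>
      have : i ≠ j := fun h => h2 (by rw [h])
      simp [this]

lemma cub_cm {V : Type*} [AddCommGroup V] {m : ℕ} (a : (Fin (m+2) → ZMod p) → V)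
    (hs : ∀ (σ : Equiv.Perm (Fin (m+2))) x, a (fun i => x (σ i)) = a x)
    (hc : ∀ y0 y1 y2 (z : Fin m → ZMod p),
      a (Fin.cons (y0 + y1) (Fin.cons y2 z : Fin (m+1) → ZMod p)) +
        a (Fin.cons y0 (Fin.cons y1 z : Fin (m+1) → ZMod p)) =
      a (Fin.cons y1 (Fin.cons y2 z : Fin (m+1) → ZMod p)) +
        a (Fin.cons y0 (Fin.cons (y1 + y2) z : Fin (m+1) → ZMod p)))
    (h0 : ∀ x i, x i = 0 → a x = 0) :
    ∃ Φ : 𝓞 K →+ V, ∀ x, a x = Φ (∏ i, cubS hζ (x i)) := by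
  have h := fun z : Fin m → ZMod p => cub_two hζ
    (fun k l => a (Fin.cons k (Fin.cons l z : Fin (m+1) → ZMod p)))
    (fun y0 y1 y2 => hc y0 y1 y2 z) (fun l => h0 _ 0 (by simp)) (fun k => h0 _ 1 (by
      have e1 : (1 : Fin (m+2)) = (0 : Fin (m+1)).succ := rfl
      rw [e1]; simp))
  choose Φ hΦ using h
  have hstep : ∀ z j u, Φ z u = Φ (Function.update z j 1) (u * cubS hζ (z j)) := by
    intro z j u
    have : Φ z = (Φ (Function.update z j 1)).comp (AddMonoidHom.mulRight (cubS hζ (z j))) := by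
      apply cub_O_ind hζ
      intro k
      have h1 := hΦ z k 1
      rw [cubS_one, mul_one] at h1
      rw [← h1, ← hs (Equiv.swap 1 j.succ.succ), cub_swap]
      exact hΦ _ _ _
    rw [this]; rfl
  have hT : ∀ (T : Finset (Fin m)) z u,
      Φ z u = Φ (T.piecewise 1 z) (u * ∏ j ∈ T, cubS hζ (z j)) := by
    intro T
    induction T using Finset.induction_on with
    | empty => intro z u; simp
    | insert j T hj ih =>
      intro z u
      rw [ih, hstep _ j, Finset.piecewise_insert, Finset.prod_insert hj,
        Finset.piecewise_eq_of_notMem _ _ _ hj]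
      congr 1; ring
  refine ⟨Φ 1, fun x => ?_⟩
  have hx : x = Fin.cons (x 0) (Fin.cons (x 1) (fun i => x i.succ.succ) : Fin (m+1) → ZMod p) := by
    funext i
    induction i using Fin.cases with
    | zero => simp
    | succ i =>
      induction i using Fin.cases with
      | zero => rfl
      | succ i => simp
  have h2 := hΦ (fun i => x i.succ.succ) (x 0) (x 1)
  rw [← hx] at h2
  rw [h2, hT Finset.univ]
  have : (Finset.univ : Finset (Fin m)).piecewise (1 : Fin m → ZMod p)
      (fun i => x i.succ.succ) = 1 := by funext i; simp
  rw [this]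
  congr 1
  rw [Fin.prod_univ_succ, Fin.prod_univ_succ, mul_assoc]
  rfl
end
end

section
open NumberField
section
variable {K : Type} [Field K] [NumberField K] {p : ℕ} [hpF : Fact p.Prime]
  [IsCyclotomicExtension {p} ℚ K] {ζ : K} (hζ : IsPrimitiveRoot ζ p)

lemma cubS_tot : (∑ x : ZMod p, cubS hζ x) * (hζ.toInteger - 1) = -(p : 𝓞 K) := by
  have hp : p.Prime := hpF.out
  rw [Finset.sum_mul]
  simp_rw [cubS_mul]
  rw [Finset.sum_sub_distrib]
  have h1 : ∑ x : ZMod p, hζ.toInteger ^ x.val = ∑ i ∈ Finset.range p, hζ.toInteger ^ i := by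
    refine Finset.sum_bij (fun x _ => x.val) (fun x _ => Finset.mem_range.2 (ZMod.val_lt x))
      (fun x _ y _ h => ZMod.val_injective p h) (fun i hi => ⟨(i : ZMod p), Finset.mem_univ _, ?_⟩)
      (fun x _ => rfl)
    exact ZMod.val_natCast_of_lt (Finset.mem_range.1 hi)
  rw [h1, hζ.toInteger_isPrimitiveRoot.geom_sum_eq_zero hp.one_lt]
  simp [ZMod.card]

lemma cub_sumA {V : Type*} [AddCommGroup V] {m : ℕ} (hm : m + 2 ≤ p)
    (a : (Fin (m+2) → ZMod p) → V)
    (Φ : 𝓞 K →+ V) (hΦ : ∀ x, a x = Φ (∏ i, cubS hζ (x i))) :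
    ∃ α : V, ∑ i : Fin (m+1) → ZMod p, a (Fin.cons 1 i) = ((-1) ^ (m+1) * (p : ℤ) ^ m) • α := by
  have hp : p.Prime := hpF.out
  obtain ⟨w, hw⟩ := (cub_p_assoc hp hζ).dvd
  set T := ∑ x : ZMod p, cubS hζ x with hT
  have hTl := cubS_tot hζ
  rw [← hT] at hTl
  let v := (hζ.toInteger - 1) ^ (p - 1 - (m+1)) * w
  have hv : (hζ.toInteger - 1) ^ (m+1) * v = p := by
    rw [hw, ← mul_assoc, ← pow_add]
    congr 2
    omega
  refine ⟨Φ v, ?_⟩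
  have h1 : ∑ i : Fin (m+1) → ZMod p, a (Fin.cons 1 i) = Φ (T ^ (m+1)) := by
    simp_rw [hΦ]
    rw [← map_sum]
    congr 1
    rw [hT, Fintype.sum_pow]
    apply Finset.sum_congr rfl
    intro x _
    rw [Fin.prod_univ_succ]
    simp [cubS_one]
  have h2 : T ^ (m+1) = ((-1) ^ (m+1) * (p : ℤ) ^ m : ℤ) • v := by
    apply mul_left_cancel₀ (pow_ne_zero (m+1) (cub_Z_ne hζ))
    rw [mul_smul_comm, hv, ← mul_pow, mul_comm _ T, hTl, zsmul_eq_mul]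
    push_cast
    rw [neg_pow]; ring
  rw [h1, h2, map_zsmul]
end
section
variable {p : ℕ} [hpF : Fact p.Prime] {V : Type*} [AddCommGroup V]

def cubG (n : ℕ) (f : ZMod p → V) (x : Fin n → ZMod p) : V :=
  ∑ I : Finset (Fin n), if Even (n - I.card) then f (∑ i ∈ I, x i) else - f (∑ i ∈ I, x i)

abbrev cubZ (p : ℕ) := MonoidAlgebra ℤ (Multiplicative (ZMod p))

def cubE' (x : ZMod p) : cubZ p := MonoidAlgebra.single (Multiplicative.ofAdd x) 1

def cubFl (f : ZMod p → V) : cubZ p →+ V where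
  toFun z := ∑ k : ZMod p, z.coeff (Multiplicative.ofAdd k) • f k
  map_zero' := by simp
  map_add' x y := by simp [add_smul, Finset.sum_add_distrib]

lemma cubFl_E (f : ZMod p → V) (x : ZMod p) : cubFl f (cubE' x) = f x := by
  change ∑ k : ZMod p, (cubE' x).coeff (Multiplicative.ofAdd k) • f k = _
  rw [Finset.sum_eq_single x]
  · simp [cubE']
  · intro b _ hb
    simp [cubE', Finsupp.single_apply, hb.symm]
  · simp

lemma cubE'_zero : cubE' (0 : ZMod p) = 1 := rfl

lemma cubE'_add (x y : ZMod p) : cubE' (x + y) = cubE' x * cubE' y := by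
  simp [cubE', MonoidAlgebra.single_mul_single]

lemma cubE'_sum {ι : Type*} (I : Finset ι) (x : ι → ZMod p) :
    cubE' (∑ i ∈ I, x i) = ∏ i ∈ I, cubE' (x i) := by
  classical
  induction I using Finset.induction_on with
  | empty => simp [cubE'_zero]
  | insert j T hj ih => rw [Finset.sum_insert hj, Finset.prod_insert hj, cubE'_add, ih]

lemma cubG_eq (n : ℕ) (f : ZMod p → V) (x : Fin n → ZMod p) :
    cubG n f x = cubFl f (∏ i, (cubE' (x i) - 1)) := by
  simp_rw [sub_eq_add_neg]
  rw [Finset.prod_add, map_sum, Finset.powerset_univ, cubG]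
  apply Finset.sum_congr rfl
  intro I _
  rw [← cubE'_sum, Finset.prod_const, ← Finset.compl_eq_univ_sdiff, Finset.card_compl,
    Fintype.card_fin]
  by_cases h : Even (n - I.card)
  · rw [if_pos h, h.neg_one_pow, mul_one, cubFl_E]
  · rw [if_neg h, (Nat.not_even_iff_odd.1 h).neg_one_pow, mul_neg_one, map_neg, cubFl_E]

lemma cubG_zero (n : ℕ) (f : ZMod p → V) (x : Fin n → ZMod p) (i : Fin n) (h : x i = 0) :
    cubG n f x = 0 := by
  rw [cubG_eq, Finset.prod_eq_zero (Finset.mem_univ i), map_zero]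
  rw [h, cubE'_zero, sub_self]

lemma cubG_sum (k : ℕ) (f : ZMod p → V) :
    ∑ i : Fin k → ZMod p, cubG (k+1) f (Fin.cons 1 i) = ((-1) ^ k * (p : ℤ) ^ k) • (f 1 - f 0) := by
  simp_rw [cubG_eq]
  rw [← map_sum]
  simp_rw [Fin.prod_univ_succ]
  simp only [Fin.cons_zero, Fin.cons_succ]
  rw [← Finset.mul_sum, ← Fintype.sum_pow (fun x : ZMod p => cubE' x - 1) k]
  have h1 : (cubE' (1 : ZMod p) - 1) * ∑ x : ZMod p, (cubE' x - 1) =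
      (cubE' (1 : ZMod p) - 1) * (-1 * p) := by
    rw [Finset.sum_sub_distrib, mul_sub, sub_mul, Finset.mul_sum]
    simp_rw [← cubE'_add]
    rw [Fintype.sum_equiv (Equiv.addLeft (1 : ZMod p)) (fun i => cubE' (1 + i)) cubE' (fun _ => rfl)]
    simp [ZMod.card]
  have h2 : ∀ k : ℕ, (cubE' (1 : ZMod p) - 1) * (∑ x : ZMod p, (cubE' x - 1)) ^ k =
      ((-1) ^ k * (p : ℤ) ^ k) • (cubE' (1 : ZMod p) - 1) := by
    intro k
    induction k with
    | zero => simp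
    | succ k ih =>
      rw [pow_succ, ← mul_assoc, ih, smul_mul_assoc, h1, zsmul_eq_mul, zsmul_eq_mul]
      push_cast; ring
  rw [h2, map_zsmul, map_sub, cubFl_E, ← cubE'_zero, cubFl_E]
end
end

section
open NumberField
section
variable {K : Type} [Field K] [NumberField K]

abbrev cubP (K : Type) [Field K] := Submodule (𝓞 K) K

def cubSp : Kˣ →* (cubP K)ˣ := Units.map
  { toFun := fun x => Submodule.span (𝓞 K) {x}
    map_one' := Submodule.one_eq_span.symm
    map_mul' := fun x y => by rw [Submodule.span_mul_span, Set.singleton_mul_singleton] }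

lemma cubSp_val (x : Kˣ) : ((cubSp x : (cubP K)ˣ) : cubP K) = Submodule.span (𝓞 K) {(x : K)} := rfl

lemma cub_one_iff (x : K) : x ∈ (1 : cubP K) ↔ ∃ y : 𝓞 K, algebraMap (𝓞 K) K y = x := by
  rw [Submodule.mem_one]

lemma cub_le_one (L : (cubP K)ˣ) (k : ℕ) (hk : k ≠ 0) (h : L ^ k = 1) : (L : cubP K) ≤ 1 := by
  intro x hx
  have h1 : x ^ k ∈ (L : cubP K) ^ k := Submodule.pow_mem_pow _ hx k
  rw [← Units.val_pow_eq_pow_val, h, Units.val_one, cub_one_iff] at h1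
  obtain ⟨y, hy⟩ := h1
  have h2 : IsIntegral (𝓞 K) x := by
    apply IsIntegral.of_pow (Nat.pos_of_ne_zero hk)
    rw [← hy]; exact isIntegral_algebraMap
  obtain ⟨z, hz⟩ := (IsIntegrallyClosed.isIntegral_iff (R := 𝓞 K) (K := K)).1 h2
  exact (cub_one_iff x).2 ⟨z, hz⟩

lemma cub_unit_le {A B : (cubP K)ˣ} (C : (cubP K)ˣ) (h : (A : cubP K) ≤ B) :
    ((A * C : (cubP K)ˣ) : cubP K) ≤ (B * C : (cubP K)ˣ) := by
  rw [Units.val_mul, Units.val_mul]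
  exact mul_le_mul_left h _

lemma cub_tf (L : (cubP K)ˣ) (k : ℕ) (hk : k ≠ 0) (h : L ^ k = 1) : L = 1 := by
  apply Units.ext
  apply le_antisymm (cub_le_one L k hk h)
  have h2 := cub_unit_le L (A := L⁻¹) (B := 1)
    (by exact cub_le_one L⁻¹ k hk (by rw [inv_pow, h, inv_one]))
  rwa [inv_mul_cancel, one_mul] at h2

lemma cub_tfz (L L' : (cubP K)ˣ) (k : ℤ) (hk : k ≠ 0) (h : L ^ k = L' ^ k) : L = L' := by
  have h1 : (L / L') ^ k = 1 := by rw [div_zpow, h, div_self']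
  have h2 : (L / L') ^ k.natAbs = 1 := by
    rcases Int.natAbs_eq k with h3 | h3
    · rw [h3, zpow_natCast] at h1; exact h1
    · rw [h3, zpow_neg, zpow_natCast, inv_eq_one] at h1; exact h1
  exact div_eq_one.1 (cub_tf _ _ (Int.natAbs_ne_zero.2 hk) h2)

lemma cub_clear (L : (cubP K)ˣ) : ∃ (e : Kˣ) (I : Ideal (𝓞 K)),
    IsLocalization.coeSubmodule K I = ((cubSp e * L : (cubP K)ˣ) : cubP K) := by
  have h0 : ((L⁻¹ : (cubP K)ˣ) : cubP K) ≠ ⊥ := by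
    intro h
    have h1 := L.mul_inv
    rw [h, Submodule.mul_bot] at h1
    have h2 : (1 : K) ∈ (⊥ : cubP K) := by rw [h1]; exact Submodule.one_le.1 le_rfl
    exact one_ne_zero ((Submodule.mem_bot _).1 h2)
  obtain ⟨e, he, he0⟩ := Submodule.exists_mem_ne_zero_of_ne_bot h0
  refine ⟨Units.mk0 e he0, Submodule.comap (Algebra.linearMap (𝓞 K) K)
    ((cubSp (Units.mk0 e he0) * L : (cubP K)ˣ) : cubP K), ?_⟩
  rw [IsLocalization.coeSubmodule, Submodule.map_comap_eq, ← Submodule.one_eq_range]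
  apply inf_eq_right.2
  have h3 := cub_unit_le L (A := cubSp (Units.mk0 e he0)) (B := L⁻¹) (by
    rw [cubSp_val, Submodule.span_singleton_le_iff_mem]; exact he)
  rwa [inv_mul_cancel] at h3

lemma cub_coe_pow (I : Ideal (𝓞 K)) (k : ℕ) : IsLocalization.coeSubmodule K (I ^ k) =
    (IsLocalization.coeSubmodule K I) ^ k := by
  induction k with
  | zero => rw [pow_zero, pow_zero, Ideal.one_eq_top, IsLocalization.coeSubmodule_top]
  | succ k ih => rw [pow_succ, pow_succ, IsLocalization.coeSubmodule_mul, ih]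

lemma cub_princ_of (L : (cubP K)ˣ) (e : Kˣ) (I : Ideal (𝓞 K))
    (h : IsLocalization.coeSubmodule K I = ((cubSp e * L : (cubP K)ˣ) : cubP K))
    (hI : I.IsPrincipal) : ∃ γ : Kˣ, L = cubSp γ := by
  obtain ⟨⟨g, hg⟩⟩ := hI
  have hg' : I = Ideal.span {g} := hg
  rw [hg', IsLocalization.coeSubmodule_span_singleton] at h
  have hg0 : algebraMap (𝓞 K) K g ≠ 0 := by
    intro h0
    rw [h0, Submodule.span_singleton_eq_bot.2 rfl] at h
    have h1 := (cubSp e * L).mul_inv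
    rw [← h, Submodule.bot_mul] at h1
    have h2 : (1 : K) ∈ (⊥ : cubP K) := by rw [h1]; exact Submodule.one_le.1 le_rfl
    exact one_ne_zero ((Submodule.mem_bot _).1 h2)
  refine ⟨e⁻¹ * Units.mk0 _ hg0, ?_⟩
  have h3 : cubSp (Units.mk0 _ hg0) = cubSp e * L := Units.ext (by rw [← h]; rfl)
  rw [map_mul, h3, map_inv, inv_mul_cancel_left]

variable {p : ℕ} [hpF : Fact p.Prime]
  [IsCyclotomicExtension {p} ℚ K] {ζ : K} (hζ : IsPrimitiveRoot ζ p)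

lemma cub_princ (hp2 : 2 < p) (cc : CubConj K ζ p) (L : (cubP K)ˣ) (x : Kˣ)
    (hx : cubSp x = L ^ p) (d b : 𝓞 K) (hd : ¬ (hζ.toInteger - 1) ∣ d)
    (hprim : (d : K) * (x - 1) = (ζ - 1) ^ p * b) : ∃ γ : Kˣ, L = cubSp γ := by
  obtain ⟨e, I, hI⟩ := cub_clear L
  apply cub_princ_of L e I hI
  have h1 : IsLocalization.coeSubmodule K (I ^ p) = ((cubSp (x * e ^ p) : (cubP K)ˣ) : cubP K) := by
    rw [cub_coe_pow, hI, ← Units.val_pow_eq_pow_val, mul_pow, ← hx, map_mul, map_pow, mul_comm]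
  have h2 : ((x * e ^ p : Kˣ) : K) ∈ IsLocalization.coeSubmodule K (I ^ p) := by
    rw [h1, cubSp_val]; exact Submodule.mem_span_singleton_self _
  obtain ⟨a, _, ha⟩ := (IsLocalization.mem_coeSubmodule K _).1 h2
  refine cub_nt hpF.out hp2 hζ cc (x : K) (e : K) I a ?_ ?_ ?_ d b hd hprim
  · rintro rfl
    rw [map_zero] at ha
    exact (x * e ^ p).ne_zero ha.symm
  · apply IsFractionRing.coeSubmodule_injective (𝓞 K) K
    rw [h1, IsLocalization.coeSubmodule_span_singleton, ha, cubSp_val]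
  · have : algebraMap (𝓞 K) K a = x * e ^ p := by rw [ha]; simp
    exact this

theorem cub_core (hp2 : 2 < p) (cc : CubConj K ζ p) {m : ℕ} (hm : m + 2 ≤ p)
    (a : (Fin (m+2) → ZMod p) → Kˣ)
    (hs : ∀ (σ : Equiv.Perm (Fin (m+2))) x, a (fun i => x (σ i)) = a x)
    (hc : ∀ y0 y1 y2 (z : Fin m → ZMod p),
      a (Fin.cons (y0 + y1) (Fin.cons y2 z : Fin (m+1) → ZMod p)) *
        a (Fin.cons y0 (Fin.cons y1 z : Fin (m+1) → ZMod p)) =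
      a (Fin.cons y1 (Fin.cons y2 z : Fin (m+1) → ZMod p)) *
        a (Fin.cons y0 (Fin.cons (y1 + y2) z : Fin (m+1) → ZMod p)))
    (h0 : ∀ x i, x i = 0 → a x = 1)
    (J : ZMod p → (cubP K)ˣ)
    (hJ : ∀ x, Additive.ofMul (cubSp (a x)) = cubG (m+2) (fun y => Additive.ofMul (J y)) x)
    (b0 : ZMod p → Kˣ) (u : (Fin (m + 2) → ZMod p) → cubLoc (cub_lam_prime hζ hpF.out))
    (hu : u ∈ cubF (cubE hζ hpF.out) (m + 2))
    (hu2 : ∀ x, (u x : K) *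
      ((Additive.toMul (cubG (m+2) (fun y => Additive.ofMul (b0 y)) x) : Kˣ) : K) = a x) :
    ∃ γ : Kˣ, J 1 = J 0 * cubSp γ := by
  have hp : p.Prime := hpF.out
  obtain ⟨Φ, hΦ⟩ := cub_cm hζ (fun x => Additive.ofMul (a x))
    (fun σ x => congrArg Additive.ofMul (hs σ x))
    (fun y0 y1 y2 z => congrArg Additive.ofMul (hc y0 y1 y2 z))
    (fun x i h => congrArg Additive.ofMul (h0 x i h))
  obtain ⟨α, hα⟩ := cub_sumA hζ hm _ Φ hΦ
  have hb := cubG_sum (m+1) (fun y => Additive.ofMul (b0 y))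
  have hJs := cubG_sum (m+1) (fun y => Additive.ofMul (J y))
  set c : ℤ := (-1) ^ (m+1) * (p : ℤ) ^ m with hcdef
  have hc2 : (-1 : ℤ) ^ (m+1) * (p : ℤ) ^ (m+1) = c * p := by rw [hcdef]; ring
  have hc0 : c ≠ 0 := mul_ne_zero (pow_ne_zero _ (by norm_num))
    (pow_ne_zero _ (by exact_mod_cast hp.ne_zero))
  rw [hc2, mul_smul] at hb hJs
  let uu : (Fin (m + 2) → ZMod p) → Kˣ := fun x =>
    a x / Additive.toMul (cubG (m+2) (fun y => Additive.ofMul (b0 y)) x)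
  have huu : ∀ x, (uu x : K) = u x := by
    intro x
    simp only [uu]
    rw [Units.val_div_eq_div_val, ← hu2, mul_div_cancel_right₀ _ (Units.ne_zero _)]
  let α0 : Kˣ := Additive.toMul (α - (p : ℤ) • (Additive.ofMul (b0 1) - Additive.ofMul (b0 0)))
  have hα0 : ∏ x : Fin (m+1) → ZMod p, uu (Fin.cons 1 x) = α0 ^ c := by
    apply Additive.ofMul.injective
    rw [ofMul_prod, ofMul_zpow]
    simp only [uu, α0, ofMul_div, ofMul_toMul]
    rw [Finset.sum_sub_distrib, hα, hb]; exact (zsmul_sub _ _ _).symm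
  have hα0K : ((∏ x : Fin (m+1) → ZMod p, u (Fin.cons 1 x) :
        cubLoc (cub_lam_prime hζ hp)) : K) = ((α0 ^ c : Kˣ) : K) := by
    rw [← hα0, Units.coe_prod]
    simp_rw [huu]
    exact map_prod (cubLoc (cub_lam_prime hζ hp)).subtype _ _
  obtain ⟨k, d, b, hd, hdb⟩ := cub_prim hζ hp hp2 m u hu (by
      intro x
      apply Subtype.ext
      have h1 := huu (Fin.cons 0 x)
      rw [← h1]
      simp only [uu]
      rw [h0 _ 0 (by simp), cubG_zero _ _ _ 0 (by simp)]
      simp) (α0 : K) (by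
      rw [hα0K]
      rcases neg_one_pow_eq_or ℤ (m+1) with h1 | h1
      · right
        rw [hcdef, h1, one_mul, ← Nat.cast_pow, zpow_natCast, Units.val_pow_eq_pow_val]
      · left
        rw [hcdef, h1, neg_one_mul, ← Nat.cast_pow, zpow_neg, zpow_natCast,
          ← Units.val_pow_eq_pow_val, ← Units.val_mul, mul_inv_cancel, Units.val_one])
  have hsα : cubSp (Additive.toMul α) = (J 1 / J 0) ^ p := by
    apply cub_tfz _ _ c hc0
    apply Additive.ofMul.injective
    have h1 : Additive.ofMul (cubSp (Additive.toMul α) ^ c) = 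
        (MonoidHom.toAdditive cubSp) (c • α) := by
      rw [map_zsmul]; rfl
    rw [h1, ← hα, map_sum]
    have h2 : ∀ x : Fin (m+1) → ZMod p, (MonoidHom.toAdditive cubSp)
      (Additive.ofMul (a (Fin.cons 1 x))) = cubG (m+2) (fun y => Additive.ofMul (J y)) (Fin.cons 1 x) :=
        fun x => hJ _
    simp_rw [h2]
    rw [hJs, ofMul_zpow, ofMul_pow, ofMul_div, natCast_zsmul]
  have hsα0 : cubSp α0 = (J 1 / J 0 * cubSp (b0 1 / b0 0)⁻¹) ^ p := by
    have : α0 = Additive.toMul α * ((b0 1 / b0 0)⁻¹) ^ p := by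
      simp only [α0]
      rw [toMul_sub, natCast_zsmul, toMul_nsmul, toMul_sub, inv_pow, div_eq_mul_inv]
      rfl
    rw [this, map_mul, map_pow, hsα, mul_pow]
  have hζ0 : ζ ≠ 0 := hζ.ne_zero hp.ne_zero
  let zu : Kˣ := Units.mk0 ζ hζ0
  have hzu : cubSp zu = 1 := by
    apply cub_tf _ p hp.ne_zero
    rw [← map_pow]
    have : zu ^ p = 1 := Units.ext hζ.pow_eq_one
    rw [this, map_one]
  obtain ⟨γ, hγ⟩ := cub_princ hζ hp2 cc _ (zu ^ k * α0)
    (by rw [map_mul, map_pow, hzu, one_pow, one_mul]; exact hsα0) d b hd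
    (by rw [Units.val_mul, Units.val_pow_eq_pow_val]; exact hdb)
  refine ⟨γ * (b0 1 / b0 0), ?_⟩
  rw [map_mul, ← hγ, map_inv, inv_mul_cancel_right, mul_div_cancel]
end
end

section
open CubicStructure

theorem cub_castE {R : Type} [Ring R] (A : ModuleCat.{0} R) (X : Type) [AddCommGroup X]
    [Module R X] (h : A = ModuleCat.of R X) (h' : (A : Type) = X) :
    ∃ e : A ≃ₗ[R] X, (∀ x, e x = cast h' x) ∧ ∀ x, e.symm x = cast h'.symm x := by
  subst h
  exact ⟨LinearEquiv.refl _ _, fun _ => rfl, fun _ => rfl⟩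

section
variable (G : Type) [CommGroup G] [Fintype G] (n : ℕ)
variable (M : Type) [AddCommGroup M] [Module (R G) M]

theorem cub_iota_delta (I : Finset (Fin n)) (r : R G) :
    iotaS G n (deltaHom G n I r) = deltaHomQ G n I (iotaR G r) := by
  have h : (iotaS G n).comp (deltaHom G n I) = (deltaHomQ G n I).comp (iotaR G) := by
    apply MonoidAlgebra.ringHom_ext
    · intro r
      simp [iotaS, deltaHom, deltaHomQ, iotaR]
    · intro g
      simp [iotaS, deltaHom, deltaHomQ, iotaR]
  exact congrArg (fun f => f r) h

theorem cub_iotaR_coeff (x : R G) (g : G) : (iotaR G x).coeff g = (x.coeff g : ℚ) := by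
  induction x using MonoidAlgebra.induction_linear with
  | zero => simp
  | add x y hx hy =>
    rw [map_add, MonoidAlgebra.coeff_add, Finsupp.add_apply, hx, hy, MonoidAlgebra.coeff_add,
      Finsupp.add_apply]
    push_cast; rfl
  | single k z =>
    by_cases hk : k = g
    · subst hk; simp [iotaR]
    · simp [iotaR, Finsupp.single_eq_of_ne (Ne.symm hk)]

theorem cub_iotaR_inj : Function.Injective (iotaR G) := by
  intro x y hxy
  ext g
  have h1 := cub_iotaR_coeff G x g
  rw [hxy, cub_iotaR_coeff] at h1
  exact_mod_cast h1.symm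

/-- The evaluation map of `Δ_I(M)_ℚ` with respect to the generator. -/
theorem cub_F (t : MQ G M) (e0 : RQ G ≃ₗ[RQ G] MQ G M) (he : ∀ r, e0 r = r • t)
    (I : Finset (Fin n)) :
    ∃ F : DMQ G n M I →ₗ[SQ G n] SQ G n,
      (∀ s x, F (TensorProduct.tmul (RQ G) (mkSQv G n I s) x) = s * deltaHomQ G n I (e0.symm x)) ∧
      ∀ y, y = F y • deltaT G n M I t := by
  let B : SQv G n I →ₗ[RQ G] MQ G M →ₗ[RQ G] SQv G n I :=
    LinearMap.mk₂ (RQ G) (fun s x => (e0.symm x) • s)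
      (fun a b x => smul_add _ _ _)
      (fun r s x => by rw [smul_smul, mul_comm, mul_smul])
      (fun s x y => by rw [map_add, add_smul])
      (fun r s x => by rw [map_smul, smul_eq_mul, mul_smul])
  let F0 := TensorProduct.lift B
  have hF0 : ∀ (s : SQv G n I) (x : MQ G M), F0 (s ⊗ₜ[RQ G] x) = (e0.symm x) • s := fun s x => rfl
  let F : DMQ G n M I →ₗ[SQ G n] SQ G n :=
    { toFun := fun y => F0 y
      map_add' := fun x y => map_add F0 x y
      map_smul' := by
        intro r y
        change F0 (r • y) = r • F0 y
        induction y using TensorProduct.induction_on with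
        | zero => rw [smul_zero, map_zero, smul_zero]
        | tmul s x =>
          rw [TensorProduct.smul_tmul', hF0, hF0, smul_comm]
        | add x y hx hy => rw [smul_add, map_add, hx, hy, map_add, smul_add] }
  have hF : ∀ s x, F (TensorProduct.tmul (RQ G) (mkSQv G n I s) x)
      = s * deltaHomQ G n I (e0.symm x) := by
    intro s x
    exact mul_comm (deltaHomQ G n I (e0.symm x)) s
  refine ⟨F, hF, ?_⟩
  intro y
  induction y using TensorProduct.induction_on with
  | zero => rw [map_zero, zero_smul]
  | add x y hx hy => rw [map_add, add_smul, ← hx, ← hy]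
  | tmul s x =>
    have h1 : F (s ⊗ₜ[RQ G] x) = (show SQ G n from s) * deltaHomQ G n I (e0.symm x) := hF s x
    rw [h1, deltaT, TensorProduct.smul_tmul']
    have h2 : x = (e0.symm x) • t := by rw [← he, LinearEquiv.apply_symm_apply]
    conv_lhs => rw [h2]
    rw [← TensorProduct.smul_tmul]
    congr 1
    change deltaHomQ G n I (e0.symm x) * (show SQ G n from s) = ((show SQ G n from s) * deltaHomQ G n I (e0.symm x)) * (1 : SQ G n)
    rw [mul_one, mul_comm]

theorem cub_E (t : MQ G M) (e0 : RQ G ≃ₗ[RQ G] MQ G M) (he : ∀ r, e0 r = r • t)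
    (I : Finset (Fin n)) :
    ∃ E : (famQ G n M I : Type) →ₗ[SQ G n] SQ G n,
      (∀ (h : Even (n - I.card)) s x, 
        E (toFamQEven G n M I h (TensorProduct.tmul (RQ G) (mkSQv G n I s) x)) =
          s * deltaHomQ G n I (e0.symm x)) ∧
      (∀ (h : ¬ Even (n - I.card)) x, E x = famQToDual G n M I h x (deltaT G n M I t)) ∧
      (∀ (h : ¬ Even (n - I.card)) v x, famQToDual G n M I h v 
        (TensorProduct.tmul (RQ G) (mkSQv G n I 1) x) = deltaHomQ G n I (e0.symm x) * E v) := by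
  obtain ⟨F, hF, hF2⟩ := cub_F G n M t e0 he I
  by_cases h : Even (n - I.card)
  · obtain ⟨e, h1, h2⟩ := cub_castE (famQ G n M I) (DMQ G n M I) (by unfold famQ; rw [if_pos h])
      (famQ_even G n M I h)
    refine ⟨F.comp e.toLinearMap, ?_, fun h' => absurd h h', fun h' => absurd h h'⟩
    intro _ s x
    have h3 := h2 (TensorProduct.tmul (RQ G) (mkSQv G n I s) x)
    rw [← hF s x]
    rw [toFamQEven, ← h3]
    simp
  · obtain ⟨e, h1, h2⟩ := cub_castE (famQ G n M I) (Module.Dual (SQ G n) (DMQ G n M I)) 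
      (by unfold famQ; rw [if_neg h]) (famQ_odd G n M I h)
    refine ⟨(LinearMap.applyₗ (deltaT G n M I t)).comp e.toLinearMap, fun h' => absurd h' h, ?_, ?_⟩
    · intro _ x
      rw [famQToDual, ← h1]
      rfl
    · intro _ v x
      rw [famQToDual, ← h1]
      rw [hF2 (TensorProduct.tmul (RQ G) (mkSQv G n I 1) x), map_smul, hF, one_mul]
      rfl
end
end

section
open CubicStructure
section
variable (G : Type) [CommGroup G] [Fintype G] (n : ℕ)
variable (M : Type) [AddCommGroup M] [Module (R G) M]

/-- base change of a functional -/
theorem cub_fI (f : Module.Dual (R G) M) (I : Finset (Fin n)) :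
    ∃ F : DM G n M I →ₗ[S G n] S G n,
      ∀ s m, F (TensorProduct.tmul (R G) (mkSv G n I s) m) = s * deltaHom G n I (f m) := by
  let B : Sv G n I →ₗ[R G] M →ₗ[R G] Sv G n I :=
    LinearMap.mk₂ (R G) (fun s x => (f x) • s)
      (fun a b x => smul_add _ _ _)
      (fun r s x => by rw [smul_smul, mul_comm, mul_smul])
      (fun s x y => by rw [map_add, add_smul])
      (fun r s x => by rw [map_smul, smul_eq_mul, mul_smul])
  let F0 := TensorProduct.lift B
  have hF0 : ∀ (s : Sv G n I) (x : M), F0 (s ⊗ₜ[R G] x) = (f x) • s := fun s x => rfl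
  let F : DM G n M I →ₗ[S G n] S G n :=
    { toFun := fun y => F0 y
      map_add' := fun x y => map_add F0 x y
      map_smul' := by
        intro r y
        change F0 (r • y) = r • F0 y
        induction y using TensorProduct.induction_on with
        | zero => rw [smul_zero, map_zero, smul_zero]
        | tmul s x =>
          rw [TensorProduct.smul_tmul', hF0, hF0, smul_comm]
        | add x y hx hy => rw [smul_add, map_add, hx, hy, map_add, smul_add] }
  refine ⟨F, ?_⟩
  intro s x
  exact mul_comm (deltaHom G n I (f x)) s

theorem cub_fQ (f : Module.Dual (R G) M) :
    ∃ F : MQ G M →ₗ[RQ G] RQ G,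
      ∀ m, F (TensorProduct.tmul (R G) (mkRQv G 1) m) = iotaR G (f m) := by
  let B : RQv G →ₗ[R G] M →ₗ[R G] RQv G :=
    LinearMap.mk₂ (R G) (fun s x => (f x) • s)
      (fun a b x => smul_add _ _ _)
      (fun r s x => by rw [smul_smul, mul_comm, mul_smul])
      (fun s x y => by rw [map_add, add_smul])
      (fun r s x => by rw [map_smul, smul_eq_mul, mul_smul])
  let F0 := TensorProduct.lift B
  have hF0 : ∀ (s : RQv G) (x : M), F0 (s ⊗ₜ[R G] x) = (f x) • s := fun s x => rfl
  let F : MQ G M →ₗ[RQ G] RQ G :=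
    { toFun := fun y => F0 y
      map_add' := fun x y => map_add F0 x y
      map_smul' := by
        intro r y
        change F0 (r • y) = r • F0 y
        induction y using TensorProduct.induction_on with
        | zero => rw [smul_zero, map_zero, smul_zero]
        | tmul s x =>
          rw [TensorProduct.smul_tmul', hF0, hF0, smul_comm]
        | add x y hx hy => rw [smul_add, map_add, hx, hy, map_add, smul_add] }
  refine ⟨F, ?_⟩
  intro x
  exact mul_one (iotaR G (f x))

theorem cub_toFamEven_surj (I : Finset (Fin n)) (h : Even (n - I.card)) (v : fam G n M I) :
    ∃ x, v = toFamEven G n M I h x :=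
  ⟨cast (fam_even G n M I h) v, by simp [toFamEven]⟩

theorem cub_toFamOdd_surj (I : Finset (Fin n)) (h : ¬ Even (n - I.card)) (v : fam G n M I) :
    ∃ x, v = toFamOdd G n M I h x :=
  ⟨cast (fam_odd G n M I h) v, by simp [toFamOdd]⟩

theorem cub_toFamEven_add (I : Finset (Fin n)) (h : Even (n - I.card)) (x y : DM G n M I) :
    toFamEven G n M I h (x + y) = toFamEven G n M I h x + toFamEven G n M I h y ∧ 
    toFamEven G n M I h 0 = 0 := by
  obtain ⟨e, h1, h2⟩ := cub_castE (fam G n M I) (DM G n M I) (by unfold fam; rw [if_pos h])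
      (fam_even G n M I h)
  simp only [toFamEven]
  rw [← h2, ← h2, ← h2, ← h2, map_add, map_zero]
  exact ⟨rfl, rfl⟩

variable {n}
theorem cub_front (hn : 2 ≤ n) {k : Type} [Fintype k] (fk : k → Module.Dual (R G) M) (mk : k → M)
    (hk : ∑ i, fk i (mk i) = 1) (hc : HasCubicStructure G n M hn) :
    ∃ (a : (SQ G n)ˣ) (j : M →+ RQ G) (φ : Module.Dual (R G) M → RQ G),
    ((MonoidAlgebra.lift ℚ ℚ (Fin n → G) (1 : (Fin n → G) →* ℚ)) (↑a : SQ G n) = 1 ∧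
    (∀ σ : Equiv.Perm (Fin n),
      MonoidAlgebra.mapDomainRingHom ℚ (permHom G n σ) (↑a : SQ G n) = (↑a : SQ G n)) ∧
    (MonoidAlgebra.mapDomainRingHom ℚ (cubI0 G n hn) (↑a : SQ G n) *
        MonoidAlgebra.mapDomainRingHom ℚ (cubI2 G n hn) (↑a : SQ G n) =
      MonoidAlgebra.mapDomainRingHom ℚ (cubI1 G n hn) (↑a : SQ G n) *
        MonoidAlgebra.mapDomainRingHom ℚ (cubI3 G n hn) (↑a : SQ G n))) ∧
    (∀ r m, j (r • m) = iotaR G r * j m) ∧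
    (∀ f m, iotaR G (f m) = φ f * j m) ∧
    (∀ (mm : Finset (Fin n) → M) (ff : Finset (Fin n) → Module.Dual (R G) M), ∃ s : S G n,
      ∏ I, (if Even (n - I.card) then deltaHomQ G n I (j (mm I)) else deltaHomQ G n I (φ (ff I)))
        = iotaS G n s * a) ∧
    (∀ N : AddSubgroup (SQ G n), (∀ s, ∀ x ∈ N, iotaS G n s * x ∈ N) →
      (∀ r : Finset (Fin n) → SQ G n,
        (∀ I, Even (n - I.card) → r I ∈ AddSubgroup.closure 
          {x | ∃ s m, x = iotaS G n s * deltaHomQ G n I (j m)}) →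
        (∀ I, ¬ Even (n - I.card) → ∀ m, ∃ s, r I * deltaHomQ G n I (j m) = iotaS G n s) →
        ∏ I, r I ∈ N) → (a : SQ G n) ∈ N) := by
  obtain ⟨c, a, t, τ, ρ, κ, hrig, hsym, hcoc, hbij, hτe, hτo, hρe, hρo, hκ, hca⟩ := hc
  let e0 : RQ G ≃ₗ[RQ G] MQ G M := LinearEquiv.ofBijective _ hbij
  have he : ∀ r, e0 r = r • t := fun r => rfl
  clear_value e0
  choose E hE1 hE2 hE3 using cub_E G n M t e0 he
  choose fQ hfQ using cub_fQ G M
  let L : ThetaQ G n M →ₗ[SQ G n] SQ G n := PiTensorProduct.lift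
    ((MultilinearMap.mkPiAlgebra (SQ G n) (Finset (Fin n)) (SQ G n)).compLinearMap E)
  have hL : ∀ v, L (PiTensorProduct.tprod (SQ G n) v) = ∏ I, E I (v I) := by
    intro v
    simp [L, PiTensorProduct.lift.tprod]
  let j : M →+ RQ G := AddMonoidHom.mk' 
    (fun m => e0.symm (TensorProduct.tmul (R G) (mkRQv G 1) m)) (by
      intro x y; rw [TensorProduct.tmul_add, map_add])
  have hj : ∀ m, j m = e0.symm (TensorProduct.tmul (R G) (mkRQv G 1) m) := fun _ => rfl
  have hjt : ∀ m, TensorProduct.tmul (R G) (mkRQv G 1) m = j m • t := by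
    intro m; rw [← he, hj, LinearEquiv.apply_symm_apply]
  have hjr : ∀ r m, j (r • m) = iotaR G r * j m := by
    intro r m
    rw [hj, hj, ← smul_eq_mul (a := iotaR G r), ← map_smul]
    congr 1
    rw [← TensorProduct.smul_tmul, TensorProduct.smul_tmul']
    rfl
  have hφ : ∀ f m, iotaR G (f m) = fQ f t * j m := by
    intro f m
    rw [← hfQ, hjt, map_smul, smul_eq_mul, mul_comm]
  clear_value j
  have hτ1 : ∀ I, E I (τ I) = 1 := by
    intro I
    by_cases h : Even (n - I.card)
    · rw [hτe I h, deltaT, hE1]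
      have : e0.symm t = 1 := by rw [LinearEquiv.symm_apply_eq, he, one_smul]
      rw [this, map_one, one_mul]
    · rw [hE2 I h, hτo I h]
  have hL1 : L (κ (c 1)) = a := by
    rw [hca, map_smul, hL, Finset.prod_eq_one (fun I _ => hτ1 I), smul_eq_mul, mul_one]
  have hLs : ∀ (s : S G n) (x : Theta G n M), L (κ (s • x)) = iotaS G n s * L (κ x) := by
    intro s x
    rw [map_smul]
    change L (iotaS G n s • κ x) = _
    rw [map_smul, smul_eq_mul]
  have hodd : ∀ I (h : ¬ Even (n - I.card)) (f : Module.Dual (S G n) (DM G n M I)) m,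
      E I (ρ I (toFamOdd G n M I h f)) * deltaHomQ G n I (j m) = 
        iotaS G n (f (TensorProduct.tmul (R G) (mkSv G n I 1) m)) := by
    intro I h f m
    have h1 := hρo I h f 1 m
    rw [map_one, hE3 I h, ← hj] at h1
    rw [← h1, mul_comm]
  have heven : ∀ I (h : Even (n - I.card)) s m,
      E I (ρ I (toFamEven G n M I h (TensorProduct.tmul (R G) (mkSv G n I s) m))) =
        iotaS G n s * deltaHomQ G n I (j m) := by
    intro I h s m
    rw [hρe, hE1, ← hj]
  refine ⟨a, j, fun f => fQ f t, ⟨hrig, hsym, hcoc⟩, hjr, hφ, ?_, ?_⟩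
  · intro mm ff
    choose fI hfI using fun I => cub_fI G n M (ff I) I
    let v : ∀ I : Finset (Fin n), (fam G n M I : Type) := fun I => 
      if h : Even (n - I.card) then 
        toFamEven G n M I h (TensorProduct.tmul (R G) (mkSv G n I 1) (mm I))
      else toFamOdd G n M I h (fI I)
    refine ⟨c.symm (PiTensorProduct.tprod (S G n) v), ?_⟩
    have h1 := hLs (c.symm (PiTensorProduct.tprod (S G n) v)) (c 1)
    rw [← map_smul, smul_eq_mul, mul_one, LinearEquiv.apply_symm_apply, hL1, hκ, hL] at h1
    rw [← h1]
    apply Finset.prod_congr rfl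
    intro I _
    by_cases h : Even (n - I.card)
    · simp only [v, h, dif_pos, if_pos]
      rw [heven, map_one, one_mul]
    · simp only [v, h, dif_neg, if_neg, not_false_iff]
      have h2 : ∀ m, E I (ρ I (toFamOdd G n M I h (fI I))) * deltaHomQ G n I (j m) = 
          deltaHomQ G n I (fQ (ff I) t) * deltaHomQ G n I (j m) := by
        intro m
        rw [hodd, hfI, one_mul, cub_iota_delta, hφ, map_mul]
      have h3 : ∑ i, deltaHomQ G n I (fQ (fk i) t) * deltaHomQ G n I (j (mk i)) = 1 := by
        have : ∀ i, deltaHomQ G n I (fQ (fk i) t) * deltaHomQ G n I (j (mk i)) = 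
            deltaHomQ G n I (iotaR G (fk i (mk i))) := by
          intro i; rw [hφ, map_mul]
        rw [Finset.sum_congr rfl (fun i _ => this i), ← map_sum, ← map_sum, hk, map_one, map_one]
      have h4 : ∀ z : SQ G n, z = ∑ i, deltaHomQ G n I (fQ (fk i) t) * 
          (z * deltaHomQ G n I (j (mk i))) := by
        intro z
        conv_lhs => rw [← mul_one z, ← h3, Finset.mul_sum]
        apply Finset.sum_congr rfl
        intro i _
        ring
      rw [h4 (deltaHomQ G n I (fQ (ff I) t)), h4 (E I (ρ I (toFamOdd G n M I h (fI I))))]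
      apply Finset.sum_congr rfl
      intro i _
      rw [h2]
  · intro N hN hr
    rw [← hL1]
    generalize c 1 = x
    induction x using PiTensorProduct.induction_on with
    | add x y hx hy => rw [map_add, map_add]; exact N.add_mem hx hy
    | smul_tprod r v =>
      rw [hLs]
      apply hN
      rw [hκ, hL]
      apply hr
      · intro I h
        obtain ⟨x, hx⟩ := cub_toFamEven_surj G n M I h (v I)
        rw [hx]
        clear hx
        induction x using TensorProduct.induction_on with
        | zero => rw [(cub_toFamEven_add G n M I h 0 0).2, map_zero, map_zero]; exact zero_mem _
        | add x y hx hy =>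
          rw [(cub_toFamEven_add G n M I h x y).1, map_add, map_add]; exact add_mem hx hy
        | tmul s m =>
          exact AddSubgroup.subset_closure ⟨s, m, heven I h s m⟩
      · intro I h m
        obtain ⟨x, hx⟩ := cub_toFamOdd_surj G n M I h (v I)
        rw [hx, hodd]
        exact ⟨_, rfl⟩
end
end

section
open NumberField CubicStructure
section
variable {K : Type} [Field K] [NumberField K] {H : Type} [CommGroup H]

def cubPsi (θ : H →* K) : MonoidAlgebra ℚ H →+* K := (MonoidAlgebra.lift ℚ K H θ).toRingHom

lemma cubPsi_single (θ : H →* K) (h : H) (c : ℚ) :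
    cubPsi θ (MonoidAlgebra.single h c) = c * θ h := by
  change MonoidAlgebra.lift ℚ K H θ _ = _
  rw [MonoidAlgebra.lift_single, Algebra.smul_def]; rfl

lemma cubPsi_map {H' : Type} [CommGroup H'] (θ : H' →* K) (f : H →* H') (z : MonoidAlgebra ℚ H) :
    cubPsi θ (MonoidAlgebra.mapDomainRingHom ℚ f z) = cubPsi (θ.comp f) z := by
  have : (cubPsi θ).comp (MonoidAlgebra.mapDomainRingHom ℚ f) = cubPsi (θ.comp f) := by
    apply MonoidAlgebra.ringHom_ext <;> intro r <;>
      simp [cubPsi_single, MonoidAlgebra.mapDomainRingHom_apply, MonoidAlgebra.mapDomain_single]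
  exact congrArg (fun f => f z) this

def cubIot (H : Type) [CommGroup H] : MonoidAlgebra ℤ H →+* MonoidAlgebra ℚ H :=
  (MonoidAlgebra.lift ℤ (MonoidAlgebra ℚ H) H (MonoidAlgebra.of ℚ H)).toRingHom

lemma cubPsi_iot (θ : H →* K) (z : MonoidAlgebra ℤ H) :
    cubPsi θ (cubIot H z) = MonoidAlgebra.lift ℤ K H θ z := by
  have : (cubPsi θ).comp (cubIot H) = (MonoidAlgebra.lift ℤ K H θ).toRingHom := by
    apply MonoidAlgebra.ringHom_ext
    · intro r
      have e1 : (MonoidAlgebra.single (1 : H) r : MonoidAlgebra ℤ H) = (r : MonoidAlgebra ℤ H) := by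
        rw [MonoidAlgebra.intCast_def]; rfl
      rw [e1, map_intCast, map_intCast]
    · intro m
      change cubPsi θ (MonoidAlgebra.lift ℤ _ H (MonoidAlgebra.of ℚ H) _) =
        MonoidAlgebra.lift ℤ K H θ _
      rw [MonoidAlgebra.lift_single, MonoidAlgebra.lift_single, one_smul, one_smul]
      change cubPsi θ (MonoidAlgebra.single m 1) = _
      rw [cubPsi_single]; simp
  exact congrArg (fun f => f z) this

lemma cubPsi_mem (T : Subring K) (θ : H →* K) (hθ : ∀ h, θ h ∈ T) (z : MonoidAlgebra ℤ H) :
    cubPsi θ (cubIot H z) ∈ T := by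
  rw [cubPsi_iot]
  induction z using MonoidAlgebra.induction_linear with
  | zero => rw [map_zero]; exact T.zero_mem
  | add x y hx hy => rw [map_add]; exact T.add_mem hx hy
  | single h c => rw [MonoidAlgebra.lift_single]; exact T.zsmul_mem (hθ h) c
end
section
variable {K : Type} [Field K] [NumberField K] {p : ℕ} [hpF : Fact p.Prime]
  [IsCyclotomicExtension {p} ℚ K] {ζ : K} (hζ : IsPrimitiveRoot ζ p)
  {G : Type} [CommGroup G] [Fintype G] (e : G →* Multiplicative (ZMod p))

def cubX : AddChar (ZMod p) K := AddChar.zmodChar p hζ.pow_eq_one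

lemma cubX_val (z : ZMod p) : cubX hζ z = ζ ^ z.val := AddChar.zmodChar_apply _ _

lemma cubX_int (z : ZMod p) : cubX hζ z ∈ (algebraMap (𝓞 K) K).range := by
  rw [cubX_val]
  exact ⟨hζ.toInteger ^ z.val, by rw [map_pow]; rfl⟩

def cubth (y : ZMod p) : G →* K where
  toFun g := cubX hζ (y * (e g).toAdd)
  map_one' := by simp
  map_mul' g h := by rw [map_mul e, toAdd_mul, mul_add, AddChar.map_add_eq_mul]

def cubTh {n : ℕ} (x : Fin n → ZMod p) : (Fin n → G) →* K where
  toFun h := ∏ i, cubth hζ e (x i) (h i)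
  map_one' := by simp
  map_mul' g h := by simp [Finset.prod_mul_distrib]

lemma cubTh_apply {n : ℕ} (x : Fin n → ZMod p) (h : Fin n → G) :
    cubTh hζ e x h = ∏ i, cubth hζ e (x i) (h i) := rfl

lemma cubth_add (y z : ZMod p) (g : G) :
    cubth hζ e (y + z) g = cubth hζ e y g * cubth hζ e z g := by
  change cubX hζ _ = cubX hζ _ * cubX hζ _
  rw [add_mul, AddChar.map_add_eq_mul]

lemma cubth_zero (g : G) : cubth hζ e 0 g = 1 := by
  change cubX hζ _ = 1
  rw [zero_mul, AddChar.map_zero_eq_one]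

lemma cubth_sum {ι : Type*} (I : Finset ι) (x : ι → ZMod p) (g : G) :
    cubth hζ e (∑ i ∈ I, x i) g = ∏ i ∈ I, cubth hζ e (x i) g := by
  classical
  induction I using Finset.induction_on with
  | empty => simp [cubth_zero]
  | insert j T hj ih => rw [Finset.sum_insert hj, Finset.prod_insert hj, cubth_add, ih]

lemma cubTh_delta {n : ℕ} (x : Fin n → ZMod p) (I : Finset (Fin n)) (z : RQ G) :
    cubPsi (cubTh hζ e x) (deltaHomQ G n I z) = cubPsi (cubth hζ e (∑ i ∈ I, x i)) z := by
  rw [deltaHomQ, cubPsi_map]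
  congr 2
  ext g
  rw [MonoidHom.comp_apply, cubTh_apply, cubth_sum, ← Finset.prod_subset (Finset.subset_univ I)]
  · apply Finset.prod_congr rfl
    intro i hi
    simp [delta, hi]
  · intro i _ hi
    simp [delta, hi]

lemma cubTh_perm {n : ℕ} (x : Fin n → ZMod p) (σ : Equiv.Perm (Fin n)) (z : SQ G n) :
    cubPsi (cubTh hζ e (fun i => x (σ i))) (MonoidAlgebra.mapDomainRingHom ℚ (permHom G n σ) z) =
      cubPsi (cubTh hζ e x) z := by
  rw [cubPsi_map]
  congr 2
  apply MonoidHom.ext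
  intro h
  rw [MonoidHom.comp_apply, cubTh_apply, cubTh_apply]
  exact Equiv.prod_comp σ (fun i => cubth hζ e (x i) (h i))

lemma cubTh_int {n : ℕ} (x : Fin n → ZMod p) (s : S G n) :
    cubPsi (cubTh hζ e x) (iotaS G n s) ∈ (algebraMap (𝓞 K) K).range :=
  cubPsi_mem _ _ (fun h => by
    rw [cubTh_apply]
    exact Subring.prod_mem _ fun i _ => cubX_int hζ _) s

lemma cubth_int (y : ZMod p) (s : R G) :
    cubPsi (cubth hζ e y) (iotaR G s) ∈ (algebraMap (𝓞 K) K).range :=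
  cubPsi_mem _ _ (fun h => cubX_int hζ _) s

lemma cubTh_coc {m : ℕ} (hn : 2 ≤ m + 2) (y0 y1 y2 : ZMod p) (z : Fin m → ZMod p) (w : SQ G (m+2)) :
    let X : Fin (m+2+1) → ZMod p :=
      Fin.cons y0 (Fin.cons y1 (Fin.cons y2 z : Fin (m+1) → ZMod p) : Fin (m+2) → ZMod p)
    cubPsi (cubTh hζ e X) (MonoidAlgebra.mapDomainRingHom ℚ (cubI0 G (m+2) hn) w) =
      cubPsi (cubTh hζ e (Fin.cons (y0+y1) (Fin.cons y2 z : Fin (m+1) → ZMod p))) w ∧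
    cubPsi (cubTh hζ e X) (MonoidAlgebra.mapDomainRingHom ℚ (cubI2 G (m+2) hn) w) =
      cubPsi (cubTh hζ e (Fin.cons y0 (Fin.cons y1 z : Fin (m+1) → ZMod p))) w ∧
    cubPsi (cubTh hζ e X) (MonoidAlgebra.mapDomainRingHom ℚ (cubI1 G (m+2) hn) w) =
      cubPsi (cubTh hζ e (Fin.cons y1 (Fin.cons y2 z : Fin (m+1) → ZMod p))) w ∧
    cubPsi (cubTh hζ e X) (MonoidAlgebra.mapDomainRingHom ℚ (cubI3 G (m+2) hn) w) =
      cubPsi (cubTh hζ e (Fin.cons y0 (Fin.cons (y1 + y2) z : Fin (m+1) → ZMod p))) w := by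
  intro X
  simp only [cubPsi_map]
  refine ⟨?_, ?_, ?_, ?_⟩ <;> congr 1 <;> apply congrArg <;> apply MonoidHom.ext <;> intro h <;>
    rw [MonoidHom.comp_apply, cubTh_apply, cubTh_apply] <;>
    simp only [Fin.prod_univ_succ, X, Fin.cons_zero, Fin.cons_succ, cubth_add]
  · rw [← mul_assoc]; rfl
  · have e0 : cubI2 G (m+2) hn h 0 = h 0 := rfl
    have e1 : cubI2 G (m+2) hn h (Fin.succ 0) = h (Fin.succ 0) := rfl
    have e2 : cubI2 G (m+2) hn h (Fin.succ (Fin.succ 0)) = 1 := rfl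
    have e3 : ∀ i : Fin m, cubI2 G (m+2) hn h i.succ.succ.succ = h i.succ.succ := fun i => rfl
    rw [e0, e1, e2]; simp [e3, mul_assoc]
  · have e0 : cubI1 G (m+2) hn h 0 = 1 := rfl
    have e1 : cubI1 G (m+2) hn h (Fin.succ 0) = h 0 := rfl
    have e2 : cubI1 G (m+2) hn h (Fin.succ (Fin.succ 0)) = h (Fin.succ 0) := rfl
    have e3 : ∀ i : Fin m, cubI1 G (m+2) hn h i.succ.succ.succ = h i.succ.succ := fun i => rfl
    rw [e0, e1, e2]; simp [e3, mul_assoc]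
  · have e0 : cubI3 G (m+2) hn h 0 = h 0 := rfl
    have e1 : cubI3 G (m+2) hn h (Fin.succ 0) = h (Fin.succ 0) := rfl
    have e2 : cubI3 G (m+2) hn h (Fin.succ (Fin.succ 0)) = h (Fin.succ 0) := rfl
    have e3 : ∀ i : Fin m, cubI3 G (m+2) hn h i.succ.succ.succ = h i.succ.succ := fun i => rfl
    rw [e0, e1, e2]; simp [e3, mul_assoc]
end
end

section
open NumberField CubicStructure
section
lemma cub_norm {p : ℕ} [Fact p.Prime] {V : Type*} [CommGroup V] {m : ℕ}
    (a : (Fin (m+2) → ZMod p) → V)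
    (hs : ∀ (σ : Equiv.Perm (Fin (m+2))) x, a (fun i => x (σ i)) = a x)
    (hc : ∀ y0 y1 y2 (z : Fin m → ZMod p),
      a (Fin.cons (y0 + y1) (Fin.cons y2 z : Fin (m+1) → ZMod p)) *
        a (Fin.cons y0 (Fin.cons y1 z : Fin (m+1) → ZMod p)) =
      a (Fin.cons y1 (Fin.cons y2 z : Fin (m+1) → ZMod p)) *
        a (Fin.cons y0 (Fin.cons (y1 + y2) z : Fin (m+1) → ZMod p)))
    (h0 : a 0 = 1) (x : Fin (m+2) → ZMod p) (i : Fin (m+2)) (hi : x i = 0) : a x = 1 := by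
  have e1 : (1 : Fin (m+2)) = (0 : Fin (m+1)).succ := rfl
  have hx : ∀ x : Fin (m+2) → ZMod p,
      x = Fin.cons (x 0) (Fin.cons (x 1) (fun i => x i.succ.succ) : Fin (m+1) → ZMod p) := by
    intro x
    funext i
    induction i using Fin.cases with
    | zero => simp
    | succ i =>
      induction i using Fin.cases with
      | zero => rfl
      | succ i => simp
  have hQ : ∀ x : Fin (m+2) → ZMod p, x 0 = 0 → a x = a (Function.update x 1 0) := by
    intro x h
    have h1 := hc 0 0 (x 1) (fun i => x i.succ.succ)
    rw [add_zero, zero_add] at h1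
    have h2 := mul_left_cancel h1
    have h3 : Function.update x 1 0 =
        Fin.cons 0 (Fin.cons 0 (fun i => x i.succ.succ) : Fin (m+1) → ZMod p) := by
      conv_lhs => rw [hx x, h, e1]
      rw [← Fin.cons_update, Fin.update_cons_zero]
    rw [h3, h2]
    conv_lhs => rw [hx x, h]
  have hQ2 : ∀ (x : Fin (m+2) → ZMod p) (i k : Fin (m+2)), i ≠ k → x i = 0 →
      a x = a (Function.update x k 0) := by
    intro x i k hik h
    let τ : Equiv.Perm (Fin (m+2)) := Equiv.swap 0 i
    have hk' : τ k ≠ 0 := by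
      intro h1
      have : τ i = 0 := Equiv.swap_apply_right _ _
      exact hik (τ.injective (this.trans h1.symm))
    let σ : Equiv.Perm (Fin (m+2)) := (Equiv.swap 1 (τ k)).trans τ
    have h0' : σ 0 = i := by
      change τ (Equiv.swap 1 (τ k) 0) = i
      rw [Equiv.swap_apply_of_ne_of_ne (by rw [e1]; exact (Fin.succ_ne_zero _).symm) hk'.symm]
      exact Equiv.swap_apply_left _ _
    have h1' : σ 1 = k := by
      change τ (Equiv.swap 1 (τ k) 1) = k
      rw [Equiv.swap_apply_left]
      exact congrArg (fun f : Equiv.Perm (Fin (m+2)) => f k) (Equiv.swap_swap 0 i)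
    rw [← hs σ x, hQ _ (by rw [h0', h]), ← hs σ (Function.update x k 0)]
    congr 1
    funext l
    by_cases hl : l = 1
    · subst hl; rw [h1']; simp
    · have : σ l ≠ k := by rw [← h1']; exact fun h => hl (σ.injective h)
      simp [hl, this]
  have hT : ∀ T : Finset (Fin (m+2)), a x = a (T.piecewise 0 x) := by
    intro T
    induction T using Finset.induction_on with
    | empty => simp
    | insert j T hj ih =>
      rw [Finset.piecewise_insert, ih]
      by_cases hij : i = j
      · subst hij
        congr 1
        symm
        rw [Function.update_eq_self_iff, Finset.piecewise_eq_of_notMem _ _ _ hj, hi]; rfl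
      · exact hQ2 _ i j hij (by by_cases h : i ∈ T <;> simp [h, hi])
  rw [hT Finset.univ, ← h0]
  congr 1
  funext i; simp
end
section
variable {K : Type} [Field K] [NumberField K] {p : ℕ} [hpF : Fact p.Prime]
  [IsCyclotomicExtension {p} ℚ K] {ζ : K} (hζ : IsPrimitiveRoot ζ p)
  {G : Type} [CommGroup G] [Fintype G] (e : G →* Multiplicative (ZMod p))

lemma cubTh_zero {n : ℕ} (z : SQ G n) : cubPsi (cubTh hζ e 0) z =
    algebraMap ℚ K (MonoidAlgebra.lift ℚ ℚ (Fin n → G) (1 : (Fin n → G) →* ℚ) z) := by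
  have : cubPsi (cubTh hζ e (0 : Fin n → ZMod p)) = (algebraMap ℚ K).comp
      (MonoidAlgebra.lift ℚ ℚ (Fin n → G) (1 : (Fin n → G) →* ℚ)).toRingHom := by
    apply MonoidAlgebra.ringHom_ext <;> intro r <;>
      simp [cubPsi_single, cubTh_apply, cubth_zero]
  exact congrArg (fun f => f z) this

/-- values of the cubic element -/
def cubAv {n : ℕ} (a : (SQ G n)ˣ) (x : Fin n → ZMod p) : Kˣ :=
  Units.map (cubPsi (cubTh hζ e x)).toMonoidHom a

lemma cubAv_val {n : ℕ} (a : (SQ G n)ˣ) (x : Fin n → ZMod p) :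
    ((cubAv hζ e a x : Kˣ) : K) = cubPsi (cubTh hζ e x) a := rfl

lemma cubAv_props {m : ℕ} (hn : 2 ≤ m + 2) (a : (SQ G (m+2))ˣ)
    (h1 : (MonoidAlgebra.lift ℚ ℚ (Fin (m+2) → G) (1 : (Fin (m+2) → G) →* ℚ)) (a : SQ G (m+2)) = 1)
    (h2 : ∀ σ : Equiv.Perm (Fin (m+2)),
      MonoidAlgebra.mapDomainRingHom ℚ (permHom G (m+2) σ) (a : SQ G (m+2)) = a)
    (h3 : MonoidAlgebra.mapDomainRingHom ℚ (cubI0 G (m+2) hn) (a : SQ G (m+2)) *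
        MonoidAlgebra.mapDomainRingHom ℚ (cubI2 G (m+2) hn) (a : SQ G (m+2)) =
      MonoidAlgebra.mapDomainRingHom ℚ (cubI1 G (m+2) hn) (a : SQ G (m+2)) *
        MonoidAlgebra.mapDomainRingHom ℚ (cubI3 G (m+2) hn) (a : SQ G (m+2))) :
    (∀ (σ : Equiv.Perm (Fin (m+2))) x, cubAv hζ e a (fun i => x (σ i)) = cubAv hζ e a x) ∧
    (∀ y0 y1 y2 (z : Fin m → ZMod p),
      cubAv hζ e a (Fin.cons (y0 + y1) (Fin.cons y2 z : Fin (m+1) → ZMod p)) *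
        cubAv hζ e a (Fin.cons y0 (Fin.cons y1 z : Fin (m+1) → ZMod p)) =
      cubAv hζ e a (Fin.cons y1 (Fin.cons y2 z : Fin (m+1) → ZMod p)) *
        cubAv hζ e a (Fin.cons y0 (Fin.cons (y1 + y2) z : Fin (m+1) → ZMod p))) ∧
    (∀ x i, x i = 0 → cubAv hζ e a x = 1) := by
  have A : ∀ (σ : Equiv.Perm (Fin (m+2))) x,
      cubAv hζ e a (fun i => x (σ i)) = cubAv hζ e a x := by
    intro σ x
    apply Units.ext
    rw [cubAv_val, cubAv_val, ← cubTh_perm hζ e x σ, h2]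
  have B : ∀ y0 y1 y2 (z : Fin m → ZMod p),
      cubAv hζ e a (Fin.cons (y0 + y1) (Fin.cons y2 z : Fin (m+1) → ZMod p)) *
        cubAv hζ e a (Fin.cons y0 (Fin.cons y1 z : Fin (m+1) → ZMod p)) =
      cubAv hζ e a (Fin.cons y1 (Fin.cons y2 z : Fin (m+1) → ZMod p)) *
        cubAv hζ e a (Fin.cons y0 (Fin.cons (y1 + y2) z : Fin (m+1) → ZMod p)) := by
    intro y0 y1 y2 z
    obtain ⟨c0, c2, c1, c3⟩ := cubTh_coc hζ e hn y0 y1 y2 z (a : SQ G (m+2))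
    apply Units.ext
    rw [Units.val_mul, Units.val_mul, cubAv_val, cubAv_val, cubAv_val, cubAv_val,
      ← c0, ← c1, ← c2, ← c3, ← map_mul, ← map_mul, h3]
  refine ⟨A, B, fun x i hi => cub_norm _ A B ?_ x i hi⟩
  apply Units.ext
  rw [cubAv_val, cubTh_zero, h1, map_one, Units.val_one]
end
end

section
open NumberField CubicStructure
section
variable {p : ℕ} [hpF : Fact p.Prime] {G : Type} [CommGroup G] [Fintype G]

/-- augmentation -/
def cubAug (G : Type) [CommGroup G] : R G →+* ℤ := (MonoidAlgebra.lift ℤ ℤ G (1 : G →* ℤ)).toRingHom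

lemma cubAug_single (g : G) (c : ℤ) : cubAug G (MonoidAlgebra.single g c) = c := by
  change MonoidAlgebra.lift ℤ ℤ G (1 : G →* ℤ) _ = c
  rw [MonoidAlgebra.lift_single]; simp

lemma cub_frob (hG : Nat.card G = p) (r : R G) :
    ∃ s : R G, r ^ p = ((cubAug G r : ℤ) : R G) + (p : R G) * s := by
  have hp := hpF.out
  induction r using MonoidAlgebra.induction_linear with
  | zero => exact ⟨0, by simp [hp.ne_zero]⟩
  | add x y hx hy =>
    obtain ⟨s, hs⟩ := hx
    obtain ⟨t, ht⟩ := hy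
    obtain ⟨w, hw⟩ := exists_add_pow_prime_eq hp x y
    refine ⟨s + t + x * y * w, ?_⟩
    rw [hw, hs, ht, map_add, Int.cast_add]; ring
  | single g c =>
    have hg : g ^ p = 1 := by rw [← hG]; exact pow_card_eq_one'
    have h2 : (p : ℤ) ∣ c ^ p - c := by
      rw [← ZMod.intCast_eq_intCast_iff_dvd_sub]
      push_cast
      rw [ZMod.pow_card]
    obtain ⟨k, hk⟩ := h2
    refine ⟨(k : R G), ?_⟩
    rw [MonoidAlgebra.single_pow, hg, cubAug_single, show c ^ p = c + p * k by linarith]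
    have : (MonoidAlgebra.single (1 : G) (c + p * k) : R G) = ((c + p * k : ℤ) : R G) := by
      rw [MonoidAlgebra.intCast_def]; rfl
    rw [this]; push_cast; rfl

lemma cub_locinv (hG : Nat.card G = p) (r0 : R G) (h : ¬ (p : ℤ) ∣ cubAug G r0) :
    ∃ (d : ℤ) (r' : R G), ¬ (p : ℤ) ∣ d ∧ r' * r0 = (d : R G) := by
  have hp := hpF.out
  obtain ⟨s, hs⟩ := cub_frob hG r0
  have hcop : IsCoprime (p : ℤ) (cubAug G r0) :=
    ((Nat.prime_iff_prime_int.mp hp).coprime_iff_not_dvd).mpr h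
  obtain ⟨v, u, huv⟩ := hcop
  let N : Submodule ℤ (R G ⧸ Ideal.span {r0}) := ⊤
  have hle : N ≤ (Ideal.span {(p : ℤ)}) • N := by
    intro x _
    obtain ⟨y, rfl⟩ := Ideal.Quotient.mk_surjective x
    have e1 : Ideal.Quotient.mk (Ideal.span {r0}) y = (p : ℤ) •
        Ideal.Quotient.mk (Ideal.span {r0}) ((v - u * s) * y) := by
      rw [zsmul_eq_mul, ← map_intCast (Ideal.Quotient.mk (Ideal.span {r0})), ← map_mul,
        Ideal.Quotient.mk_eq_mk_iff_sub_mem, Ideal.mem_span_singleton]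
      refine ⟨r0 ^ (p - 1) * u * y, ?_⟩
      have h1 : r0 * r0 ^ (p-1) = r0 ^ p := by
        rw [← pow_succ', Nat.sub_add_cancel hp.one_lt.le]
      have h2 : ((v * p + u * cubAug G r0 : ℤ) : R G) = 1 := by rw [huv]; simp
      push_cast at h2 ⊢
      calc _ = y * 1 - p * ((v - u * s) * y) := by rw [mul_one]
        _ = (r0 ^ p) * u * y := by rw [← h2, hs]; ring
        _ = _ := by rw [← h1]; ring
    rw [e1]
    exact Submodule.smul_mem_smul (Ideal.mem_span_singleton_self _) trivial
  have hfin : Module.Finite ℤ (R G) := 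
    Module.Finite.of_basis (MonoidAlgebra.basis G ℤ)
  have hfin2 : Module.Finite ℤ (R G ⧸ Ideal.span {r0}) :=
    Module.Finite.of_surjective ((Ideal.Quotient.mk (Ideal.span {r0})).toAddMonoidHom.toIntLinearMap)
      Ideal.Quotient.mk_surjective
  obtain ⟨d, hd, hd2⟩ := Submodule.exists_sub_one_mem_and_smul_eq_zero_of_fg_of_le_smul
    (Ideal.span {(p : ℤ)}) N Module.Finite.fg_top hle
  rw [Ideal.mem_span_singleton] at hd
  have h3 := hd2 (Ideal.Quotient.mk _ 1) trivial
  rw [zsmul_eq_mul, ← map_intCast (Ideal.Quotient.mk (Ideal.span {r0})), ← map_mul, mul_one,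
    Ideal.Quotient.eq_zero_iff_mem, Ideal.mem_span_singleton] at h3
  obtain ⟨r', hr'⟩ := h3
  refine ⟨d, r', fun hh => ?_, by rw [hr', mul_comm]⟩
  have : (p : ℤ) ∣ 1 := by
    have := dvd_sub hh hd
    simpa using this
  exact (Nat.prime_iff_prime_int.mp hp).not_unit (isUnit_of_dvd_one this)

end
section
variable {p : ℕ} [hpF : Fact p.Prime] {G : Type} [CommGroup G] [Fintype G]
  {M : Type} [AddCommGroup M] [Module (R G) M]

lemma cub_inv (hinv : ∃ (N : Type) (_ : AddCommGroup N) (_ : Module (R G) N),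
      Nonempty ((TensorProduct (R G) M N) ≃ₗ[R G] R G)) :
    Module.Invertible (R G) M ∧ ∃ (k : Type) (_ : Fintype k) (fk : k → Module.Dual (R G) M) (mk : k → M),
      ∑ i, fk i (mk i) = 1 := by
  obtain ⟨N, _, _, ⟨l⟩⟩ := hinv
  have hI : Module.Invertible (R G) M := Module.Invertible.left l
  refine ⟨hI, ?_⟩
  let E := Module.Invertible.linearEquiv (R G) M
  obtain ⟨S, hS⟩ := TensorProduct.exists_finset (E.symm 1)
  refine ⟨S, inferInstance, fun i => i.1.1, fun i => i.1.2, ?_⟩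
  have h1 := congrArg E hS
  rw [LinearEquiv.apply_symm_apply, map_sum] at h1
  rw [h1, ← Finset.sum_coe_sort S]
  rfl

/-- local generator -/
lemma cub_locgen (hG : Nat.card G = p) {k : Type} [Fintype k] (fk : k → Module.Dual (R G) M) (mk : k → M)
    (hk : ∑ i, fk i (mk i) = 1) :
    ∃ (f0 : Module.Dual (R G) M) (m0 : M) (d : ℤ) (r' : R G), ¬ (p : ℤ) ∣ d ∧
      r' * f0 m0 = (d : R G) := by
  by_cases hh : ∀ i, (p : ℤ) ∣ cubAug G (fk i (mk i))
  · have : (p : ℤ) ∣ cubAug G (∑ i, fk i (mk i)) := by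
      rw [map_sum]; exact Finset.dvd_sum fun i _ => hh i
    rw [hk, map_one] at this
    exact absurd (isUnit_of_dvd_one this) (Nat.prime_iff_prime_int.mp hpF.out).not_unit
  · push Not at hh
    obtain ⟨i, hi⟩ := hh
    obtain ⟨d, r', h1, h2⟩ := cub_locinv hG _ hi
    exact ⟨fk i, mk i, d, r', h1, h2⟩
end
end

section
open NumberField CubicStructure
section
variable {V : Type} [CommGroup V] {p : ℕ} [hpF : Fact p.Prime]
lemma cubG_toMul (n : ℕ) (J : ZMod p → V) (x : Fin n → ZMod p) :
    Additive.toMul (cubG n (fun y => Additive.ofMul (J y)) x) =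
      ∏ I : Finset (Fin n), if Even (n - I.card) then J (∑ i ∈ I, x i) else (J (∑ i ∈ I, x i))⁻¹ := by
  rw [cubG, toMul_sum]
  apply Finset.prod_congr rfl
  intro I _
  split_ifs <;> rfl
end
section
variable {K : Type} [Field K] [NumberField K] {p : ℕ} [hpF : Fact p.Prime]
  [IsCyclotomicExtension {p} ℚ K] {ζ : K} (hζ : IsPrimitiveRoot ζ p)
  {G : Type} [CommGroup G] [Fintype G] (e : G →* Multiplicative (ZMod p))
  {M : Type} [AddCommGroup M] [Module (R G) M]
  (j : M →+ RQ G) (φ : Module.Dual (R G) M → RQ G)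

lemma cub_pmp {ι : Type} (s : Finset ι) (f : ι → K) (L : ι → cubP K) (h : ∀ i ∈ s, f i ∈ L i) :
    ∏ i ∈ s, f i ∈ ∏ i ∈ s, L i := by
  classical
  induction s using Finset.induction_on with
  | empty => simp
  | insert j T hj ih =>
    rw [Finset.prod_insert hj, Finset.prod_insert hj]
    exact Submodule.mul_mem_mul (h j (by simp)) (ih fun i hi => h i (by simp [hi]))

def cubJs (y : ZMod p) : cubP K := Submodule.span (𝓞 K) (Set.range fun m => cubPsi (cubth hζ e y) (j m))
def cubJi (y : ZMod p) : cubP K := Submodule.span (𝓞 K) (Set.range fun f => cubPsi (cubth hζ e y) (φ f))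

lemma cubJ_mul (hφ : ∀ f m, iotaR G (f m) = φ f * j m)
    {k : Type} [Fintype k] (fk : k → Module.Dual (R G) M) (mk : k → M)
    (hk : ∑ i, fk i (mk i) = 1) (y : ZMod p) : cubJs hζ e j y * cubJi hζ e φ y = 1 := by
  apply le_antisymm
  · rw [cubJs, cubJi, Submodule.span_mul_span, Submodule.span_le]
    rintro _ ⟨_, ⟨m, rfl⟩, _, ⟨f, rfl⟩, rfl⟩
    rw [SetLike.mem_coe, cub_one_iff]
    obtain ⟨z, hz⟩ := cubth_int hζ e y (f m)
    refine ⟨z, ?_⟩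
    rw [hz, hφ, map_mul, mul_comm]
  · rw [Submodule.one_le]
    have : (1 : K) = ∑ i, cubPsi (cubth hζ e y) (j (mk i)) * cubPsi (cubth hζ e y) (φ (fk i)) := by
      have h1 := congrArg (fun z => cubPsi (cubth hζ e y) (iotaR G z)) hk
      simp only [map_one, map_sum] at h1
      rw [← h1]
      refine Finset.sum_congr rfl fun i _ => ?_
      rw [hφ, map_mul, mul_comm]
    rw [this]
    exact Submodule.sum_mem _ fun i _ => Submodule.mul_mem_mul
      (Submodule.subset_span ⟨_, rfl⟩) (Submodule.subset_span ⟨_, rfl⟩)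

def cubJ (h : ∀ y, cubJs hζ e j y * cubJi hζ e φ y = 1) (y : ZMod p) : (cubP K)ˣ :=
  ⟨cubJs hζ e j y, cubJi hζ e φ y, h y, by rw [mul_comm]; exact h y⟩

lemma cubJ_val (h : ∀ y, cubJs hζ e j y * cubJi hζ e φ y = 1) (y : ZMod p) :
    (cubJ hζ e j φ h y : cubP K) = cubJs hζ e j y := rfl

lemma cubJ_prod {n : ℕ} (a : (SQ G n)ˣ)
    (hφ : ∀ f m, iotaR G (f m) = φ f * j m)
    {k : Type} [Fintype k] (fk : k → Module.Dual (R G) M) (mk : k → M)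
    (hk : ∑ i, fk i (mk i) = 1)
    (A1 : ∀ (mm : Finset (Fin n) → M) (ff : Finset (Fin n) → Module.Dual (R G) M), ∃ s : S G n,
      ∏ I, (if Even (n - I.card) then deltaHomQ G n I (j (mm I)) else deltaHomQ G n I (φ (ff I)))
        = iotaS G n s * a)
    (A2 : ∀ N : AddSubgroup (SQ G n), (∀ s, ∀ x ∈ N, iotaS G n s * x ∈ N) →
      (∀ r : Finset (Fin n) → SQ G n,
        (∀ I, Even (n - I.card) → r I ∈ AddSubgroup.closure 
          {x | ∃ s m, x = iotaS G n s * deltaHomQ G n I (j m)}) →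
        (∀ I, ¬ Even (n - I.card) → ∀ m, ∃ s, r I * deltaHomQ G n I (j m) = iotaS G n s) →
        ∏ I, r I ∈ N) → (a : SQ G n) ∈ N)
    (x : Fin n → ZMod p) :
    Submodule.span (𝓞 K) {(cubAv hζ e a x : K)} = ∏ I : Finset (Fin n),
      if Even (n - I.card) then cubJs hζ e j (∑ i ∈ I, x i) else cubJi hζ e φ (∑ i ∈ I, x i) := by
  classical
  set P := ∏ I : Finset (Fin n),
      if Even (n - I.card) then cubJs hζ e j (∑ i ∈ I, x i) else cubJi hζ e φ (∑ i ∈ I, x i) with hP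
  apply le_antisymm
  · rw [Submodule.span_singleton_le_iff_mem, cubAv_val]
    have := A2 (P.toAddSubgroup.comap (cubPsi (cubTh hζ e x)).toAddMonoidHom) ?_ ?_
    · exact this
    · intro s z hz
      change cubPsi (cubTh hζ e x) _ ∈ P
      rw [map_mul]
      obtain ⟨w, hw⟩ := cubTh_int hζ e x s
      rw [← hw, ← Algebra.smul_def]
      exact P.smul_mem _ hz
    · intro r h1 h2
      change cubPsi (cubTh hζ e x) _ ∈ P
      rw [map_prod, hP]
      apply cub_pmp
      intro I _
      split_ifs with hI
      · have := h1 I hI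
        generalize r I = q at this
        induction this using AddSubgroup.closure_induction with
        | mem z hz =>
          obtain ⟨s, m, rfl⟩ := hz
          rw [map_mul, cubTh_delta]
          obtain ⟨w, hw⟩ := cubTh_int hζ e x s
          rw [← hw, ← Algebra.smul_def]
          exact Submodule.smul_mem _ _ (Submodule.subset_span ⟨m, rfl⟩)
        | zero => rw [map_zero]; exact Submodule.zero_mem _
        | add u v _ _ hu hv => rw [map_add]; exact Submodule.add_mem _ hu hv
        | neg u _ hu => rw [map_neg]; exact Submodule.neg_mem _ hu
      · have e1 : cubPsi (cubTh hζ e x) (r I) = ∑ i, cubPsi (cubTh hζ e x) (r I * deltaHomQ G n I (j (mk i))) *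
            cubPsi (cubth hζ e (∑ i ∈ I, x i)) (φ (fk i)) := by
          have h3 := congrArg (fun z => cubPsi (cubTh hζ e x) (r I) *
            cubPsi (cubth hζ e (∑ i ∈ I, x i)) (iotaR G z)) hk
          simp only [map_one, map_sum, mul_one, Finset.mul_sum] at h3
          rw [← h3]
          refine Finset.sum_congr rfl fun i _ => ?_
          rw [hφ, map_mul, map_mul, cubTh_delta]; ring
        rw [e1]
        refine Submodule.sum_mem _ fun i _ => ?_
        obtain ⟨s, hs⟩ := h2 I hI (mk i)
        obtain ⟨w, hw⟩ := cubTh_int hζ e x s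
        rw [hs, ← hw, ← Algebra.smul_def]
        exact Submodule.smul_mem _ _ (Submodule.subset_span ⟨_, rfl⟩)
  · have e2 : P = ∏ I : Finset (Fin n), Submodule.span (𝓞 K) (if Even (n - I.card) then
        (Set.range fun m => cubPsi (cubth hζ e (∑ i ∈ I, x i)) (j m)) else
        (Set.range fun f => cubPsi (cubth hζ e (∑ i ∈ I, x i)) (φ f))) := by
      rw [hP]
      refine Finset.prod_congr rfl fun I _ => ?_
      split_ifs <;> rfl
    rw [e2, Submodule.prod_span, Submodule.span_le]
    intro z hz
    rw [Set.mem_fintype_prod] at hz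
    obtain ⟨g, hg, rfl⟩ := hz
    have h1 : ∀ I : Finset (Fin n), ∃ (m : M) (f : Module.Dual (R G) M),
        g I = cubPsi (cubTh hζ e x) (if Even (n - I.card) then deltaHomQ G n I (j m) else
          deltaHomQ G n I (φ f)) := by
      intro I
      have := hg I
      split_ifs at this ⊢ with hI
      · obtain ⟨m, hm⟩ := this
        exact ⟨m, 0, by rw [cubTh_delta]; exact hm.symm⟩
      · obtain ⟨f, hf⟩ := this
        exact ⟨0, f, by rw [cubTh_delta]; exact hf.symm⟩
    choose mm ff hmf using h1
    obtain ⟨s, hs⟩ := A1 mm ff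
    have h2 : ∏ I, g I = cubPsi (cubTh hζ e x) (iotaS G n s * a) := by
      rw [← hs, map_prod]
      exact Finset.prod_congr rfl fun I _ => hmf I
    rw [h2, map_mul]
    obtain ⟨w, hw⟩ := cubTh_int hζ e x s
    rw [← hw, ← Algebra.smul_def]
    exact Submodule.smul_mem _ _ (Submodule.mem_span_singleton_self _)

lemma cubJ_hJ {n : ℕ} (a : (SQ G n)ˣ) (h : ∀ y, cubJs hζ e j y * cubJi hζ e φ y = 1)
    (x : Fin n → ZMod p)
    (hx : Submodule.span (𝓞 K) {(cubAv hζ e a x : K)} = ∏ I : Finset (Fin n),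
      if Even (n - I.card) then cubJs hζ e j (∑ i ∈ I, x i) else cubJi hζ e φ (∑ i ∈ I, x i)) :
    Additive.ofMul (cubSp (cubAv hζ e a x)) =
      cubG n (fun y => Additive.ofMul (cubJ hζ e j φ h y)) x := by
  apply Additive.toMul.injective
  rw [cubG_toMul]
  apply Units.ext
  rw [Units.coe_prod]
  refine hx.trans (Finset.prod_congr rfl fun I _ => ?_)
  split_ifs <;> rfl
end
end

section
open NumberField CubicStructure
section
variable {K : Type} [Field K] [NumberField K] {p : ℕ} [hpF : Fact p.Prime]
  [IsCyclotomicExtension {p} ℚ K] {ζ : K} (hζ : IsPrimitiveRoot ζ p)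
  {G : Type} [CommGroup G] [Fintype G] (e : G →* Multiplicative (ZMod p))
  {M : Type} [AddCommGroup M] [Module (R G) M]
  (j : M →+ RQ G) (φ : Module.Dual (R G) M → RQ G)

lemma cub_vF {n : ℕ} (s : S G n) : ∃ v ∈ cubF (cubE hζ hpF.out) n, ∀ x,
    ((v x : cubLoc (cub_lam_prime hζ hpF.out)) : K) = cubPsi (cubTh hζ e x) (iotaS G n s) := by
  induction s using MonoidAlgebra.induction_linear with
  | zero => exact ⟨0, Subalgebra.zero_mem _, fun x => by simp⟩
  | add s t hs ht =>
    obtain ⟨v, hv, hv2⟩ := hs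
    obtain ⟨w, hw, hw2⟩ := ht
    refine ⟨v + w, Subalgebra.add_mem _ hv hw, fun x => ?_⟩
    rw [map_add, map_add, ← hv2, ← hw2]; rfl
  | single h c =>
    refine ⟨_, cubF_gen (cubE hζ hpF.out) (c : cubLoc (cub_lam_prime hζ hpF.out))
      (fun i => (e (h i)).toAdd), fun x => ?_⟩
    refine Eq.trans ?_ (cubPsi_iot (cubTh hζ e x) _).symm
    rw [MonoidAlgebra.lift_single, cubTh_apply, zsmul_eq_mul, Subring.coe_mul, Subring.coe_intCast,
      SubmonoidClass.coe_finsetProd]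
    refine congrArg (fun y : K => (c : K) * y) (Finset.prod_congr rfl fun i _ => ?_)
    rw [cubE_val]
    exact (cubX_val hζ _).symm

/-- local inverse -/
def cubInv (d : ℤ) (r' : R G) (f0 : Module.Dual (R G) M) : RQ G :=
  ((d : ℚ)⁻¹) • (iotaR G r' * φ f0)

variable (hφ : ∀ f m, iotaR G (f m) = φ f * j m)
  {f0 : Module.Dual (R G) M} {m0 : M} {d : ℤ} {r' : R G} (hd0 : d ≠ 0)
  (hd : r' * f0 m0 = (d : R G))

lemma cubInv_d (hd0 : d ≠ 0) : (d : RQ G) * cubInv φ d r' f0 = iotaR G r' * φ f0 := by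
  rw [cubInv, ← zsmul_eq_mul, ← Int.cast_smul_eq_zsmul ℚ, smul_smul,
    mul_inv_cancel₀ (by exact_mod_cast hd0), one_smul]

lemma cubInv_mul (hφ : ∀ f m, iotaR G (f m) = φ f * j m) (hd0 : d ≠ 0)
    (hd : r' * f0 m0 = (d : R G)) : cubInv φ d r' f0 * j m0 = 1 := by
  rw [cubInv, smul_mul_assoc, mul_assoc, ← hφ, ← map_mul, hd, map_intCast]
  have h1 : (d : RQ G) = (d : ℚ) • (1 : RQ G) := by
    rw [Int.cast_smul_eq_zsmul ℚ, zsmul_one]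
  rw [h1, smul_smul, inv_mul_cancel₀ (by exact_mod_cast hd0), one_smul]

lemma cubInv_gen (hφ : ∀ f m, iotaR G (f m) = φ f * j m) (hd0 : d ≠ 0)
    (hd : r' * f0 m0 = (d : R G)) (m : M) : (d : RQ G) * j m = iotaR G (r' * f0 m) * j m0 := by
  calc (d : RQ G) * j m = d * j m * (cubInv φ d r' f0 * j m0) := by
        rw [cubInv_mul j φ hφ hd0 hd, mul_one]
    _ = (d * cubInv φ d r' f0) * j m * j m0 := by ring
    _ = _ := by rw [cubInv_d φ hd0, map_mul, hφ, mul_assoc (iotaR G r')]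

lemma cub_s1 {n : ℕ} (a : (SQ G n)ˣ) (hφ : ∀ f m, iotaR G (f m) = φ f * j m) (hd0 : d ≠ 0)
    (hd : r' * f0 m0 = (d : R G))
    (A2 : ∀ N : AddSubgroup (SQ G n), (∀ s, ∀ x ∈ N, iotaS G n s * x ∈ N) →
      (∀ r : Finset (Fin n) → SQ G n,
        (∀ I, Even (n - I.card) → r I ∈ AddSubgroup.closure 
          {x | ∃ s m, x = iotaS G n s * deltaHomQ G n I (j m)}) →
        (∀ I, ¬ Even (n - I.card) → ∀ m, ∃ s, r I * deltaHomQ G n I (j m) = iotaS G n s) →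
        ∏ I, r I ∈ N) → (a : SQ G n) ∈ N) :
    ∃ s : S G n, (d : SQ G n) ^ Fintype.card (Finset (Fin n)) * a = iotaS G n s *
      ∏ I : Finset (Fin n), deltaHomQ G n I (if Even (n - I.card) then j m0 else cubInv φ d r' f0) := by
  set T := ∏ I : Finset (Fin n), deltaHomQ G n I (if Even (n - I.card) then j m0 else cubInv φ d r' f0)
    with hT
  set C := Fintype.card (Finset (Fin n)) with hC
  let N : AddSubgroup (SQ G n) :=
    { carrier := {z | ∃ s : S G n, (d : SQ G n) ^ C * z = iotaS G n s * T}
      zero_mem' := ⟨0, by simp⟩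
      add_mem' := by
        rintro x y ⟨s, hs⟩ ⟨t, ht⟩
        exact ⟨s + t, by rw [mul_add, hs, ht, map_add, add_mul]⟩
      neg_mem' := by
        rintro x ⟨s, hs⟩
        exact ⟨-s, by rw [mul_neg, hs, map_neg, neg_mul]⟩ }
  refine A2 N ?_ ?_
  · rintro s x ⟨t, ht⟩
    exact ⟨s * t, by rw [mul_left_comm, ht, map_mul, mul_assoc]⟩
  · intro r h1 h2
    have h3 : ∀ I : Finset (Fin n), ∃ s : S G n, (d : SQ G n) * r I = iotaS G n s *
        deltaHomQ G n I (if Even (n - I.card) then j m0 else cubInv φ d r' f0) := by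
      intro I
      split_ifs with hI
      · have := h1 I hI
        generalize r I = q at this
        induction this using AddSubgroup.closure_induction with
        | mem z hz =>
          obtain ⟨s, m, rfl⟩ := hz
          refine ⟨s * deltaHom G n I (r' * f0 m), ?_⟩
          have h4 := congrArg (deltaHomQ G n I) (cubInv_gen j φ hφ hd0 hd m)
          rw [map_mul, map_mul, map_intCast] at h4
          rw [mul_left_comm, h4, map_mul (iotaS G n), cub_iota_delta, mul_assoc]
        | zero => exact ⟨0, by simp⟩
        | add u v _ _ hu hv =>
          obtain ⟨s, hs⟩ := hu
          obtain ⟨t, ht⟩ := hv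
          exact ⟨s + t, by rw [mul_add, hs, ht, map_add, add_mul]⟩
        | neg u _ hu =>
          obtain ⟨s, hs⟩ := hu
          exact ⟨-s, by rw [mul_neg, hs, map_neg, neg_mul]⟩
      · obtain ⟨s, hs⟩ := h2 I hI m0
        refine ⟨d * s, ?_⟩
        have h4 := congrArg (deltaHomQ G n I) (cubInv_mul j φ hφ hd0 hd)
        rw [map_mul, map_one] at h4
        rw [map_mul, map_intCast, ← hs, mul_assoc, mul_assoc, mul_comm (deltaHomQ G n I (j m0)), h4,
          mul_one]
    choose s hs using h3
    refine ⟨∏ I, s I, ?_⟩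
    rw [hT, map_prod, ← Finset.prod_mul_distrib, ← Finset.prod_congr rfl fun I _ => hs I,
      Finset.prod_mul_distrib, Finset.prod_const, Finset.card_univ]

def cubB (h : cubInv φ d r' f0 * j m0 = 1) (y : ZMod p) : Kˣ :=
  ⟨cubPsi (cubth hζ e y) (j m0), cubPsi (cubth hζ e y) (cubInv φ d r' f0),
    by rw [← map_mul, mul_comm, h, map_one], by rw [← map_mul, h, map_one]⟩

lemma cub_u {n : ℕ} (a : (SQ G n)ˣ) (hpd : ¬ (p : ℤ) ∣ d) (h : cubInv φ d r' f0 * j m0 = 1)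
    (s : S G n) (hs : (d : SQ G n) ^ Fintype.card (Finset (Fin n)) * a = iotaS G n s *
      ∏ I : Finset (Fin n), deltaHomQ G n I (if Even (n - I.card) then j m0 else cubInv φ d r' f0)) :
    ∃ u ∈ cubF (cubE hζ hpF.out) n, ∀ x, ((u x : cubLoc (cub_lam_prime hζ hpF.out)) : K) *
      ((Additive.toMul (cubG n (fun y => Additive.ofMul (cubB hζ e j φ h y)) x) : Kˣ) : K)
        = cubAv hζ e a x := by
  obtain ⟨v, hv, hv2⟩ := cub_vF hζ e s
  have hu : IsUnit (cubIn (cub_lam_prime hζ hpF.out) (d : 𝓞 K)) :=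
    cubLoc_isUnit _ _ fun hh => hpd (cub_lam_int hζ hpF.out d hh)
  obtain ⟨w, hw⟩ := hu
  have hwd : (w : cubLoc (cub_lam_prime hζ hpF.out)) = (d : cubLoc (cub_lam_prime hζ hpF.out)) := by
    rw [hw]; apply Subtype.ext; rw [cubIn_val]; simp
  have hdK : ((↑(w⁻¹) : cubLoc (cub_lam_prime hζ hpF.out)) : K) * (d : K) = 1 := by
    have h1 : (↑(w⁻¹) : cubLoc (cub_lam_prime hζ hpF.out)) * d = 1 := by
      rw [← hwd]; exact w.inv_mul
    have h2 := congrArg (fun y : cubLoc (cub_lam_prime hζ hpF.out) => (y : K)) h1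
    simpa using h2
  set C := Fintype.card (Finset (Fin n)) with hC
  refine ⟨((↑(w⁻¹) : cubLoc (cub_lam_prime hζ hpF.out)) ^ C) • v, Subalgebra.smul_mem _ hv _, fun x => ?_⟩
  rw [cubG_toMul, Units.coe_prod, Pi.smul_apply, smul_eq_mul, Subring.coe_mul, Subring.coe_pow, hv2,
    cubAv_val]
  have h3 := congrArg (cubPsi (cubTh hζ e x)) hs
  rw [map_mul, map_mul, map_pow, map_intCast, map_prod] at h3
  have h4 : ∏ I : Finset (Fin n), cubPsi (cubTh hζ e x) (deltaHomQ G n I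
      (if Even (n - I.card) then j m0 else cubInv φ d r' f0)) =
      ∏ I : Finset (Fin n), ((if Even (n - I.card) then cubB hζ e j φ h (∑ i ∈ I, x i) else
        (cubB hζ e j φ h (∑ i ∈ I, x i))⁻¹ : Kˣ) : K) := by
    refine Finset.prod_congr rfl fun I _ => ?_
    rw [cubTh_delta]
    split_ifs <;> rfl
  rw [h4] at h3
  rw [mul_assoc, ← h3, ← mul_assoc, ← mul_pow, hdK, one_pow, one_mul]
end
end

section
open NumberField CubicStructure
section
variable {K : Type} [Field K] [NumberField K] {p : ℕ} [hpF : Fact p.Prime]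
  [IsCyclotomicExtension {p} ℚ K] {ζ : K} (hζ : IsPrimitiveRoot ζ p)
  {G : Type} [CommGroup G] [Fintype G] (e : G →* Multiplicative (ZMod p))
  {M : Type} [AddCommGroup M] [Module (R G) M]
  (j : M →+ RQ G) (φ : Module.Dual (R G) M → RQ G)

lemma cub_p2princ {ζ : K} (hζ : IsPrimitiveRoot ζ p) (h2 : p = 2) (L : (cubP K)ˣ) : ∃ γ : Kˣ, L = cubSp γ := by
  have h1 : hζ.toInteger = -1 := by
    subst h2
    exact hζ.toInteger_isPrimitiveRoot.eq_neg_one_of_two_right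
  have hs : Function.Surjective (Int.castRingHom (𝓞 K)) := by
    intro x
    have hx : x ∈ Algebra.adjoin ℤ {hζ.toInteger} := by rw [cub_adjoin_top hζ]; trivial
    induction hx using Algebra.adjoin_induction with
    | mem y hy => exact ⟨-1, by rw [Set.mem_singleton_iff.1 hy, h1]; simp⟩
    | algebraMap r => exact ⟨r, by simp⟩
    | add x y _ _ hx hy =>
      obtain ⟨a, rfl⟩ := hx
      obtain ⟨b, rfl⟩ := hy
      exact ⟨a + b, map_add _ _ _⟩
    | mul x y _ _ hx hy =>
      obtain ⟨a, rfl⟩ := hx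
      obtain ⟨b, rfl⟩ := hy
      exact ⟨a * b, map_mul _ _ _⟩
  have hP : IsPrincipalIdealRing (𝓞 K) := IsPrincipalIdealRing.of_surjective _ hs
  obtain ⟨e, I, hI⟩ := cub_clear L
  exact cub_princ_of L e I hI (hP.principal I)

lemma cubth_aug (s : R G) : cubPsi (cubth hζ e 0) (iotaR G s) = (cubAug G s : K) := by
  refine (cubPsi_iot (cubth hζ e 0) s).trans ?_
  induction s using MonoidAlgebra.induction_linear with
  | zero => simp
  | add x y hx hy => rw [map_add, hx, hy, map_add, Int.cast_add]
  | single g c => rw [MonoidAlgebra.lift_single, cubAug_single, cubth_zero]; simp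

variable {f0 : Module.Dual (R G) M} {m0 : M} {d : ℤ} {r' : R G}

lemma cub_J0 (hφ : ∀ f m, iotaR G (f m) = φ f * j m) (hd0 : d ≠ 0)
    (hd : r' * f0 m0 = (d : R G)) : ∃ (mA : M) (j0 : Kˣ), cubPsi (cubth hζ e 0) (j mA) = j0 ∧
      ∀ m, ∃ c : ℤ, cubPsi (cubth hζ e 0) (j m) = c * j0 := by
  let F : M →ₗ[ℤ] ℤ := ((cubAug G).toAddMonoidHom.comp f0.toAddMonoidHom).toIntLinearMap
  have hF : ∀ m, F m = cubAug G (f0 m) := fun m => rfl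
  obtain ⟨k, hk⟩ := (IsPrincipalIdealRing.principal (LinearMap.range F)).principal
  have hkm : k ∈ LinearMap.range F := by rw [hk]; exact Submodule.mem_span_singleton_self k
  obtain ⟨mA, hA⟩ := hkm
  have hc : ∀ m, ∃ c : ℤ, F m = c * k := by
    intro m
    have : F m ∈ LinearMap.range F := ⟨m, rfl⟩
    rw [hk, Submodule.mem_span_singleton] at this
    obtain ⟨c, hc⟩ := this
    exact ⟨c, hc.symm⟩
  have h1 : ∀ m, cubPsi (cubth hζ e 0) (φ f0) * cubPsi (cubth hζ e 0) (j m) = (F m : K) := by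
    intro m
    rw [← map_mul, ← hφ, cubth_aug]; rfl
  have h2 : (cubAug G r' : K) * (F m0 : K) = d := by
    rw [← Int.cast_mul, hF, ← map_mul, hd, map_intCast]; rfl
  have hdK : (d : K) ≠ 0 := by exact_mod_cast hd0
  have h3 : (F m0 : K) ≠ 0 := fun h => hdK (by rw [← h2, h, mul_zero])
  have h4 : cubPsi (cubth hζ e 0) (φ f0) ≠ 0 := fun h => h3 (by rw [← h1, h, zero_mul])
  have h5 : cubPsi (cubth hζ e 0) (j mA) ≠ 0 := by
    intro h
    obtain ⟨c, hc⟩ := hc m0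
    apply h3
    have : (F mA : K) = 0 := by rw [← h1, h, mul_zero]
    rw [hc, Int.cast_mul, ← hA, this, mul_zero]
  refine ⟨mA, Units.mk0 _ h5, rfl, fun m => ?_⟩
  obtain ⟨c, hc⟩ := hc m
  refine ⟨c, ?_⟩
  apply mul_left_cancel₀ h4
  rw [h1, hc, Units.val_mk0, mul_left_comm, h1, Int.cast_mul, hA]

lemma cub_J0p (h : ∀ y, cubJs hζ e j y * cubJi hζ e φ y = 1) (mA : M) (j0 : Kˣ)
    (h1 : cubPsi (cubth hζ e 0) (j mA) = j0) 
    (h2 : ∀ m, ∃ c : ℤ, cubPsi (cubth hζ e 0) (j m) = c * j0) :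
    cubJ hζ e j φ h 0 = cubSp j0 := by
  apply Units.ext
  rw [cubJ_val, cubSp_val]
  apply le_antisymm
  · rw [cubJs, Submodule.span_le]
    rintro _ ⟨m, rfl⟩
    obtain ⟨c, hc⟩ := h2 m
    have : (c : K) * j0 = (c : 𝓞 K) • (j0 : K) := by
      rw [Algebra.smul_def, map_intCast]
    change cubPsi (cubth hζ e 0) (j m) ∈ _
    rw [hc, this]
    exact Submodule.smul_mem _ _ (Submodule.mem_span_singleton_self _)
  · rw [Submodule.span_singleton_le_iff_mem, ← h1]
    exact Submodule.subset_span ⟨mA, rfl⟩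

theorem cub_J1 {m : ℕ} (hm : m + 2 ≤ p) (cc : 2 < p → Nonempty (CubConj K ζ p))
    {k : Type} [Fintype k] (fk : k → Module.Dual (R G) M) (mk : k → M)
    (hk : ∑ i, fk i (mk i) = 1)
    (hφ : ∀ f m, iotaR G (f m) = φ f * j m) (hpd : ¬ (p : ℤ) ∣ d)
    (hd : r' * f0 m0 = (d : R G)) (hn : 2 ≤ m + 2)
    (a : (SQ G (m+2))ˣ)
    (hc : (MonoidAlgebra.lift ℚ ℚ (Fin (m+2) → G) (1 : (Fin (m+2) → G) →* ℚ)) (↑a : SQ G (m+2)) = 1 ∧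
    (∀ σ : Equiv.Perm (Fin (m+2)),
      MonoidAlgebra.mapDomainRingHom ℚ (permHom G (m+2) σ) (↑a : SQ G (m+2)) = (↑a : SQ G (m+2))) ∧
    (MonoidAlgebra.mapDomainRingHom ℚ (cubI0 G (m+2) hn) (↑a : SQ G (m+2)) *
        MonoidAlgebra.mapDomainRingHom ℚ (cubI2 G (m+2) hn) (↑a : SQ G (m+2)) =
      MonoidAlgebra.mapDomainRingHom ℚ (cubI1 G (m+2) hn) (↑a : SQ G (m+2)) *
        MonoidAlgebra.mapDomainRingHom ℚ (cubI3 G (m+2) hn) (↑a : SQ G (m+2))))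
    (A1 : ∀ (mm : Finset (Fin (m+2)) → M) (ff : Finset (Fin (m+2)) → Module.Dual (R G) M), ∃ s : S G (m+2),
      ∏ I, (if Even ((m+2) - I.card) then deltaHomQ G (m+2) I (j (mm I))
        else deltaHomQ G (m+2) I (φ (ff I))) = iotaS G (m+2) s * a)
    (A2 : ∀ N : AddSubgroup (SQ G (m+2)), (∀ s, ∀ x ∈ N, iotaS G (m+2) s * x ∈ N) →
      (∀ r : Finset (Fin (m+2)) → SQ G (m+2),
        (∀ I, Even ((m+2) - I.card) → r I ∈ AddSubgroup.closure 
          {x | ∃ s m', x = iotaS G (m+2) s * deltaHomQ G (m+2) I (j m')}) →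
        (∀ I, ¬ Even ((m+2) - I.card) → ∀ m', ∃ s, r I * deltaHomQ G (m+2) I (j m') = iotaS G (m+2) s) →
        ∏ I, r I ∈ N) → (a : SQ G (m+2)) ∈ N) :
    ∃ γ : Kˣ, cubJs hζ e j 1 = Submodule.span (𝓞 K) {(γ : K)} := by
  have hd0 : d ≠ 0 := fun h => hpd (by rw [h]; exact dvd_zero _)
  have h := cubJ_mul hζ e j φ hφ fk mk hk
  suffices hh : ∃ γ : Kˣ, cubJ hζ e j φ h 1 = cubSp γ by
    obtain ⟨γ, hγ⟩ := hh
    exact ⟨γ, congrArg Units.val hγ⟩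
  by_cases hp2 : p = 2
  · exact cub_p2princ hζ hp2 _
  have hp2' : 2 < p := lt_of_le_of_ne hpF.out.two_le (Ne.symm hp2)
  obtain ⟨hs1, hc1, h01⟩ := cubAv_props hζ e hn a hc.1 hc.2.1 hc.2.2
  obtain ⟨s, hs⟩ := cub_s1 j φ a hφ hd0 hd A2
  obtain ⟨u, hu, hu2⟩ := cub_u hζ e j φ a hpd (cubInv_mul j φ hφ hd0 hd) s hs
  obtain ⟨cc⟩ := cc hp2'
  obtain ⟨γ, hγ⟩ := cub_core hζ hp2' cc hm (cubAv hζ e a) hs1 hc1 h01 (cubJ hζ e j φ h)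
    (fun x => cubJ_hJ hζ e j φ a h x (cubJ_prod hζ e j φ a hφ fk mk hk A1 A2 x)) _ u hu hu2
  obtain ⟨mA, j0, h1, h2⟩ := cub_J0 hζ e j φ hφ hd0 hd
  refine ⟨j0 * γ, ?_⟩
  rw [hγ, cub_J0p hζ e j φ h mA j0 h1 h2, map_mul]
end
end

section
open NumberField CubicStructure
section
variable {R M O : Type} [CommRing R] [AddCommGroup M] [Module R M] [CommRing O] [IsDomain O]

theorem cub_rim (c : M →+ ℤ) (V : M →+ O) (α : R →+* ℤ) (β : R →+* O)
    (hc : ∀ r m, c (r • m) = α r * c m) (hV : ∀ r m, V (r • m) = β r * V m)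
    (inj : ∀ m, c m = 0 → V m = 0 → m = 0) (injR : ∀ r, α r = 0 → β r = 0 → r = 0)
    (hβ : Function.Surjective β) (hVs : Function.Surjective V) (mA : M) (hA : c mA = 1)
    (lam : O) (hl : Prime lam) (η : R) (hη0 : α η = 0) (hη1 : β η = lam)
    (hres : ∀ r, lam ∣ β r - (α r : O)) (m0 : M) (d : ℤ) (hd : ¬ lam ∣ (d : O))
    (hgen : ∀ m, ∃ ρ : R, d • m = ρ • m0)
    (hun : ∀ w : O, ¬ lam ∣ w → ∃ ε : Oˣ, lam ∣ (ε : O) - w) :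
    Nonempty (M ≃ₗ[R] R) := by
  obtain ⟨ρA, hρA⟩ := hgen mA
  have e1 : d = α ρA * c m0 := by
    have := congrArg c hρA
    rwa [map_zsmul, hc, hA, smul_eq_mul, mul_one] at this
  have hρ : ¬ lam ∣ (α ρA : O) := fun h => hd (by rw [e1, Int.cast_mul]; exact h.mul_right _)
  have hc0 : c m0 ≠ 0 := by
    intro h
    apply hd
    rw [e1, h, mul_zero, Int.cast_zero]; exact dvd_zero _
  obtain ⟨m1, hm1⟩ := hVs 1
  obtain ⟨ρ1, hρ1⟩ := hgen m1
  have hw0 : ¬ lam ∣ V m0 := by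
    intro h
    apply hd
    have := congrArg V hρ1
    rw [map_zsmul, hV, hm1, zsmul_eq_mul, mul_one] at this
    rw [this]; exact h.mul_left _
  have hβA : ¬ lam ∣ β ρA := fun h => hρ ((dvd_sub_right h).mp (hres ρA))
  have hw : ¬ lam ∣ V mA := by
    intro h
    have := congrArg V hρA
    rw [map_zsmul, hV, zsmul_eq_mul] at this
    have h2 : lam ∣ β ρA * V m0 := by rw [← this]; exact h.mul_left _
    exact (hl.dvd_or_dvd h2).elim hβA hw0
  obtain ⟨ε, v, hv⟩ := hun _ hw
  obtain ⟨m3, hm3⟩ := hVs v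
  let m := mA + η • m3
  have hcm : c m = 1 := by rw [map_add, hc, hη0, hA, zero_mul, add_zero]
  have hVm : V m = ε := by rw [map_add, hV, hη1, hm3, ← hv]; ring
  have hsurj : ∀ y, ∃ r : R, r • m = y := by
    intro y
    let y1 := y - c y • m
    have hy1 : c y1 = 0 := by rw [map_sub, map_zsmul, hcm, smul_eq_mul, mul_one, sub_self]
    obtain ⟨ρ, hρ'⟩ := hgen y1
    have h1 : α ρ = 0 := by
      have := congrArg c hρ'
      rw [map_zsmul, hc, hy1, smul_zero] at this
      exact (mul_eq_zero.mp this.symm).resolve_right hc0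
    have h2 : lam ∣ β ρ := by
      have := hres ρ
      rwa [h1, Int.cast_zero, sub_zero] at this
    have h3 : lam ∣ V y1 := by
      have := congrArg V hρ'
      rw [map_zsmul, hV, zsmul_eq_mul] at this
      have h4 : lam ∣ d * V y1 := by rw [this]; exact h2.mul_right _
      exact (hl.dvd_or_dvd h4).resolve_left hd
    obtain ⟨v', hv'⟩ := h3
    obtain ⟨ρ2, hρ2⟩ := hβ (v' * ((ε⁻¹ : Oˣ) : O))
    have h5 : y1 = (η * ρ2) • m := by
      rw [← sub_eq_zero]
      apply inj
      · rw [map_sub, hy1, hc, map_mul, hη0]; simp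
      · rw [map_sub, hV, map_mul, hη1, hρ2, hVm, hv', mul_assoc lam, mul_assoc v', Units.inv_mul, mul_one,
          sub_self]
    refine ⟨(c y : R) + η * ρ2, ?_⟩
    rw [add_smul, ← h5, Int.cast_smul_eq_zsmul]
    exact add_sub_cancel _ _
  have hinj : ∀ r : R, r • m = 0 → r = 0 := by
    intro r hr
    apply injR
    · have := congrArg c hr
      rwa [hc, hcm, mul_one, map_zero] at this
    · have := congrArg V hr
      rw [hV, hVm, map_zero] at this
      exact (mul_eq_zero.mp this).resolve_right ε.ne_zero
  exact ⟨(LinearEquiv.ofBijective (LinearMap.toSpanSingleton R M m)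
    ⟨(injective_iff_map_eq_zero _).mpr fun r hr => hinj r hr, hsurj⟩).symm⟩
end
section
variable {K : Type} [Field K] [NumberField K] {p : ℕ} [hpF : Fact p.Prime]
  [IsCyclotomicExtension {p} ℚ K] {ζ : K} (hζ : IsPrimitiveRoot ζ p)
  {G : Type} [CommGroup G] [Fintype G] (e : G →* Multiplicative (ZMod p))

lemma cub_unitres (w : 𝓞 K) (hw : ¬ (hζ.toInteger - 1) ∣ w) :
    ∃ ε : (𝓞 K)ˣ, (hζ.toInteger - 1) ∣ (ε : 𝓞 K) - w := by
  have hp := hpF.out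
  obtain ⟨c, hc⟩ := cub_resO hζ w
  have hlp : (hζ.toInteger - 1) ∣ (p : 𝓞 K) := by
    have h1 := (hζ.toInteger_isPrimitiveRoot).geom_sum_eq_zero hp.one_lt
    have h2 : (p : 𝓞 K) = - ∑ i ∈ Finset.range p, (hζ.toInteger ^ i - 1) := by
      rw [Finset.sum_sub_distrib, h1]; simp
    rw [h2, dvd_neg]
    exact Finset.dvd_sum fun i _ => by simpa using sub_dvd_pow_sub_pow hζ.toInteger 1 i
  have hpc : ¬ (p : ℤ) ∣ c := by
    rintro ⟨k, rfl⟩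
    apply hw
    have h3 : (hζ.toInteger - 1) ∣ ((p * k : ℤ) : 𝓞 K) := by
      push_cast; exact hlp.mul_right _
    exact (dvd_sub_left h3).mp hc
  have hp0 : (p : ℤ) ≠ 0 := by exact_mod_cast hp.ne_zero
  obtain ⟨w', hw'⟩ := Int.eq_ofNat_of_zero_le (Int.emod_nonneg c hp0)
  have h4 : (p : ℤ) ∣ c - w' := by rw [← hw']; exact Int.dvd_self_sub_emod
  have h5 : Nat.Coprime w' p := by
    rw [Nat.coprime_comm, hp.coprime_iff_not_dvd]
    intro h
    apply hpc
    have : (p : ℤ) ∣ (w' : ℤ) := by exact_mod_cast h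
    exact (dvd_sub_left this).mp h4
  have hu := (hζ.toInteger_isPrimitiveRoot).geom_sum_isUnit hp.two_le h5
  obtain ⟨ε, hε⟩ := hu
  refine ⟨ε, ?_⟩
  rw [hε]
  have h6 : (hζ.toInteger - 1) ∣ (∑ i ∈ Finset.range w', hζ.toInteger ^ i) - (w' : 𝓞 K) := by
    have : (∑ i ∈ Finset.range w', hζ.toInteger ^ i) - (w' : 𝓞 K) =
        ∑ i ∈ Finset.range w', (hζ.toInteger ^ i - 1) := by
      rw [Finset.sum_sub_distrib]; simp
    rw [this]
    exact Finset.dvd_sum fun i _ => by simpa using sub_dvd_pow_sub_pow hζ.toInteger 1 i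
  have h7 : (hζ.toInteger - 1) ∣ (c : 𝓞 K) - (w' : 𝓞 K) := by
    obtain ⟨k, hk⟩ := h4
    have h8 := congrArg (fun t : ℤ => (t : 𝓞 K)) hk
    push_cast at h8
    rw [h8]
    exact hlp.mul_right _
  have := dvd_sub (dvd_sub h6 h7) hc
  convert this using 1; ring

lemma cubPsi_sum (θ : G →* K) (z : RQ G) : cubPsi θ z = ∑ g, (z.coeff g : K) * θ g := by
  classical
  induction z using MonoidAlgebra.induction_linear with
  | zero => simp
  | add x y hx hy => 
    rw [map_add, hx, hy, ← Finset.sum_add_distrib]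
    refine Finset.sum_congr rfl fun g _ => ?_
    rw [MonoidAlgebra.coeff_add, Finsupp.add_apply, Rat.cast_add, add_mul]
  | single h c =>
    rw [cubPsi_single, Finset.sum_eq_single h]
    · rw [MonoidAlgebra.coeff_single, Finsupp.single_eq_same]
    · intro g _ hg
      rw [MonoidAlgebra.coeff_single, Finsupp.single_eq_of_ne hg]; simp
    · simp

open Polynomial in
lemma cub_pairinj (he : Function.Injective e) (z : RQ G) (h0 : cubPsi (cubth hζ e 0) z = 0)
    (h1 : cubPsi (cubth hζ e 1) z = 0) : z = 0 := by
  classical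
  have hp := hpF.out
  let P : ℚ[X] := ∑ g, monomial ((e g).toAdd.val) (z.coeff g)
  have hP0 : P.IsRoot 1 := by
    rw [cubPsi_sum] at h0
    have h2 : algebraMap ℚ K (P.eval 1) = 0 := by
      rw [← h0, eval_finsetSum, map_sum]
      refine Finset.sum_congr rfl fun g _ => ?_
      rw [eval_monomial, cubth_zero]; simp
    exact (map_eq_zero _).mp h2
  have hP1 : aeval ζ P = 0 := by
    rw [cubPsi_sum] at h1
    rw [← h1, map_sum]
    refine Finset.sum_congr rfl fun g _ => ?_
    rw [aeval_monomial]
    change _ = _ * cubX hζ (1 * _)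
    rw [one_mul, cubX_val]; rfl
  have hd1 : cyclotomic p ℚ ∣ P := by
    rw [cyclotomic_eq_minpoly_rat hζ hp.pos]
    exact minpoly.dvd ℚ ζ hP1
  have hd0 : (X - 1 : ℚ[X]) ∣ P := by
    have := dvd_iff_isRoot.mpr hP0
    rwa [C_1] at this
  have hcop : IsCoprime (X - 1 : ℚ[X]) (cyclotomic p ℚ) := by
    rw [← cyclotomic_one ℚ]
    exact cyclotomic.isCoprime_rat hp.one_lt.ne
  have hdd : (X ^ p - 1 : ℚ[X]) ∣ P := by
    have := hcop.mul_dvd hd0 hd1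
    rwa [mul_comm, cyclotomic_prime_mul_X_sub_one] at this
  have hdeg : P.degree < p := by
    rw [← mem_degreeLT]
    refine Submodule.sum_mem _ fun g _ => ?_
    rw [mem_degreeLT]
    exact (degree_monomial_le _ _).trans_lt (by exact_mod_cast ZMod.val_lt _)
  have hP : P = 0 := by
    apply eq_zero_of_dvd_of_degree_lt hdd
    rwa [← C_1, degree_X_pow_sub_C hp.pos]
  apply MonoidAlgebra.ext
  apply Finsupp.ext
  intro g0
  have h3 : P.coeff ((e g0).toAdd.val) = z.coeff g0 := by
    rw [finsetSum_coeff, Finset.sum_eq_single g0]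
    · rw [coeff_monomial, if_pos rfl]
    · intro g _ hg
      rw [coeff_monomial, if_neg]
      intro h
      exact hg (he (Multiplicative.toAdd.injective (ZMod.val_injective p h)))
    · simp
  rw [← h3, hP]; simp
end
end

section
open NumberField CubicStructure
section
variable {K : Type} [Field K] [NumberField K] {p : ℕ} [hpF : Fact p.Prime]
  [IsCyclotomicExtension {p} ℚ K] {ζ : K} (hζ : IsPrimitiveRoot ζ p)
  {G : Type} [CommGroup G] [Fintype G] (e : G →* Multiplicative (ZMod p))
  {M : Type} [AddCommGroup M] [Module (R G) M]
  (j : M →+ RQ G) (φ : Module.Dual (R G) M → RQ G)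
  {f0 : Module.Dual (R G) M} {m0 : M} {d : ℤ} {r' : R G}

/-- the integral character -/
lemma cub_beta (y : ZMod p) : ∃ β : R G →+* 𝓞 K,
    ∀ r, algebraMap (𝓞 K) K (β r) = cubPsi (cubth hζ e y) (iotaR G r) := by
  have hinj : Function.Injective (algebraMap (𝓞 K) K) := FaithfulSMul.algebraMap_injective _ _
  choose b hb using fun r => cubth_int hζ e y r
  exact ⟨{ toFun := b
           map_one' := hinj (by rw [hb, map_one, map_one, map_one])
           map_zero' := hinj (by rw [hb, map_zero, map_zero, map_zero])
           map_mul' := fun r s => hinj (by rw [map_mul, hb, hb, hb, map_mul, map_mul])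
           map_add' := fun r s => hinj (by rw [map_add, hb, hb, hb, map_add, map_add]) }, hb⟩

theorem cub_final (ε : G ≃* Multiplicative (ZMod p)) (hjinj : ∀ m, j m = 0 → m = 0)
    (hj : ∀ r m, j (r • m) = iotaR G r * j m)
    (hφ : ∀ f m, iotaR G (f m) = φ f * j m) (hpd : ¬ (p : ℤ) ∣ d)
    (hd : r' * f0 m0 = (d : R G)) (γ : Kˣ)
    (hγ : cubJs hζ ε.toMonoidHom j 1 = Submodule.span (𝓞 K) {(γ : K)}) :
    Nonempty (M ≃ₗ[R G] R G) := by
  have hd0 : d ≠ 0 := fun h => hpd (by rw [h]; exact dvd_zero _)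
  have hinj : Function.Injective (algebraMap (𝓞 K) K) := FaithfulSMul.algebraMap_injective _ _
  obtain ⟨mA, j0, hA, h0⟩ := cub_J0 hζ ε.toMonoidHom j φ hφ hd0 hd
  obtain ⟨β, hβ⟩ := cub_beta hζ ε.toMonoidHom 1
  have h1 : ∀ m, ∃ w : 𝓞 K, cubPsi (cubth hζ ε.toMonoidHom 1) (j m) = algebraMap (𝓞 K) K w * γ := by
    intro m
    have : cubPsi (cubth hζ ε.toMonoidHom 1) (j m) ∈ cubJs hζ ε.toMonoidHom j 1 :=
      Submodule.subset_span ⟨m, rfl⟩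
    rw [hγ, Submodule.mem_span_singleton] at this
    obtain ⟨w, hw⟩ := this
    exact ⟨w, by rw [← hw, Algebra.smul_def]⟩
  choose c hc using h0
  choose V hV using h1
  have hcinj : ∀ a b : ℤ, (a : K) * j0 = b * j0 → a = b := fun a b h => by
    exact_mod_cast mul_right_cancel₀ j0.ne_zero h
  have hVinj : ∀ a b : 𝓞 K, algebraMap (𝓞 K) K a * γ = algebraMap (𝓞 K) K b * γ → a = b := fun a b h =>
    hinj (mul_right_cancel₀ γ.ne_zero h)
  let c' : M →+ ℤ := AddMonoidHom.mk' c fun a b => hcinj _ _ (by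
    rw [← hc, map_add, map_add, hc, hc]; push_cast; ring)
  let V' : M →+ 𝓞 K := AddMonoidHom.mk' V fun a b => hVinj _ _ (by
    rw [← hV, map_add, map_add, hV, hV, map_add]; ring)
  obtain ⟨g, hg⟩ := ε.surjective (Multiplicative.ofAdd 1)
  have hthg : cubth hζ ε.toMonoidHom 1 g = ζ := by
    change cubX hζ (1 * (ε g).toAdd) = ζ
    rw [hg, one_mul, cubX_val, toAdd_ofAdd, ZMod.val_one, pow_one]
  have hβg : β (MonoidAlgebra.single g 1) = hζ.toInteger := by
    apply hinj
    rw [hβ]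
    refine (cubPsi_iot _ _).trans ?_
    rw [MonoidAlgebra.lift_single, one_smul, hthg]; rfl
  have hβs : Function.Surjective β := by
    intro x
    have hx : x ∈ Algebra.adjoin ℤ {hζ.toInteger} := by rw [cub_adjoin_top hζ]; trivial
    induction hx using Algebra.adjoin_induction with
    | mem y hy => exact ⟨_, hβg.trans (Set.mem_singleton_iff.1 hy).symm⟩
    | algebraMap r => exact ⟨r, by rw [map_intCast]; simp⟩
    | add x y _ _ hx hy =>
      obtain ⟨a, rfl⟩ := hx
      obtain ⟨b, rfl⟩ := hy
      exact ⟨a + b, map_add _ _ _⟩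
    | mul x y _ _ hx hy =>
      obtain ⟨a, rfl⟩ := hx
      obtain ⟨b, rfl⟩ := hy
      exact ⟨a * b, map_mul _ _ _⟩
  have hVr : ∀ r m, V' (r • m) = β r * V' m := fun r m => hVinj _ _ (by
    change algebraMap (𝓞 K) K (V (r • m)) * γ = algebraMap (𝓞 K) K (β r * V m) * γ
    rw [← hV, hj, map_mul, hV, map_mul, hβ]; ring)
  refine cub_rim c' V' (cubAug G) β ?_ hVr ?_ ?_ hβs ?_ mA ?_ (hζ.toInteger - 1)
    (cub_lam_prime hζ hpF.out) (MonoidAlgebra.single g 1 - 1) ?_ ?_ ?_ m0 d ?_ ?_ (cub_unitres hζ)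
  · intro r m
    apply hcinj
    change (c (r • m) : K) * j0 = ((cubAug G r * c m : ℤ) : K) * j0
    rw [← hc, hj, map_mul, hc, cubth_aug]; push_cast; ring
  · intro m h1 h2
    apply hjinj
    apply cub_pairinj hζ ε.toMonoidHom ε.injective
    · rw [hc, show c m = 0 from h1]; simp
    · rw [hV, show V m = 0 from h2]; simp
  · intro r h1 h2
    apply cub_iotaR_inj G
    rw [map_zero]
    apply cub_pairinj hζ ε.toMonoidHom ε.injective
    · rw [cubth_aug, h1, Int.cast_zero]
    · rw [← hβ, h2, map_zero]
  · intro w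
    have hmem : algebraMap (𝓞 K) K w * γ ∈ cubJs hζ ε.toMonoidHom j 1 := by
      rw [hγ, ← Algebra.smul_def]
      exact Submodule.smul_mem _ _ (Submodule.mem_span_singleton_self _)
    have key : ∀ z ∈ cubJs hζ ε.toMonoidHom j 1, ∃ m, cubPsi (cubth hζ ε.toMonoidHom 1) (j m) = z := by
      intro z hz
      rw [cubJs] at hz
      induction hz using Submodule.span_induction with
      | mem x hx => exact hx
      | zero => exact ⟨0, by rw [map_zero, map_zero]⟩
      | add x y _ _ hx hy =>
        obtain ⟨a, rfl⟩ := hx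
        obtain ⟨b, rfl⟩ := hy
        exact ⟨a + b, by rw [map_add, map_add]⟩
      | smul t x _ hx =>
        obtain ⟨a, rfl⟩ := hx
        obtain ⟨r, rfl⟩ := hβs t
        exact ⟨r • a, by rw [hj, map_mul, ← hβ, Algebra.smul_def]⟩
    obtain ⟨m, hm⟩ := key _ hmem
    exact ⟨m, hVinj _ _ (by rw [← hm]; exact (hV m).symm)⟩
  · apply hcinj
    change (c mA : K) * j0 = _
    rw [← hc, hA]; simp
  · rw [map_sub, cubAug_single, map_one, sub_self]
  · rw [map_sub, hβg, map_one]
  · intro r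
    induction r using MonoidAlgebra.induction_linear with
    | zero => simp
    | add x y hx hy =>
      have := dvd_add hx hy
      convert this using 1
      rw [map_add, map_add]; push_cast; ring
    | single h k =>
      have hb : β (MonoidAlgebra.single h k) = (k : 𝓞 K) * hζ.toInteger ^ ((ε h).toAdd.val) := by
        apply hinj
        rw [hβ]
        refine (cubPsi_iot _ _).trans ?_
        rw [MonoidAlgebra.lift_single, zsmul_eq_mul, map_mul, map_intCast, map_pow]
        change _ * cubX hζ (1 * (ε h).toAdd) = _
        rw [one_mul, cubX_val]; rfl
      rw [hb, cubAug_single]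
      have h3 := sub_dvd_pow_sub_pow hζ.toInteger 1 ((ε h).toAdd.val)
      rw [one_pow] at h3
      have := h3.mul_left (k : 𝓞 K)
      convert this using 1; ring
  · exact fun h => hpd (cub_lam_int hζ hpF.out d h)
  · intro m
    refine ⟨r' * f0 m, ?_⟩
    rw [← sub_eq_zero]
    apply hjinj
    rw [map_sub, map_zsmul, hj, zsmul_eq_mul, cubInv_gen j φ hφ hd0 hd, sub_self]
end
end

open CubicStructure in
/-- Let `p` be a prime, `G` a finite abelian group of order `p`, and `2 ≤ n ≤ p`.
Assume Vandiver's conjecture for `p`: `p` does not divide the class number of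
`ℚ(ζ_p + ζ_p⁻¹)`, the maximal real subfield of the `p`-th cyclotomic field.  Then
every invertible `ℤ[G]`-module (finitely generated, projective, with a
tensor-inverse) admitting an `n`-cubic structure is a free `ℤ[G]`-module of rank
one. -/
theorem invertible_module_with_cubic_structure_free_of_vandiver
    (p : ℕ) (hp : p.Prime)
    (G : Type) [CommGroup G] [Fintype G] (hGcard : Nat.card G = p)
    (n : ℕ) (hn2 : 2 ≤ n) (hnp : n ≤ p)
    (hVandiver :
      haveI : NeZero p := ⟨hp.ne_zero⟩
      haveI : IsCyclotomicExtension {p} ℚ (CyclotomicField p ℚ) :=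
        CyclotomicField.isCyclotomicExtension p ℚ
      ¬ p ∣ Nat.card (ClassGroup (NumberField.RingOfIntegers
        (IntermediateField.adjoin ℚ
          {IsCyclotomicExtension.zeta p ℚ (CyclotomicField p ℚ) +
            (IsCyclotomicExtension.zeta p ℚ
              (CyclotomicField p ℚ))⁻¹}))))
    (M : Type) [AddCommGroup M] [Module (R G) M]
    (hfg : Module.Finite (R G) M) (hproj : Module.Projective (R G) M)
    (hinv : ∃ (N : Type) (_ : AddCommGroup N) (_ : Module (R G) N),
      Nonempty ((TensorProduct (R G) M N) ≃ₗ[R G] R G))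
    (hcubic : HasCubicStructure G n M hn2) :
    Nonempty (M ≃ₗ[R G] R G) := by
  have hpF : Fact p.Prime := ⟨hp⟩
  have hne : NeZero p := ⟨hp.ne_zero⟩
  have hcyc : IsCyclotomicExtension {p} ℚ (CyclotomicField p ℚ) :=
    CyclotomicField.isCyclotomicExtension p ℚ
  have hζ : IsPrimitiveRoot (IsCyclotomicExtension.zeta p ℚ (CyclotomicField p ℚ)) p :=
    IsCyclotomicExtension.zeta_spec p ℚ (CyclotomicField p ℚ)
  have hcard2 : Nat.card G = Nat.card (Multiplicative (ZMod p)) := by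
    rw [hGcard, Nat.card_congr Multiplicative.toAdd, Nat.card_zmod]
  have ε : G ≃* Multiplicative (ZMod p) := by
    refine mulEquivOfPrimeCardEq (p := p) hGcard (hcard2.symm.trans hGcard)
  obtain ⟨hI, k, _, fk, mk, hk⟩ := cub_inv hinv
  obtain ⟨m, rfl⟩ : ∃ m, n = m + 2 := ⟨n - 2, by omega⟩
  obtain ⟨a, j, φ, hc, hj, hφ, A1, A2⟩ := cub_front G M hn2 fk mk hk hcubic
  obtain ⟨f0, m0, d, r', hpd, hd⟩ := cub_locgen hGcard fk mk hk
  obtain ⟨γ, hγ⟩ := cub_J1 hζ ε.toMonoidHom j φ hnp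
    (fun hp2 => cub_conj p hp hp2 (CyclotomicField p ℚ) _ hζ hVandiver)
    fk mk hk hφ hpd hd hn2 a hc A1 A2
  refine cub_final hζ j φ ε ?_ hj hφ hpd hd γ hγ
  intro x hx
  rw [← Module.forall_dual_apply_eq_zero_iff (R G) x]
  intro f
  apply cub_iotaR_inj G
  rw [hφ, hx, mul_zero, map_zero]
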